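/- Let n ≥ 1 and let x ∈ S_n be a 2-element. Then there exists a bijection Γ : Irr^x(S_n) → Irr^x(Sub_{S_n}(x)) such that: (I) Γ(χ)(1)_2 = χ(1)_2 for every χ ∈ Irr^x(S_n); (II) Γ(χ)(x) = ±χ(x) for every χ ∈ Irr^x(S_n). -/

import Mathlib

open CategoryTheory

noncomputable section

/-- The set of irreducible complex characters of a group `G`. -/
def Irr (G : Type) [Group G] : Set (G → ℂ) :=
  {χ | ∃ V : FDRep ℂ G, Simple V ∧ V.character = χ}

/-- The irreducible characters of `G` that do not vanish at `g`. -/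
def IrrX (G : Type) [Group G] (g : G) : Set (G → ℂ) :=
  {χ | χ ∈ Irr G ∧ χ g ≠ 0}

/-- The irreducible characters of `G` of degree not divisible by `p`. -/
def IrrP' (p : ℕ) (G : Type) [Group G] : Set (G → ℂ) :=
  {χ | ∃ V : FDRep ℂ G, Simple V ∧ V.character = χ ∧ ¬ (p ∣ Module.finrank ℂ V)}

/-- The degree of a character, recovered from its value at `1`. -/
def charDeg {G : Type} [Group G] (χ : G → ℂ) : ℕ := ⌊(χ 1).re⌋₊

/-- The `p`-part of a natural number. -/
def pPart (p m : ℕ) : ℕ := p ^ (m.factorization p)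

/-- `x` is a picky `p`-element: a `p`-element lying in a unique Sylow `p`-subgroup. -/
def IsPicky (p : ℕ) {G : Type*} [Group G] (x : G) : Prop :=
  (∃ k, orderOf x = p ^ k) ∧ ∃! Q : Sylow p G, x ∈ Q

/-- `H` is a normal subgroup of `K` (both subgroups of an ambient group `G`). -/
def NormalIn {G : Type*} [Group G] (H K : Subgroup G) : Prop :=
  H ≤ K ∧ ∀ k ∈ K, ∀ h ∈ H, k * h * k⁻¹ ∈ H

/-- `H` is subnormal in `K`: there is a finite chain of subgroups from `H` to `K`,
each normal in the next. -/
def IsSubnormalIn {G : Type*} [Group G] (H K : Subgroup G) : Prop :=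
  Relation.ReflTransGen NormalIn H K

/-- The subnormalizer of `x` in `G`: the subgroup generated by all `g` such that
`⟨x⟩` is subnormal in `⟨x, g⟩`. -/
def subnormalizer {G : Type*} [Group G] (x : G) : Subgroup G :=
  Subgroup.closure {g | IsSubnormalIn (Subgroup.zpowers x) (Subgroup.closure {x, g})}

lemma mem_subnormalizer_self {G : Type*} [Group G] (x : G) : x ∈ subnormalizer x :=
  Subgroup.subset_closure (by
    show IsSubnormalIn (Subgroup.zpowers x) (Subgroup.closure {x, x})
    rw [Set.pair_eq_singleton, ← Subgroup.zpowers_eq_closure]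
    exact Relation.ReflTransGen.refl)

/-- The full cycle type of a permutation of `Fin n`: the multiset of the lengths of
all its cycles, with fixed points counted as cycles of length `1`. -/
def fullCycleType {n : ℕ} (x : Equiv.Perm (Fin n)) : Multiset ℕ :=
  x.cycleType + Multiset.replicate (n - x.support.card) 1

/-- The multiset of cycle lengths of a `p`-adic element of `S_n`: `a_i` cycles of
length `p ^ i`, where `n = Σ a_i p ^ i` is the `p`-adic expansion of `n`. -/
def padicCycleMultiset (p n : ℕ) : Multiset ℕ :=
  ∑ i ∈ Finset.range (Nat.digits p n).length,
    Multiset.replicate ((Nat.digits p n).getD i 0) (p ^ i)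

/-- A `p`-adic element of `S_n`. -/
def IsPAdic (p : ℕ) {n : ℕ} (x : Equiv.Perm (Fin n)) : Prop :=
  fullCycleType x = padicCycleMultiset p n

/-- A picky element of Type II: a `2`-adic element on `n - 2` points together with
two fixed points. -/
def IsTypeII {n : ℕ} (x : Equiv.Perm (Fin n)) : Prop :=
  fullCycleType x = padicCycleMultiset 2 (n - 2) + Multiset.replicate 2 1

/-- A picky element of Type III: a `3`-adic element on `n - 3` points together with
three fixed points. -/
def IsTypeIII {n : ℕ} (x : Equiv.Perm (Fin n)) : Prop :=
  fullCycleType x = padicCycleMultiset 3 (n - 3) + Multiset.replicate 3 1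

set_option linter.unusedSectionVars false

section Characters

variable {G : Type} [Group G] [Fintype G]

/-- The bilinear pairing `1/|G| ∑ f(g) f'(g⁻¹)` of functions on a finite group. -/
def pair (f f' : G → ℂ) : ℂ := (Nat.card G : ℂ)⁻¹ * ∑ g, f g * f' g⁻¹

lemma pair_add_left (f₁ f₂ f' : G → ℂ) : pair (f₁ + f₂) f' = pair f₁ f' + pair f₂ f' := by
  simp [pair, add_mul, Finset.sum_add_distrib, mul_add]

lemma pair_smul_left (c : ℂ) (f f' : G → ℂ) : pair (c • f) f' = c * pair f f' := by
  simp only [pair, Pi.smul_apply, smul_eq_mul, Finset.mul_sum]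
  exact Finset.sum_congr rfl fun g _ => by ring

lemma pair_comm (f f' : G → ℂ) : pair f f' = pair f' f := by
  simp only [pair]
  congr 1
  refine Fintype.sum_equiv (Equiv.inv G) _ _ fun g => ?_
  simp [mul_comm]

lemma pair_zsmul_left (c : ℤ) (f f' : G → ℂ) : pair (c • f) f' = c * pair f f' := by
  rw [← pair_smul_left]; congr 1; ext; simp

lemma pair_sum_left {ι : Type*} (s : Finset ι) (f : ι → G → ℂ) (f' : G → ℂ) :
    pair (∑ i ∈ s, f i) f' = ∑ i ∈ s, pair (f i) f' := by
  classical
  induction s using Finset.induction_on with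
  | empty => simp [pair]
  | insert a s ha ih => rw [Finset.sum_insert ha, Finset.sum_insert ha, pair_add_left, ih]

lemma card_ne_zero' : (Nat.card G : ℂ) ≠ 0 := by
  simp

lemma pair_Irr {χ φ : G → ℂ} (hχ : χ ∈ Irr G) (hφ : φ ∈ Irr G) [Decidable (χ = φ)] :
    pair χ φ = if χ = φ then 1 else 0 := by
  obtain ⟨V, hV, rfl⟩ := hχ
  obtain ⟨W, hW, rfl⟩ := hφ
  have : Invertible (Nat.card G : ℂ) := invertibleOfNonzero card_ne_zero'
  split_ifs with h
  · rw [← h]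
    have := FDRep.char_orthonormal V V
    rwa [if_pos ⟨Iso.refl V⟩] at this
  · have := FDRep.char_orthonormal V W
    rwa [if_neg] at this
    rintro ⟨i⟩
    exact h (FDRep.char_iso i)

lemma pair_Irr_self {χ : G → ℂ} (hχ : χ ∈ Irr G) : pair χ χ = 1 := by
  classical
  rw [pair_Irr hχ hχ, if_pos rfl]

lemma mem_Irr_of_norm (V : FDRep ℂ G) (h : pair V.character V.character = 1) :
    V.character ∈ Irr G := by
  refine ⟨V, ?_, rfl⟩
  rw [FDRep.simple_iff_char_is_norm_one]
  rw [pair, inv_mul_eq_one₀ card_ne_zero'] at h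
  exact h.symm

lemma Irr_one {χ : G → ℂ} (hχ : χ ∈ Irr G) : ∃ m : ℕ, 0 < m ∧ χ 1 = m := by
  obtain ⟨V, hV, rfl⟩ := hχ
  refine ⟨Module.finrank ℂ V, ?_, FDRep.char_one V⟩
  rw [Nat.pos_iff_ne_zero]
  intro h
  have h1 := pair_Irr_self (G := G) ⟨V, hV, rfl⟩
  have : Subsingleton V := Module.finrank_zero_iff.mp h
  have h2 : V.character = 0 := by
    ext g
    simp only [FDRep.character]
    rw [Subsingleton.elim (V.ρ g) 0, map_zero]; rfl
  rw [h2] at h1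
  simp [pair] at h1

lemma Irr_conj {χ : G → ℂ} (hχ : χ ∈ Irr G) (g h : G) : χ (h * g * h⁻¹) = χ g := by
  obtain ⟨V, hV, rfl⟩ := hχ
  exact FDRep.char_conj V g h

lemma FDRep_of_character {V : Type} [AddCommGroup V] [Module ℂ V] [Module.Finite ℂ V]
    (ρ : Representation ℂ G V) : (FDRep.of ρ).character = ρ.character := by
  ext g
  rfl

/-- Every character is a sum of irreducible characters. -/
lemma character_mem_closure_aux (n : ℕ) : ∀ (V : Type) [AddCommGroup V] [Module ℂ V]
    [Module.Finite ℂ V] (ρ : Representation ℂ G V), Module.finrank ℂ V ≤ n →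
    ρ.character ∈ AddSubmonoid.closure (Irr G) := by
  induction n with
  | zero =>
    intro V _ _ _ ρ h
    have : Subsingleton V := Module.finrank_zero_iff.mp (Nat.le_zero.mp h)
    have h2 : ρ.character = 0 := by
      ext g
      simp only [Representation.character]
      rw [Subsingleton.elim (ρ g) 0, map_zero]; rfl
    rw [h2]; exact zero_mem _
  | succ n ih =>
    intro V _ _ _ ρ hn
    by_cases hs : Subsingleton V
    · have := Module.finrank_zero_of_subsingleton (R := ℂ) (M := V)
      exact ih V ρ (by omega)
    by_cases hirr : ρ.IsIrreducible
    · apply AddSubmonoid.subset_closure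
      rw [← FDRep_of_character]
      apply mem_Irr_of_norm
      rw [FDRep_of_character]
      have : Invertible (Nat.card G : ℂ) := invertibleOfNonzero card_ne_zero'
      have := Representation.char_orthonormal ρ ρ
      rwa [if_pos ⟨Representation.Equiv.refl ρ⟩] at this
    · have hnt : Nontrivial (Subrepresentation ρ) := by
        refine ⟨⊥, ⊤, fun h => hs ?_⟩
        have h' : (⊥ : Submodule ℂ V) = ⊤ := congrArg Subrepresentation.toSubmodule h
        exact (Submodule.subsingleton_iff ℂ).mp (subsingleton_of_bot_eq_top h')
      obtain ⟨W, hW0, hW1⟩ : ∃ W : Subrepresentation ρ, W ≠ ⊥ ∧ W ≠ ⊤ := by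
        by_contra! h
        exact hirr ⟨fun W => by
          by_cases hb : W = ⊥
          · exact Or.inl hb
          · exact Or.inr (h W hb)⟩
      obtain ⟨W', hW'⟩ := exists_isCompl W
      have hc : IsCompl W.toSubmodule W'.toSubmodule := by
        refine ⟨?_, ?_⟩
        · rw [disjoint_iff]
          have := hW'.1.eq_bot
          rw [← Subrepresentation.toSubmodule_inf, this]; rfl
        · rw [codisjoint_iff]
          have := hW'.2.eq_top
          rw [← Subrepresentation.toSubmodule_sup, this]; rfl
      have hadd := Submodule.finrank_add_eq_of_isCompl hc
      have hp : 0 < Module.finrank ℂ W.toSubmodule := by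
        rw [Nat.pos_iff_ne_zero]
        intro h
        exact hW0 (Subrepresentation.toSubmodule_injective (Submodule.finrank_eq_zero.mp h))
      have hp' : 0 < Module.finrank ℂ W'.toSubmodule := by
        rw [Nat.pos_iff_ne_zero]
        intro h
        have : W' = ⊥ := Subrepresentation.toSubmodule_injective (Submodule.finrank_eq_zero.mp h)
        rw [this] at hW'
        exact hW1 (by simpa using hW'.2.eq_top)
      have key : ρ.character = W.toRepresentation.character + W'.toRepresentation.character := by
        ext g
        simp only [Representation.character, Pi.add_apply]
        rw [← LinearMap.trace_prodMap',
          ← LinearMap.trace_conj' _ (Submodule.prodEquivOfIsCompl _ _ hc)]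
        congr 1
        ext v
        obtain ⟨⟨a, b⟩, rfl⟩ := (Submodule.prodEquivOfIsCompl _ _ hc).surjective v
        simp [LinearEquiv.conj_apply, Subrepresentation.toRepresentation]
      rw [key]
      exact add_mem (ih _ _ (by omega)) (ih _ _ (by omega))

lemma character_mem_closure {V : Type} [AddCommGroup V] [Module ℂ V] [Module.Finite ℂ V]
    (ρ : Representation ℂ G V) : ρ.character ∈ AddSubgroup.closure (Irr G) := by
  have h := character_mem_closure_aux (G := G) _ V ρ le_rfl
  have h2 : AddSubmonoid.closure (Irr G) ≤ (AddSubgroup.closure (Irr G)).toAddSubmonoid :=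
    AddSubmonoid.closure_le.mpr AddSubgroup.subset_closure
  exact h2 h

end Characters

section Virtual

variable {G : Type} [Group G] [Fintype G]

/-- The group of virtual characters. -/
def Virt (G : Type) [Group G] : AddSubgroup (G → ℂ) := AddSubgroup.closure (Irr G)

lemma exists_coeff {f : G → ℂ} (hf : f ∈ Virt G) :
    ∃ a : (Irr G) →₀ ℤ, f = a.sum fun φ n => n • (φ : G → ℂ) := by
  rw [Virt, AddSubgroup.closure] at hf
  rw [← AddSubgroup.closure, ← Submodule.span_int_eq_addSubgroupClosure] at hf
  simp only [Submodule.mem_toAddSubgroup] at hf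
  obtain ⟨a, ha⟩ := (Finsupp.mem_span_iff_linearCombination ℤ (Irr G) f).mp hf
  exact ⟨a, ha.symm⟩

lemma pair_coeff {f : G → ℂ} {a : (Irr G) →₀ ℤ} (h : f = a.sum fun φ n => n • (φ : G → ℂ))
    (φ : Irr G) : pair f φ = a φ := by
  classical
  rw [h, Finsupp.sum, pair_sum_left]
  simp_rw [pair_zsmul_left]
  rw [Finset.sum_eq_single φ]
  · rw [pair_Irr_self φ.2, mul_one]
  · intro ψ _ hne
    rw [pair_Irr ψ.2 φ.2, if_neg (fun h => hne (Subtype.ext h)), mul_zero]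
  · intro h
    rw [Finsupp.notMem_support_iff.mp h]; simp

lemma pair_Virt_int {f f' : G → ℂ} (hf : f ∈ Virt G) (hf' : f' ∈ Virt G) :
    ∃ n : ℤ, pair f f' = n := by
  obtain ⟨a, ha⟩ := exists_coeff hf
  obtain ⟨b, hb⟩ := exists_coeff hf'
  refine ⟨a.sum fun φ n => n * b φ, ?_⟩
  conv_lhs => rw [ha]
  rw [Finsupp.sum, pair_sum_left, Finsupp.sum]
  push_cast
  refine Finset.sum_congr rfl fun φ _ => ?_
  rw [pair_zsmul_left, pair_comm, pair_coeff hb]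

/-- A virtual character of norm one is an irreducible character up to sign. -/
lemma Virt_norm_one {f : G → ℂ} (hf : f ∈ Virt G) (h1 : pair f f = 1) :
    f ∈ Irr G ∨ -f ∈ Irr G := by
  classical
  obtain ⟨a, ha⟩ := exists_coeff hf
  have hsq : ∑ φ ∈ a.support, a φ * a φ = 1 := by
    have : pair f f = ((∑ φ ∈ a.support, a φ * a φ : ℤ) : ℂ) := by
      nth_rewrite 1 [ha]
      rw [Finsupp.sum, pair_sum_left]
      push_cast
      refine Finset.sum_congr rfl fun φ _ => ?_
      rw [pair_zsmul_left, pair_comm, pair_coeff ha]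
    rw [h1] at this
    exact_mod_cast this.symm
  have hle : ∀ φ ∈ a.support, 1 ≤ a φ * a φ := by
    intro φ hφ
    have := Finsupp.mem_support_iff.mp hφ
    have : 0 < a φ * a φ := mul_self_pos.mpr this
    omega
  have hcard : a.support.card ≤ 1 := by
    have := Finset.card_nsmul_le_sum a.support (fun φ => a φ * a φ) 1 hle
    rw [hsq] at this
    simpa using this
  have hne : a.support.Nonempty := by
    rw [Finset.nonempty_iff_ne_empty]
    intro h; rw [h] at hsq; simp at hsq
  obtain ⟨φ, hφ⟩ := Finset.card_eq_one.mp (le_antisymm hcard hne.card_pos)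
  rw [hφ, Finset.sum_singleton] at hsq
  rw [Finsupp.sum, hφ, Finset.sum_singleton] at ha
  rcases Int.isUnit_iff.mp (IsUnit.of_mul_eq_one _ hsq) with h | h
  · left; rw [ha, h, one_smul]; exact φ.2
  · right; rw [ha, h]; simp

/-- An orthonormal, complete family of virtual characters is, up to signs, the family of
irreducible characters. -/
lemma orthonormal_equiv {T : Type} (f : T → G → ℂ) (hv : ∀ t, f t ∈ Virt G)
    (h1 : ∀ t, pair (f t) (f t) = 1) (h0 : ∀ t u, t ≠ u → pair (f t) (f u) = 0)
    (hc : ∀ χ ∈ Irr G, ∃ t, pair χ (f t) ≠ 0) :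
    ∃ e : T ≃ Irr G, ∀ t, ∃ s : ℤ, (s = 1 ∨ s = -1) ∧ (e t : G → ℂ) = s • f t := by
  classical
  have h : ∀ t, ∃ φ : Irr G, ∃ s : ℤ, (s = 1 ∨ s = -1) ∧ (φ : G → ℂ) = s • f t := by
    intro t
    rcases Virt_norm_one (hv t) (h1 t) with h | h
    · exact ⟨⟨_, h⟩, 1, Or.inl rfl, by simp⟩
    · exact ⟨⟨_, h⟩, -1, Or.inr rfl, by simp⟩
  choose e s hs he using h
  refine ⟨Equiv.ofBijective e ⟨?_, ?_⟩, fun t => ⟨s t, hs t, he t⟩⟩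
  · intro t u htu
    by_contra hne
    have := pair_Irr_self (e t).2
    rw [he t, pair_zsmul_left, pair_comm, ← he t, htu, he u, pair_zsmul_left, pair_comm,
      h0 t u hne] at this
    simp at this
  · intro χ
    obtain ⟨t, ht⟩ := hc χ χ.2
    refine ⟨t, ?_⟩
    by_contra hne
    apply ht
    have h2 : f t = s t • (e t : G → ℂ) := by
      rw [he t, smul_smul]
      rcases hs t with h | h <;> simp [h]
    rw [h2, pair_comm, pair_zsmul_left, pair_Irr (e t).2 χ.2,
      if_neg (fun h => hne (Subtype.ext h)), mul_zero]

/-- The permutation representation on functions. -/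
def permRep (G : Type) [Group G] (X : Type) [MulAction G X] : Representation ℂ G (X → ℂ) where
  toFun g := LinearMap.funLeft ℂ ℂ fun x => g⁻¹ • x
  map_one' := by ext; simp [LinearMap.funLeft_apply]
  map_mul' g h := by
    ext f x
    simp [LinearMap.funLeft_apply, mul_smul]

/-- The character of a permutation representation counts fixed points. -/
lemma fixedPoints_mem_Virt {X : Type} [Fintype X] [DecidableEq X] [MulAction G X] :
    (fun g : G => ((Finset.univ.filter fun x : X => g • x = x).card : ℂ)) ∈ Virt G := by
  have hm := character_mem_closure (permRep G X)
  suffices h : (fun g : G => ((Finset.univ.filter fun x : X => g • x = x).card : ℂ)) =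
      (permRep G X).character by rw [h]; exact hm
  ext g
  change _ = LinearMap.trace ℂ _ (permRep G X g)
  rw [LinearMap.trace_eq_matrix_trace ℂ (Pi.basisFun ℂ X), Matrix.trace]
  simp only [Matrix.diag_apply, LinearMap.toMatrix_apply]
  simp only [permRep, MonoidHom.coe_mk, OneHom.coe_mk, LinearMap.funLeft_apply,
    Pi.basisFun_apply, Pi.basisFun_repr, Pi.single_apply, inv_smul_eq_iff, Finset.sum_boole]
  simp only [eq_comm]

lemma reg_mem_Virt [DecidableEq G] :
    (fun g : G => if g = 1 then (Fintype.card G : ℂ) else 0) ∈ Virt G := by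
  suffices h' : (fun g : G => if g = 1 then (Fintype.card G : ℂ) else 0) =
      (fun g : G => ((Finset.univ.filter fun x : G => g • x = x).card : ℂ)) by
    rw [h']; exact fixedPoints_mem_Virt
  ext g
  split_ifs with h
  · simp [h]
  · simp [h]

lemma pair_reg [DecidableEq G] (f : G → ℂ) :
    pair (fun g : G => if g = 1 then (Fintype.card G : ℂ) else 0) f = f 1 := by
  simp [pair]

/-- The regular character decomposed. -/
lemma exists_reg_decomp [DecidableEq G] : ∃ s : Finset (Irr G), (∀ φ, φ ∈ s) ∧
    ∀ g : G, ∑ φ ∈ s, (φ : G → ℂ) 1 * (φ : G → ℂ) g =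
      if g = 1 then (Fintype.card G : ℂ) else 0 := by
  obtain ⟨a, ha⟩ := exists_coeff (reg_mem_Virt (G := G))
  have hc : ∀ φ : Irr G, (a φ : ℂ) = (φ : G → ℂ) 1 := fun φ => by
    rw [← pair_coeff ha φ, pair_reg]
  refine ⟨a.support, fun φ => ?_, fun g => ?_⟩
  · rw [Finsupp.mem_support_iff]
    intro h
    obtain ⟨m, hm, h1⟩ := Irr_one φ.2
    have := hc φ
    rw [h, h1] at this
    norm_cast at this
    omega
  · have := congrFun ha g
    simp only [Finsupp.sum] at this
    rw [this]
    simp [hc]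

instance : Finite (Irr G) := by
  classical
  obtain ⟨s, hs, -⟩ := exists_reg_decomp (G := G)
  exact Set.finite_univ_iff.mp (s.finite_toSet.subset fun φ _ => hs φ)

instance : Fintype (Irr G) := Fintype.ofFinite _

lemma sum_Irr_one [DecidableEq G] (g : G) :
    ∑ φ : Irr G, (φ : G → ℂ) 1 * (φ : G → ℂ) g = if g = 1 then (Fintype.card G : ℂ) else 0 := by
  classical
  obtain ⟨s, hs, h⟩ := exists_reg_decomp (G := G)
  rw [← h g, Finset.eq_univ_iff_forall.mpr hs]

end Virtual

section Transport

variable {G H : Type} [Group G] [Group H] [Fintype G] [Fintype H]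

lemma Irr_comp_mulEquiv (e : G ≃* H) {χ : H → ℂ} (hχ : χ ∈ Irr H) : χ ∘ e ∈ Irr G := by
  have hn := pair_Irr_self hχ
  obtain ⟨V, hV, rfl⟩ := hχ
  have : V.character ∘ e = (FDRep.of (V.ρ.comp e.toMonoidHom)).character := rfl
  rw [this]
  apply mem_Irr_of_norm
  rw [← hn, ← this, pair, pair, Nat.card_congr e.toEquiv]
  congr 1
  refine Fintype.sum_equiv e.toEquiv _ _ fun g => ?_
  simp

/-- Irreducible characters of a direct product. -/
lemma Irr_prod {χ : G → ℂ} {φ : H → ℂ} (hχ : χ ∈ Irr G) (hφ : φ ∈ Irr H) :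
    (fun x : G × H => χ x.1 * φ x.2) ∈ Irr (G × H) := by
  have h1 := pair_Irr_self hχ
  have h2 := pair_Irr_self hφ
  obtain ⟨V, hV, rfl⟩ := hχ
  obtain ⟨W, hW, rfl⟩ := hφ
  let ρ := Representation.tprod (V.ρ.comp (MonoidHom.fst G H)) (W.ρ.comp (MonoidHom.snd G H))
  have : (fun x : G × H => V.character x.1 * W.character x.2) = (FDRep.of ρ).character := by
    rw [FDRep_of_character, Representation.char_tensor]; rfl
  rw [this]
  apply mem_Irr_of_norm
  rw [← this]
  rw [pair] at h1 h2 ⊢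
  rw [← mul_one (1 : ℂ)]
  nth_rewrite 1 [← h1]
  rw [← h2, Fintype.sum_prod_type, Nat.card_prod, Nat.cast_mul, mul_inv]
  rw [show ∀ a b c d : ℂ, a * b * (c * d) = (a * c) * (b * d) by intros; ring,
    Finset.sum_mul_sum, Finset.mul_sum, Finset.mul_sum]
  refine Finset.sum_congr rfl fun a _ => ?_
  rw [Finset.mul_sum, Finset.mul_sum]
  refine Finset.sum_congr rfl fun b _ => ?_
  simp only [Prod.fst_inv, Prod.snd_inv]
  ring

lemma pair_prod (f f' : G → ℂ) (k k' : H → ℂ) :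
    pair (fun x : G × H => f x.1 * k x.2) (fun x => f' x.1 * k' x.2) = pair f f' * pair k k' := by
  simp only [pair, Fintype.sum_prod_type, Nat.card_prod, Nat.cast_mul, mul_inv]
  rw [show ∀ a b c d : ℂ, a * b * (c * d) = (a * c) * (b * d) by intros; ring,
    Finset.sum_mul_sum, Finset.mul_sum, Finset.mul_sum]
  refine Finset.sum_congr rfl fun a _ => ?_
  rw [Finset.mul_sum, Finset.mul_sum]
  refine Finset.sum_congr rfl fun b _ => ?_
  simp only [Prod.fst_inv, Prod.snd_inv]
  ring

lemma pair_one_of_sum [DecidableEq G] {T : Type} [Fintype T] (f : T → G → ℂ) (a : T → ℂ)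
    (h : ∀ g, ∑ t, a t * f t g = if g = 1 then (Fintype.card G : ℂ) else 0)
    {χ : G → ℂ} (hχ : χ ∈ Irr G) : ∃ t, pair χ (f t) ≠ 0 := by
  by_contra! h0
  have h1 : pair (∑ t, a t • f t) χ = 0 := by
    rw [pair_sum_left]
    exact Finset.sum_eq_zero fun t _ => by rw [pair_smul_left, pair_comm, h0, mul_zero]
  have h2 : ∑ t, a t • f t = fun g : G => if g = 1 then (Fintype.card G : ℂ) else 0 := by
    ext g; simpa using h g
  rw [h2, pair_reg] at h1
  obtain ⟨m, hm, hm1⟩ := Irr_one hχ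
  rw [hm1] at h1
  norm_cast at h1
  omega

/-- Every irreducible character of a direct product is a product of irreducible characters. -/
lemma Irr_prod_surj {χ : G × H → ℂ} (hχ : χ ∈ Irr (G × H)) :
    ∃ φ ∈ Irr G, ∃ ψ ∈ Irr H, χ = fun x => φ x.1 * ψ x.2 := by
  classical
  obtain ⟨⟨φ, ψ⟩, h⟩ := pair_one_of_sum (G := G × H)
    (fun (t : Irr G × Irr H) x => (t.1 : G → ℂ) x.1 * (t.2 : H → ℂ) x.2)
    (fun t => (t.1 : G → ℂ) 1 * (t.2 : H → ℂ) 1) (fun x => by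
      have e1 := sum_Irr_one (G := G) x.1
      have e2 := sum_Irr_one (G := H) x.2
      have : ∀ t : Irr G × Irr H, (t.1 : G → ℂ) 1 * (t.2 : H → ℂ) 1 *
          ((t.1 : G → ℂ) x.1 * (t.2 : H → ℂ) x.2) =
          ((t.1 : G → ℂ) 1 * (t.1 : G → ℂ) x.1) * ((t.2 : H → ℂ) 1 * (t.2 : H → ℂ) x.2) := by
        intro t; ring
      simp_rw [this]
      rw [Fintype.sum_prod_type]
      simp only []
      rw [← Fintype.sum_mul_sum, e1, e2]
      by_cases h1 : x.1 = 1 <;> by_cases h2 : x.2 = 1 <;> simp [h1, h2, Prod.ext_iff]) hχ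
  refine ⟨φ, φ.2, ψ, ψ.2, ?_⟩
  by_contra hne
  apply h
  rw [pair_Irr hχ (Irr_prod φ.2 ψ.2), if_neg hne]

end Transport

section Wreath

/-- The wreath product of a group with the group of order two. -/
@[ext]
structure Wr (K : Type) where
  /-- first base component -/
  a : K
  /-- second base component -/
  b : K
  /-- whether the top component is the nontrivial one -/
  s : Bool

variable {K : Type} [Group K]

instance : Mul (Wr K) :=
  ⟨fun x y => if x.s then ⟨x.a * y.b, x.b * y.a, !y.s⟩ else ⟨x.a * y.a, x.b * y.b, y.s⟩⟩
instance : One (Wr K) := ⟨⟨1, 1, false⟩⟩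
instance : Inv (Wr K) := ⟨fun x => if x.s then ⟨x.b⁻¹, x.a⁻¹, true⟩ else ⟨x.a⁻¹, x.b⁻¹, false⟩⟩

lemma Wr.mul_def (x y : Wr K) : x * y =
  if x.s then ⟨x.a * y.b, x.b * y.a, !y.s⟩ else ⟨x.a * y.a, x.b * y.b, y.s⟩ := rfl
lemma Wr.one_def : (1 : Wr K) = ⟨1, 1, false⟩ := rfl
lemma Wr.inv_def (x : Wr K) : x⁻¹ =
  if x.s then ⟨x.b⁻¹, x.a⁻¹, true⟩ else ⟨x.a⁻¹, x.b⁻¹, false⟩ := rfl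

instance : Group (Wr K) := Group.ofLeftAxioms
  (by
    rintro ⟨a, b, s⟩ ⟨c, d, t⟩ ⟨e, f, u⟩
    cases s <;> cases t <;> simp [Wr.mul_def, mul_assoc])
  (by rintro ⟨a, b, s⟩; simp [Wr.mul_def, Wr.one_def])
  (by rintro ⟨a, b, s⟩; cases s <;> simp [Wr.mul_def, Wr.one_def, Wr.inv_def])

/-- The underlying type of a wreath product. -/
def Wr.equivProd (K : Type) : Wr K ≃ (K × K) × Bool where
  toFun x := ((x.a, x.b), x.s)
  invFun p := ⟨p.1.1, p.1.2, p.2⟩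
  left_inv _ := rfl
  right_inv _ := rfl

instance [Fintype K] : Fintype (Wr K) := Fintype.ofEquiv _ (Wr.equivProd K).symm

lemma Wr.sum_eq [Fintype K] (f : Wr K → ℂ) :
    ∑ x, f x = ∑ a, ∑ b, f ⟨a, b, false⟩ + ∑ a, ∑ b, f ⟨a, b, true⟩ := by
  rw [← Equiv.sum_comp (Wr.equivProd K).symm, Fintype.sum_prod_type]
  simp only [Fintype.sum_bool, Fintype.sum_prod_type, Wr.equivProd, Equiv.coe_fn_symm_mk]
  simp only [Finset.sum_add_distrib]
  rw [add_comm]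

lemma Wr.card [Fintype K] : (Nat.card (Wr K) : ℂ) = 2 * (Nat.card K : ℂ) ^ 2 := by
  rw [Nat.card_congr (Wr.equivProd K)]
  simp; ring

lemma trace_map_comp_comm {V : Type} [AddCommGroup V] [Module ℂ V] [Module.Finite ℂ V]
    (f g : V →ₗ[ℂ] V) : LinearMap.trace ℂ _
      (TensorProduct.map f g ∘ₗ (TensorProduct.comm ℂ V V).toLinearMap) =
      LinearMap.trace ℂ V (f * g) := by
  let b := Module.finBasis ℂ V
  rw [LinearMap.trace_eq_matrix_trace ℂ (b.tensorProduct b),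
    LinearMap.trace_eq_matrix_trace ℂ b, LinearMap.toMatrix_mul, Matrix.trace, Matrix.trace,
    Fintype.sum_prod_type]
  refine Finset.sum_congr rfl fun i _ => ?_
  rw [Matrix.diag_apply, Matrix.mul_apply]
  refine Finset.sum_congr rfl fun j _ => ?_
  simp [LinearMap.toMatrix_apply, mul_comm]

/-- The representation of the wreath product on a tensor square, twisted by a sign. -/
def Wr.rep {V : Type} [AddCommGroup V] [Module ℂ V] (ρ : Representation ℂ K V) (ε : ℤˣ) :
    Representation ℂ (Wr K) (TensorProduct ℂ V V) where
  toFun x := if x.s then (ε : ℤ) • (TensorProduct.map (ρ x.a) (ρ x.b) ∘ₗ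
      (TensorProduct.comm ℂ V V).toLinearMap) else TensorProduct.map (ρ x.a) (ρ x.b)
  map_one' := by
    ext; simp [Wr.one_def]
  map_mul' := by
    have hε : (ε : ℤ) * ε = 1 := by
      rcases Int.units_eq_one_or ε with h | h <;> simp [h]
    rintro ⟨a, b, s⟩ ⟨c, d, t⟩
    cases s <;> cases t <;> ext u v <;> simp [Wr.mul_def, smul_smul, hε]

lemma Wr.rep_character {V : Type} [AddCommGroup V] [Module ℂ V] [Module.Finite ℂ V]
    (ρ : Representation ℂ K V) (ε : ℤˣ) (x : Wr K) : (Wr.rep ρ ε).character x =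
      if x.s then (ε : ℤ) * ρ.character (x.a * x.b) else ρ.character x.a * ρ.character x.b := by
  change LinearMap.trace ℂ _ (Wr.rep ρ ε x) = _
  simp only [Wr.rep, MonoidHom.coe_mk, OneHom.coe_mk]
  split_ifs with h
  · rw [map_zsmul, trace_map_comp_comm]
    simp [Representation.character]
  · rw [LinearMap.trace_tensorProduct']
    rfl

/-- The class function on the wreath product extending `χ × χ`. -/
def Wr.sq (χ : K → ℂ) (ε : ℤˣ) : Wr K → ℂ :=
  fun x => if x.s then (ε : ℤ) * χ (x.a * x.b) else χ x.a * χ x.b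

/-- The class function on the wreath product induced from `φ × ψ`. -/
def Wr.ind (φ ψ : K → ℂ) : Wr K → ℂ :=
  fun x => if x.s then 0 else φ x.a * ψ x.b + ψ x.a * φ x.b

variable [Fintype K]

lemma sum_mul_left_eq {f : K → ℂ} : ∑ a, ∑ b, f (a * b) = (Nat.card K : ℂ) * ∑ b, f b := by
  have : ∀ a, ∑ b, f (a * b) = ∑ b, f b := fun a =>
    Fintype.sum_equiv (Equiv.mulLeft a) _ _ fun _ => rfl
  simp [this]

lemma Wr.pair_sq_sq (χ φ : K → ℂ) (ε ε' : ℤˣ) :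
    pair (Wr.sq χ ε) (Wr.sq φ ε') =
      (pair χ φ ^ 2 + ((ε * ε' : ℤ) : ℂ) * pair χ φ) / 2 := by
  have hK : (Nat.card K : ℂ) ≠ 0 := card_ne_zero'
  have e1 : ∑ a, ∑ b, Wr.sq χ ε ⟨a, b, false⟩ * Wr.sq φ ε' (⟨a, b, false⟩ : Wr K)⁻¹ =
      (∑ a, χ a * φ a⁻¹) ^ 2 := by
    rw [pow_two, Fintype.sum_mul_sum]
    refine Finset.sum_congr rfl fun a _ => Finset.sum_congr rfl fun b _ => ?_
    simp [Wr.sq, Wr.inv_def]; ring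
  have e2 : ∑ a, ∑ b, Wr.sq χ ε ⟨a, b, true⟩ * Wr.sq φ ε' (⟨a, b, true⟩ : Wr K)⁻¹ =
      (Nat.card K : ℂ) * (((ε * ε' : ℤ) : ℂ) * ∑ a, χ a * φ a⁻¹) := by
    rw [mul_left_comm, ← sum_mul_left_eq (f := fun a => χ a * φ a⁻¹), Finset.mul_sum]
    refine Finset.sum_congr rfl fun a _ => ?_
    rw [Finset.mul_sum]
    refine Finset.sum_congr rfl fun b _ => ?_
    simp [Wr.sq, Wr.inv_def]; ring
  rw [pair, Wr.sum_eq, e1, e2, Wr.card, pair]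
  field_simp

lemma Wr.pair_ind_sq (φ ψ χ : K → ℂ) (ε : ℤˣ) :
    pair (Wr.ind φ ψ) (Wr.sq χ ε) = pair φ χ * pair ψ χ := by
  have hK : (Nat.card K : ℂ) ≠ 0 := card_ne_zero'
  have e1 : ∑ a, ∑ b, Wr.ind φ ψ ⟨a, b, false⟩ * Wr.sq χ ε (⟨a, b, false⟩ : Wr K)⁻¹ =
      (∑ a, φ a * χ a⁻¹) * (∑ a, ψ a * χ a⁻¹) + (∑ a, ψ a * χ a⁻¹) * (∑ a, φ a * χ a⁻¹) := by
    rw [Fintype.sum_mul_sum, Fintype.sum_mul_sum, ← Finset.sum_add_distrib]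
    refine Finset.sum_congr rfl fun a _ => ?_
    rw [← Finset.sum_add_distrib]
    refine Finset.sum_congr rfl fun b _ => ?_
    simp [Wr.sq, Wr.ind, Wr.inv_def]; ring
  have e2 : ∑ a, ∑ b, Wr.ind φ ψ ⟨a, b, true⟩ * Wr.sq χ ε (⟨a, b, true⟩ : Wr K)⁻¹ = 0 := by
    simp [Wr.ind]
  rw [pair, Wr.sum_eq, e1, e2, Wr.card, pair, pair]
  field_simp
  ring

lemma Wr.pair_ind_ind (φ ψ φ' ψ' : K → ℂ) :
    pair (Wr.ind φ ψ) (Wr.ind φ' ψ') = pair φ φ' * pair ψ ψ' + pair φ ψ' * pair ψ φ' := by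
  have hK : (Nat.card K : ℂ) ≠ 0 := card_ne_zero'
  have e1 : ∑ a, ∑ b, Wr.ind φ ψ ⟨a, b, false⟩ * Wr.ind φ' ψ' (⟨a, b, false⟩ : Wr K)⁻¹ =
      ((∑ a, φ a * φ' a⁻¹) * (∑ a, ψ a * ψ' a⁻¹) + (∑ a, φ a * ψ' a⁻¹) * (∑ a, ψ a * φ' a⁻¹)) +
      ((∑ a, ψ a * φ' a⁻¹) * (∑ a, φ a * ψ' a⁻¹) + (∑ a, ψ a * ψ' a⁻¹) * (∑ a, φ a * φ' a⁻¹))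
      := by
    simp only [Fintype.sum_mul_sum, ← Finset.sum_add_distrib]
    refine Finset.sum_congr rfl fun a _ => Finset.sum_congr rfl fun b _ => ?_
    simp [Wr.ind, Wr.inv_def]; ring
  have e2 : ∑ a, ∑ b, Wr.ind φ ψ ⟨a, b, true⟩ * Wr.ind φ' ψ' (⟨a, b, true⟩ : Wr K)⁻¹ = 0 := by
    simp [Wr.ind]
  rw [pair, Wr.sum_eq, e1, e2, Wr.card]
  simp only [pair]
  field_simp
  ring

lemma Wr.sq_mem_Virt {V : Type} [AddCommGroup V] [Module ℂ V] [Module.Finite ℂ V]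
    (ρ : Representation ℂ K V) (ε : ℤˣ) : Wr.sq ρ.character ε ∈ Virt (Wr K) := by
  have h : Wr.sq ρ.character ε = (Wr.rep ρ ε).character := by
    ext x
    rw [Wr.rep_character]; rfl
  rw [h]
  exact character_mem_closure (Wr.rep ρ ε)

lemma Wr.sq_mem_Irr {χ : K → ℂ} (hχ : χ ∈ Irr K) (ε : ℤˣ) : Wr.sq χ ε ∈ Irr (Wr K) := by
  have h1 := pair_Irr_self hχ
  obtain ⟨V, hV, rfl⟩ := hχ
  have h2 : Wr.sq V.character ε = (FDRep.of (Wr.rep V.ρ ε)).character := by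
    rw [FDRep_of_character]; ext x; rw [Wr.rep_character]; rfl
  rw [h2]
  apply mem_Irr_of_norm
  rw [← h2, Wr.pair_sq_sq, h1]
  rcases Int.units_eq_one_or ε with h | h <;> simp [h]

lemma Wr.ind_mem_Irr {φ ψ : K → ℂ} (hφ : φ ∈ Irr K) (hψ : ψ ∈ Irr K) (hne : φ ≠ ψ) :
    Wr.ind φ ψ ∈ Irr (Wr K) := by
  classical
  have hp : pair (Wr.ind φ ψ) (Wr.ind φ ψ) = 1 := by
    rw [Wr.pair_ind_ind, pair_Irr_self hφ, pair_Irr_self hψ, pair_Irr hφ hψ, if_neg hne]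
    simp
  have h1 := Irr_one hφ
  have h2 := Irr_one hψ
  have hv : Wr.ind φ ψ ∈ Virt (Wr K) := by
    obtain ⟨V, hV, rfl⟩ := hφ
    obtain ⟨W, hW, rfl⟩ := hψ
    let σ : Representation ℂ K (V × W) := Representation.prod V.ρ W.ρ
    have hσ : σ.character = V.character + W.character := by
      ext g
      exact LinearMap.trace_prodMap' (V.ρ g) (W.ρ g)
    have e := sub_mem (sub_mem (Wr.sq_mem_Virt σ 1) (Wr.sq_mem_Virt V.ρ 1))
      (Wr.sq_mem_Virt W.ρ 1)
    suffices h : Wr.ind V.character W.character = Wr.sq σ.character 1 - Wr.sq V.character 1 -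
        Wr.sq W.character 1 by rw [h]; exact e
    ext x
    rw [hσ]
    change _ = Wr.sq (V.character + W.character) 1 x - Wr.sq V.character 1 x -
      Wr.sq W.character 1 x
    change (if x.s then _ else _) = (if x.s then _ else _) - (if x.s then _ else _) - (if x.s then _ else _)
    simp only [Pi.add_apply, Units.val_one, Int.cast_one, one_mul]
    split_ifs <;> ring
  rcases Virt_norm_one hv hp with h | h
  · exact h
  · exfalso
    obtain ⟨m, hm, hm1⟩ := Irr_one h
    obtain ⟨k, hk, hk1⟩ := h1
    obtain ⟨l, hl, hl1⟩ := h2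
    simp only [Pi.neg_apply, Wr.ind, Wr.one_def, hk1, hl1] at hm1
    have : (m : ℂ) + (k * l + l * k) = 0 := by rw [← hm1]; simp
    norm_cast at this
    omega

/-- All irreducible characters of a wreath product with the group of order two. -/
lemma Wr.Irr_surj {χ : Wr K → ℂ} (hχ : χ ∈ Irr (Wr K)) :
    (∃ φ ∈ Irr K, ∃ ε, χ = Wr.sq φ ε) ∨
    ∃ φ ∈ Irr K, ∃ ψ ∈ Irr K, φ ≠ ψ ∧ χ = Wr.ind φ ψ := by
  classical
  let F : Irr K → Irr K → Bool → Wr K → ℂ := fun φ ψ β =>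
    if φ = ψ then Wr.sq φ (cond β 1 (-1)) else Wr.ind φ ψ
  let c : Irr K → Irr K → ℂ := fun φ ψ => if φ = ψ then ((φ : K → ℂ) 1) ^ 2 else
        (φ : K → ℂ) 1 * (ψ : K → ℂ) 1 / 2
  have hF : ∀ x, ∀ φ ψ, c φ ψ * F φ ψ true x + c φ ψ * F φ ψ false x =
      if x.s then 0 else ((φ : K → ℂ) 1 * (φ : K → ℂ) x.a) * ((ψ : K → ℂ) 1 * (ψ : K → ℂ) x.b) +
            ((φ : K → ℂ) 1 * (φ : K → ℂ) x.b) * ((ψ : K → ℂ) 1 * (ψ : K → ℂ) x.a) := by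
    rintro ⟨a, b, s⟩ φ ψ
    by_cases h : φ = ψ
    · subst h
      cases s
      · simp [F, c, Wr.sq]; ring
      · simp [F, c, Wr.sq]
    · cases s
      · simp [F, c, h, Wr.ind]; ring
      · simp [F, c, h, Wr.ind]
  obtain ⟨⟨φ, ψ, β⟩, ht⟩ := pair_one_of_sum (G := Wr K)
    (fun (t : Irr K × Irr K × Bool) => F t.1 t.2.1 t.2.2) (fun t => c t.1 t.2.1) (fun x => by
      rw [Fintype.sum_prod_type]
      simp only [Fintype.sum_prod_type, Fintype.sum_bool, hF]
      obtain ⟨a, b, s⟩ := x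
      cases s
      · simp only [Bool.false_eq_true, if_false, Finset.sum_add_distrib]
        rw [← Fintype.sum_mul_sum, ← Fintype.sum_mul_sum, sum_Irr_one, sum_Irr_one]
        have hc : (Fintype.card (Wr K) : ℂ) = 2 * (Fintype.card K : ℂ) ^ 2 := by
          have := Wr.card (K := K)
          simpa using this
        rw [hc]
        by_cases h1 : a = 1 <;> by_cases h2 : b = 1 <;> simp [h1, h2, Wr.one_def]
        ring
      · simp [Wr.one_def]) hχ
  by_cases h : φ = ψ
  · left
    refine ⟨φ, φ.2, cond β 1 (-1), ?_⟩
    by_contra hne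
    apply ht
    simp only [F, if_pos h]
    rw [pair_Irr hχ (Wr.sq_mem_Irr φ.2 _), if_neg hne]
  · right
    have h' : (φ : K → ℂ) ≠ ψ := fun h' => h (Subtype.ext h')
    refine ⟨φ, φ.2, ψ, ψ.2, h', ?_⟩
    by_contra hne
    apply ht
    simp only [F, if_neg h]
    rw [pair_Irr hχ (Wr.ind_mem_Irr φ.2 ψ.2 h'), if_neg hne]

end Wreath

section Realizes

/-- The data `(v, w, d)` describes, up to common signs, the values at `y` and `c` and the `2`-adic
valuations of the degrees of a family of irreducible characters of `G` containing all those
which do not vanish at both `y` and `c`. -/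
def Realizes {G : Type} [Group G] (y c : G) {ι : Type} (v w : ι → ℤ) (d : ι → ℕ) : Prop :=
  ∃ e : ι → G → ℂ, Function.Injective e ∧ (∀ i, e i ∈ Irr G) ∧
    (∀ i, ∃ s : ℤ, (s = 1 ∨ s = -1) ∧ e i y = (s * v i : ℤ) ∧ e i c = (s * w i : ℤ)) ∧
    (∀ i, ∃ m : ℕ, e i 1 = m ∧ padicValNat 2 m = d i) ∧
    ∀ χ ∈ Irr G, χ ∉ Set.range e → χ y = 0 ∧ χ c = 0

variable {G : Type} [Group G] {y c : G} {ι : Type} {v w : ι → ℤ} {d : ι → ℕ}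

lemma Realizes.restrict (h : Realizes y c v w d) (p : ι → Prop)
    (hp : ∀ i, ¬ p i → v i = 0 ∧ w i = 0) :
    Realizes y c (fun i : {i // p i} => v i) (fun i => w i) (fun i => d i) := by
  obtain ⟨e, hi, hirr, hval, hdeg, hrest⟩ := h
  refine ⟨fun i => e i, hi.comp Subtype.val_injective, fun i => hirr i, fun i => hval i,
    fun i => hdeg i, fun χ hχ hn => ?_⟩
  by_cases hr : χ ∈ Set.range e
  · obtain ⟨i, rfl⟩ := hr
    have hpi : ¬ p i := fun hpi => hn ⟨⟨i, hpi⟩, rfl⟩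
    obtain ⟨s, -, h1, h2⟩ := hval i
    rw [h1, h2, (hp i hpi).1, (hp i hpi).2]
    simp
  · exact hrest χ hχ hr

lemma Realizes.fst (h : Realizes y c v w d) : Realizes y y v v d := by
  obtain ⟨e, hi, hirr, hval, hdeg, hrest⟩ := h
  refine ⟨e, hi, hirr, fun i => ?_, hdeg, fun χ hχ hn => ⟨(hrest χ hχ hn).1, (hrest χ hχ hn).1⟩⟩
  obtain ⟨s, hs, h1, -⟩ := hval i
  exact ⟨s, hs, h1, h1⟩

lemma Realizes.snd (h : Realizes y c v w d) : Realizes c c w w d := by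
  obtain ⟨e, hi, hirr, hval, hdeg, hrest⟩ := h
  refine ⟨e, hi, hirr, fun i => ?_, hdeg, fun χ hχ hn => ⟨(hrest χ hχ hn).2, (hrest χ hχ hn).2⟩⟩
  obtain ⟨s, hs, -, h1⟩ := hval i
  exact ⟨s, hs, h1, h1⟩

lemma Realizes.congr [Fintype G] {H : Type} [Group H] [Fintype H] (h : Realizes y c v w d)
    (f : G ≃* H) : Realizes (f y) (f c) v w d := by
  obtain ⟨e, hi, hirr, hval, hdeg, hrest⟩ := h
  refine ⟨fun i => e i ∘ f.symm, ?_, fun i => Irr_comp_mulEquiv f.symm (hirr i), fun i => ?_,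
    fun i => ?_, fun χ hχ hn => ?_⟩
  · intro i j hij
    apply hi
    ext x
    simpa using congrFun hij (f x)
  · simpa using hval i
  · simpa using hdeg i
  · have := hrest (χ ∘ f) (Irr_comp_mulEquiv f hχ) (fun ⟨i, h⟩ => hn ⟨i, by
      ext x
      simp [h]⟩)
    simpa using this

lemma Realizes.prod [Fintype G] {H : Type} [Group H] [Fintype H] {z : H} {κ : Type} {u : κ → ℤ}
    {d' : κ → ℕ} (h : Realizes y y v v d) (h' : Realizes z z u u d') :
    Realizes (y, z) (y, z) (fun p : ι × κ => v p.1 * u p.2) (fun p => v p.1 * u p.2)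
      (fun p => d p.1 + d' p.2) := by
  obtain ⟨e, hi, hirr, hval, hdeg, hrest⟩ := h
  obtain ⟨f, hi', hirr', hval', hdeg', hrest'⟩ := h'
  refine ⟨fun p x => e p.1 x.1 * f p.2 x.2, ?_, fun p => Irr_prod (hirr _) (hirr' _), ?_, ?_, ?_⟩
  · classical
    rintro ⟨i, j⟩ ⟨i', j'⟩ hij
    have hp := pair_Irr_self (Irr_prod (hirr i) (hirr' j))
    have h2 : (fun x : G × H => e i x.1 * f j x.2) = fun x => e i' x.1 * f j' x.2 := hij
    nth_rewrite 2 [h2] at hp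
    rw [pair_prod, pair_Irr (hirr _) (hirr _), pair_Irr (hirr' _) (hirr' _)] at hp
    by_cases h1 : e i = e i' <;> by_cases h3 : f j = f j' <;> simp [h1, h3] at hp
    rw [hi h1, hi' h3]
  · rintro ⟨i, j⟩
    obtain ⟨s, hs, h1, -⟩ := hval i
    obtain ⟨t, ht, h2, -⟩ := hval' j
    refine ⟨s * t, ?_, ?_, ?_⟩
    · rcases hs with rfl | rfl <;> rcases ht with rfl | rfl <;> simp
    all_goals simp only [h1, h2]; push_cast; ring
  · rintro ⟨i, j⟩
    obtain ⟨m, hm, h1⟩ := hdeg i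
    obtain ⟨k, hk, h2⟩ := hdeg' j
    refine ⟨m * k, by simp [hm, hk], ?_⟩
    obtain ⟨m', hm', e1⟩ := Irr_one (hirr i)
    obtain ⟨k', hk', e2⟩ := Irr_one (hirr' j)
    have e1 : m = m' := by rw [hm] at e1; exact_mod_cast e1
    have e2 : k = k' := by rw [hk] at e2; exact_mod_cast e2
    rw [padicValNat.mul (by omega) (by omega), h1, h2]
  · intro χ hχ hn
    obtain ⟨φ, hφ, ψ, hψ, rfl⟩ := Irr_prod_surj hχ
    by_cases h1 : φ ∈ Set.range e
    · by_cases h2 : ψ ∈ Set.range f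
      · obtain ⟨i, rfl⟩ := h1
        obtain ⟨j, rfl⟩ := h2
        exact absurd ⟨(i, j), rfl⟩ hn
      · simp [(hrest' ψ hψ h2).1]
    · simp [(hrest φ hφ h1).1]

/-- The index type of the data attached to a wreath product. -/
abbrev DescIdx (ι : Type) [LinearOrder ι] : Type := (ι × Bool) ⊕ {p : ι × ι // p.1 < p.2}

/-- Values at `(c, y)` of the characters of a wreath product. -/
def descV [LinearOrder ι] (v w : ι → ℤ) : DescIdx ι → ℤ
  | .inl p => w p.1 * v p.1
  | .inr p => w p.1.1 * v p.1.2 + v p.1.1 * w p.1.2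

/-- Values at the swap times `(c, 1)` of the characters of a wreath product. -/
def descW [LinearOrder ι] (w : ι → ℤ) : DescIdx ι → ℤ
  | .inl p => (bif p.2 then 1 else -1) * w p.1
  | .inr _ => 0

/-- Valuations of the degrees of the characters of a wreath product. -/
def descD [LinearOrder ι] (d : ι → ℕ) : DescIdx ι → ℕ
  | .inl p => 2 * d p.1
  | .inr p => d p.1.1 + d p.1.2 + 1

lemma Realizes.wreath [Fintype G] [LinearOrder ι] (h : Realizes y c v w d) :
    Realizes (⟨c, y, false⟩ : Wr G) ⟨c, 1, true⟩ (descV v w) (descW w) (descD d) := by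
  classical
  obtain ⟨e, hi, hirr, hval, hdeg, hrest⟩ := h
  have hval' : ∀ i, ∃ s : ℤˣ, e i y = ((s : ℤ) * v i : ℤ) ∧ e i c = ((s : ℤ) * w i : ℤ) := by
    intro i
    obtain ⟨s, hs | hs, h⟩ := hval i
    · exact ⟨1, by simpa [hs] using h⟩
    · exact ⟨-1, by simpa [hs] using h⟩
  choose s hy hc using hval'
  choose m hm hmd using hdeg
  have hmpos : ∀ i, m i ≠ 0 := by
    intro i
    obtain ⟨m', hm', e1⟩ := Irr_one (hirr i)
    rw [hm] at e1
    have : m i = m' := by exact_mod_cast e1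
    omega
  have hss : ∀ i, ((s i : ℤ) : ℂ) * (s i : ℤ) = 1 := by
    intro i
    rcases Int.units_eq_one_or (s i) with h | h <;> simp [h]
  let E : DescIdx ι → Wr G → ℂ := fun k => match k with
    | .inl p => Wr.sq (e p.1) ((bif p.2 then 1 else -1) * s p.1)
    | .inr p => Wr.ind (e p.1.1) (e p.1.2)
  have hne : ∀ p : {p : ι × ι // p.1 < p.2}, e p.1.1 ≠ e p.1.2 := fun p h => p.2.ne (hi h)
  have hE : ∀ k, E k ∈ Irr (Wr G) := by
    rintro (p | p)
    · exact Wr.sq_mem_Irr (hirr _) _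
    · exact Wr.ind_mem_Irr (hirr _) (hirr _) (hne p)
  refine ⟨E, ?_, hE, ?_, ?_, ?_⟩
  · intro k l hkl
    have hp := pair_Irr_self (hE k)
    nth_rewrite 2 [hkl] at hp
    rcases k with ⟨i, β⟩ | p <;> rcases l with ⟨j, γ⟩ | r
    · simp only [E, Wr.pair_sq_sq, pair_Irr (hirr _) (hirr _)] at hp
      by_cases hij : i = j
      · subst hij
        congr 2
        have := hss i
        rcases Int.units_eq_one_or (s i) with h | h <;> cases β <;> cases γ <;> simp [h] at hp ⊢
      · rw [if_neg (fun h => hij (hi h))] at hp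
        simp at hp
    · rw [pair_comm] at hp
      simp only [E, Wr.pair_ind_sq, pair_Irr (hirr _) (hirr _)] at hp
      by_cases h1 : e r.1.1 = e i <;> by_cases h2 : e r.1.2 = e i <;> simp [h1, h2] at hp
      exact absurd (h1.trans h2.symm) (hne r)
    · simp only [E, Wr.pair_ind_sq, pair_Irr (hirr _) (hirr _)] at hp
      by_cases h1 : e p.1.1 = e j <;> by_cases h2 : e p.1.2 = e j <;> simp [h1, h2] at hp
      exact absurd (h1.trans h2.symm) (hne p)
    · simp only [E, Wr.pair_ind_ind, pair_Irr (hirr _) (hirr _)] at hp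
      congr 1
      by_cases h1 : e p.1.1 = e r.1.1 ∧ e p.1.2 = e r.1.2
      · exact Subtype.ext (Prod.ext (hi h1.1) (hi h1.2))
      · by_cases h2 : e p.1.1 = e r.1.2 ∧ e p.1.2 = e r.1.1
        · have := p.2
          rw [hi h2.1, hi h2.2] at this
          exact absurd this r.2.not_gt
        · rw [not_and_or] at h1 h2
          rcases h1 with h1 | h1 <;> rcases h2 with h2 | h2 <;> simp [h1, h2] at hp
  · rintro (⟨i, β⟩ | p)
    · refine ⟨1, Or.inl rfl, ?_, ?_⟩
      · simp only [E, Wr.sq, descV, hy, hc, Bool.false_eq_true, if_false]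
        push_cast
        linear_combination ((w i : ℂ) * v i) * hss i
      · simp only [E, Wr.sq, descW, hc, if_true, mul_one]
        cases β
        · simp
          linear_combination (w i : ℂ) * hss i
        · simp
          linear_combination (w i : ℂ) * hss i
    · refine ⟨s p.1.1 * s p.1.2, ?_, ?_, ?_⟩
      · rcases Int.units_eq_one_or (s p.1.1) with h | h <;>
          rcases Int.units_eq_one_or (s p.1.2) with h' | h' <;> simp [h, h']
      · simp only [E, Wr.ind, descV, hy, hc, Bool.false_eq_true, if_false]
        push_cast
        ring
      · simp [E, Wr.ind, descW]
  · rintro (⟨i, β⟩ | p)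
    · refine ⟨m i * m i, ?_, ?_⟩
      · simp [E, Wr.sq, Wr.one_def, hm]
      · rw [padicValNat.mul (hmpos i) (hmpos i), hmd, descD]; ring
    · refine ⟨2 * (m p.1.1 * m p.1.2), ?_, ?_⟩
      · simp [E, Wr.ind, Wr.one_def, hm]; ring
      · rw [padicValNat.mul (by simp) (mul_ne_zero (hmpos _) (hmpos _)),
          padicValNat.mul (hmpos _) (hmpos _), hmd, hmd, descD]
        simp; ring
  · intro χ hχ hn
    rcases Wr.Irr_surj hχ with ⟨φ, hφ, ε, rfl⟩ | ⟨φ, hφ, ψ, hψ, hφψ, rfl⟩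
    · by_cases h1 : φ ∈ Set.range e
      · obtain ⟨i, rfl⟩ := h1
        exfalso
        apply hn
        rcases Int.units_eq_one_or (s i) with h | h <;> rcases Int.units_eq_one_or ε with h' | h'
        · exact ⟨.inl (i, true), by simp [E, h, h']⟩
        · exact ⟨.inl (i, false), by simp [E, h, h']⟩
        · exact ⟨.inl (i, false), by simp [E, h, h']⟩
        · exact ⟨.inl (i, true), by simp [E, h, h']⟩
      · have := hrest φ hφ h1
        simp [Wr.sq, this.1, this.2]
    · by_cases h1 : φ ∈ Set.range e
      · by_cases h2 : ψ ∈ Set.range e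
        · obtain ⟨i, rfl⟩ := h1
          obtain ⟨j, rfl⟩ := h2
          exfalso
          apply hn
          rcases lt_trichotomy i j with h | h | h
          · exact ⟨.inr ⟨(i, j), h⟩, rfl⟩
          · exact absurd (congrArg e h) hφψ
          · refine ⟨.inr ⟨(j, i), h⟩, ?_⟩
            ext x
            simp [E, Wr.ind, add_comm, mul_comm]
        · have := hrest ψ hψ h2
          simp [Wr.ind, this.1, this.2]
      · have := hrest φ hφ h1
        simp [Wr.ind, this.1, this.2]

end Realizes

section MN

variable {I : Type} [Fintype I] [DecidableEq I]

/-- The function obtained from `E` by the Murnaghan–Nakayama recursion along a list of cycle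
lengths: each part is subtracted from one of the beta numbers. -/
def mn (E : (I → ℤ) → ℤ) : List ℕ → (I → ℤ) → ℤ
  | [], b => E b
  | r :: l, b => ∑ i, mn E l (b - Pi.single i (r : ℤ))

/-- The signed indicator function of the rearrangements of `κ`. -/
def eps (κ b : I → ℤ) : ℤ := ∑ τ : Equiv.Perm I, (τ.sign : ℤ) * if b = κ ∘ τ then 1 else 0

/-- Antisymmetric functions. -/
def Alt (E : (I → ℤ) → ℤ) : Prop := ∀ b (τ : Equiv.Perm I), E (b ∘ τ) = τ.sign * E b

lemma mn_append (E : (I → ℤ) → ℤ) (l l' : List ℕ) (b : I → ℤ) :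
    mn E (l ++ l') b = mn (mn E l') l b := by
  induction l generalizing b with
  | nil => rfl
  | cons r l ih => simp only [List.cons_append, mn, ih]

lemma mn_perm (E : (I → ℤ) → ℤ) {l l' : List ℕ} (h : l.Perm l') (b : I → ℤ) :
    mn E l b = mn E l' b := by
  induction h generalizing b with
  | nil => rfl
  | cons r _ ih => simp only [mn, ih]
  | swap r s l =>
    simp only [mn]
    rw [Finset.sum_comm]
    refine Finset.sum_congr rfl fun i _ => Finset.sum_congr rfl fun j _ => ?_
    rw [sub_right_comm]
  | trans _ _ h1 h2 => rw [h1, h2]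

lemma mn_sum {T : Type} (s : Finset T) (c : T → ℤ) (E : T → (I → ℤ) → ℤ) (l : List ℕ)
    (b : I → ℤ) : mn (fun b => ∑ t ∈ s, c t * E t b) l b = ∑ t ∈ s, c t * mn (E t) l b := by
  induction l generalizing b with
  | nil => rfl
  | cons r l ih =>
    simp only [mn, ih]
    rw [Finset.sum_comm]
    simp only [Finset.mul_sum]

lemma Alt.mn {E : (I → ℤ) → ℤ} (h : Alt E) (l : List ℕ) : Alt (mn E l) := by
  induction l with
  | nil => exact h
  | cons r l ih =>
    intro b τ
    simp only [_root_.mn]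
    rw [Finset.mul_sum, ← Equiv.sum_comp τ fun i =>
      (τ.sign : ℤ) * _root_.mn E l (b - (Pi.single i (r : ℤ) : I → ℤ))]
    refine Finset.sum_congr rfl fun i _ => ?_
    rw [← ih]
    congr 1
    ext j
    simp [Pi.single_apply]

lemma alt_eps (κ : I → ℤ) : Alt (eps κ) := by
  intro b τ
  simp only [eps, Finset.mul_sum]
  rw [← Equiv.sum_comp (Equiv.mulRight τ)]
  refine Finset.sum_congr rfl fun σ _ => ?_
  have : b ∘ τ = κ ∘ (σ * τ : Equiv.Perm I) ↔ b = κ ∘ σ := by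
    constructor
    · intro h
      ext i
      simpa using congrFun h (τ⁻¹ i)
    · rintro rfl
      rfl
  simp only [Equiv.coe_mulRight, this, Equiv.Perm.sign_mul, Units.val_mul]
  ring

lemma Alt.eq_zero {E : (I → ℤ) → ℤ} (h : Alt E) {b : I → ℤ} (hb : ¬ Function.Injective b) :
    E b = 0 := by
  simp only [Function.Injective, not_forall] at hb
  obtain ⟨i, j, hij, hne⟩ := hb
  have h1 := h b (Equiv.swap i j)
  have : b ∘ Equiv.swap i j = b := by
    ext k
    simp only [Function.comp, Equiv.swap_apply_def]
    split_ifs <;> simp_all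
  rw [this, Equiv.Perm.sign_swap hne] at h1
  simp at h1
  omega

lemma mn_ne_zero {E : (I → ℤ) → ℤ} (S : ℤ) (hE : ∀ b, E b ≠ 0 → (∀ i, 0 ≤ b i) ∧ ∑ i, b i = S)
    (l : List ℕ) {b : I → ℤ} (h : mn E l b ≠ 0) :
    (∀ i, 0 ≤ b i) ∧ ∑ i, b i = S + l.sum := by
  induction l generalizing b with
  | nil => simpa using hE b h
  | cons r l ih =>
    obtain ⟨i, -, hi⟩ := Finset.exists_ne_zero_of_sum_ne_zero h
    obtain ⟨h1, h2⟩ := ih hi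
    constructor
    · intro j
      have := h1 j
      by_cases hj : j = i
      · subst hj; simp at this; omega
      · simpa [hj] using this
    · simp [Finset.sum_sub_distrib] at h2
      push_cast [List.sum_cons] at h2 ⊢
      linarith

lemma eps_ne_zero {κ b : I → ℤ} (h : eps κ b ≠ 0) : ∃ τ : Equiv.Perm I, b = κ ∘ τ := by
  obtain ⟨τ, -, hτ⟩ := Finset.exists_ne_zero_of_sum_ne_zero h
  refine ⟨τ, ?_⟩
  by_contra hne
  simp [hne] at hτ

lemma eps_self {κ : I → ℤ} (h : Function.Injective κ) : eps κ κ = 1 := by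
  rw [eps, Finset.sum_eq_single 1]
  · simp
  · intro τ _ hτ
    rw [if_neg, mul_zero]
    intro h2
    apply hτ
    ext i
    exact (h (congrFun h2 i)).symm
  · simp

lemma mn_eps_ne_zero {κ b : I → ℤ} (hκ : ∀ i, 0 ≤ κ i) {l : List ℕ} (h : mn (eps κ) l b ≠ 0) :
    Function.Injective b ∧ (∀ i, 0 ≤ b i) ∧ ∑ i, b i = ∑ i, κ i + l.sum := by
  refine ⟨?_, mn_ne_zero _ (fun b hb => ?_) l h⟩
  · by_contra hb
    exact h (((alt_eps κ).mn l).eq_zero hb)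
  · obtain ⟨τ, rfl⟩ := eps_ne_zero hb
    exact ⟨fun i => hκ _, Equiv.sum_comp τ κ⟩

/-- Reindexing. -/
lemma mn_eps_equiv {J : Type} [Fintype J] [DecidableEq J] (e : J ≃ I) (κ b : I → ℤ) (l : List ℕ) :
    mn (eps (κ ∘ e)) l (b ∘ e) = mn (eps κ) l b := by
  induction l generalizing b with
  | nil =>
    simp only [mn, eps]
    rw [← Equiv.sum_comp (e.permCongr)]
    refine Finset.sum_congr rfl fun τ _ => ?_
    rw [Equiv.Perm.sign_permCongr]
    congr 2
    simp only [eq_iff_iff]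
    constructor
    · intro h
      ext i
      simpa using congrFun h (e.symm i)
    · rintro rfl
      ext i
      simp
  | cons r l ih =>
    simp only [mn]
    rw [← Equiv.sum_comp e fun i => mn (eps κ) l (b - (Pi.single i (r : ℤ) : I → ℤ))]
    refine Finset.sum_congr rfl fun i _ => ?_
    rw [← ih]
    congr 1
    ext j
    simp [Pi.single_apply]

lemma two_dvd_sum_symm (f : I → I → ℤ) (hf : ∀ i j, f i j = f j i) :
    (2 : ℤ) ∣ ∑ i, ∑ j, f i j - ∑ i, f i i := by
  have h1 : ∀ i, f i i = ∑ j, if i = j then f i j else 0 := fun i => by simp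
  simp_rw [h1]
  rw [← Finset.sum_sub_distrib]
  simp_rw [← Finset.sum_sub_distrib]
  rw [← Fintype.sum_prod_type' (f := fun i j => f i j - if i = j then f i j else 0)]
  apply (ZMod.intCast_zmod_eq_zero_iff_dvd _ 2).mp
  push_cast
  refine Finset.sum_involution (fun p _ => p.swap) ?_ ?_ ?_ ?_
  · rintro ⟨i, j⟩ -
    by_cases h : i = j
    · simp [h]
    · simp [h, Ne.symm h, hf j i, CharTwo.add_self_eq_zero]
  · rintro ⟨i, j⟩ - h
    by_cases hij : i = j
    · simp [hij] at h
    · simpa using fun h _ => hij h.symm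
  · simp
  · simp

/-- Parity: splitting an even part into two halves does not change the value modulo `2`. -/
lemma mn_halve (E : (I → ℤ) → ℤ) (r : ℕ) (l : List ℕ) (b : I → ℤ) :
    (2 : ℤ) ∣ mn E (r :: r :: l) b - mn E ((r + r) :: l) b := by
  simp only [mn]
  have := two_dvd_sum_symm
    (fun i j : I => mn E l (b - Pi.single i (r : ℤ) - Pi.single j (r : ℤ)))
    (fun i j => by rw [sub_right_comm])
  simpa [sub_sub, ← Pi.single_add] using this

end MN

section Kernel

variable {I : Type} [Fintype I] [DecidableEq I]

/-- `κ` enumerates the integers in `[0, N)`, where `N` is the number of indices. -/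
def IsBase (κ : I → ℤ) : Prop := Function.Injective κ ∧ ∀ i, 0 ≤ κ i ∧ κ i < Fintype.card I

lemma IsBase.sum {κ : I → ℤ} (h : IsBase κ) :
    ∑ i, κ i = ∑ x ∈ Finset.range (Fintype.card I), (x : ℤ) := by
  have h1 : Finset.univ.image κ = (Finset.range (Fintype.card I)).image (fun x : ℕ => (x : ℤ)) := by
    apply Finset.eq_of_subset_of_card_le
    · intro p hp
      obtain ⟨i, -, rfl⟩ := Finset.mem_image.mp hp
      refine Finset.mem_image.mpr ⟨(κ i).toNat, ?_, ?_⟩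
      · have := h.2 i
        simp; omega
      · have := h.2 i
        simp; omega
    · rw [Finset.card_image_of_injective _ h.1]
      exact Finset.card_image_le.trans (by simp)
  rw [← Finset.sum_image (f := fun x => x) (fun i _ j _ hij => h.1 hij), h1,
    Finset.sum_image (by simp)]

lemma range_sum_le {b : I → ℤ} (hb : Function.Injective b) (h0 : ∀ i, 0 ≤ b i) :
    ∑ x ∈ Finset.range (Fintype.card I), (x : ℤ) ≤ ∑ i, b i := by
  have := Finset.sum_range_le_sum (s := Finset.univ.image b) (c := 0) (by simpa using h0)
  rw [Finset.sum_image (fun i _ j _ hij => hb hij), Finset.card_image_of_injective _ hb] at this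
  simpa using this

lemma IsBase.exists_eq {κ b : I → ℤ} (h : IsBase κ) (hb : Function.Injective b) (h0 : ∀ i, 0 ≤ b i)
    {m : ℤ} (hs : ∑ i, b i = ∑ i, κ i + m) {p : ℤ} (hp : 0 ≤ p) (hp' : p < Fintype.card I - m) :
    ∃ i, b i = p := by
  by_contra hne
  push Not at hne
  have h1 := range_sum_le (b := fun i => if b i < p then b i else b i - 1) ?_ ?_
  · rw [← h.sum] at h1
    have h2 : ∑ i, (if b i < p then b i else b i - 1) =
        ∑ i, b i - ((Finset.univ.filter fun i => ¬ b i < p).card : ℤ) := by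
      rw [Finset.card_filter, Nat.cast_sum, ← Finset.sum_sub_distrib]
      refine Finset.sum_congr rfl fun i _ => ?_
      split_ifs <;> simp_all
    have h3 := Finset.card_filter_add_card_filter_not (s := Finset.univ) (fun i : I => b i < p)
    have h4 : (Finset.univ.filter fun i => b i < p).card ≤ p.toNat := by
      have : ((Finset.univ.filter fun i => b i < p).image b) ⊆ Finset.Ico 0 p := by
        intro x hx
        simp only [Finset.mem_image, Finset.mem_filter, Finset.mem_univ, true_and] at hx
        obtain ⟨i, hi, rfl⟩ := hx
        exact Finset.mem_Ico.mpr ⟨h0 i, hi⟩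
      have := Finset.card_le_card this
      rw [Finset.card_image_of_injective _ hb] at this
      simpa using this
    rw [Finset.card_univ] at h3
    omega
  · intro i j hij
    apply hb
    have hi := hne i
    have hj := hne j
    simp only at hij
    split_ifs at hij <;> omega
  · intro i
    have := h0 i
    have := hne i
    split_ifs <;> omega

lemma Alt.sum_add {E : (I → ℤ) → ℤ} (h : Alt E) (r : ℕ) :
    Alt fun b => ∑ i, E (b + Pi.single i (r : ℤ)) := by
  intro b τ
  simp only []
  rw [Finset.mul_sum, ← Equiv.sum_comp τ fun i =>
    (τ.sign : ℤ) * E (b + (Pi.single i (r : ℤ) : I → ℤ))]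
  refine Finset.sum_congr rfl fun i _ => ?_
  rw [← h]
  congr 1
  ext j
  simp [Pi.single_apply]

/-- Adding a part to a beta set, as an operator adjoint to the Murnaghan–Nakayama recursion. -/
lemma sum_mn_add {κ : I → ℤ} (hκ : IsBase κ) {K r : ℕ} (hr : 0 < r) (hrK : r ≤ K)
    (l : List ℕ) (hl : ∀ s ∈ l, 0 < s ∧ s ≤ K) (b : I → ℤ) (hb0 : ∀ i, 0 ≤ b i)
    (hbK : Function.Injective b → ∀ p : ℤ, 0 ≤ p → p < K → ∃ i, b i = p) :
    ∑ i, mn (eps κ) l (b + Pi.single i (r : ℤ)) = r * l.count r * mn (eps κ) (l.erase r) b := by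
  have hneg : ∀ (l : List ℕ) (b : I → ℤ) (i : I), b i < 0 → mn (eps κ) l b = 0 := by
    intro l b i hi
    by_contra h
    have := (mn_eps_ne_zero (fun i => (hκ.2 i).1) h).2.1 i
    omega
  by_cases hinj : Function.Injective b
  swap
  · rw [((alt_eps κ).mn _).eq_zero hinj, mul_zero]
    exact ((alt_eps κ).mn l).sum_add r |>.eq_zero hinj
  induction l generalizing b with
  | nil =>
    simp only [List.count_nil, Nat.cast_zero, mul_zero, zero_mul]
    refine Finset.sum_eq_zero fun i _ => ?_
    by_contra h
    have h1 := (mn_eps_ne_zero (fun i => (hκ.2 i).1) h).2.2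
    have h2 := range_sum_le hinj hb0
    rw [← hκ.sum] at h2
    simp [Finset.sum_add_distrib] at h1
    omega
  | cons s l ih =>
    obtain ⟨hs0, hsK⟩ := hl s (by simp)
    have key : ∀ j, ∑ i, mn (eps κ) l (b + Pi.single i (r : ℤ) - Pi.single j (s : ℤ)) =
        r * l.count r * mn (eps κ) (l.erase r) (b - Pi.single j (s : ℤ)) +
          if r = s ∧ b j < s then mn (eps κ) l b else 0 := by
      intro j
      by_cases hj : (s : ℤ) ≤ b j
      · rw [if_neg (by omega), add_zero]
        by_cases hinj' : Function.Injective (b - Pi.single j (s : ℤ))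
        · rw [← ih (fun t ht => hl t (by simp [ht])) (b - (Pi.single j (s : ℤ) : I → ℤ)) ?_ ?_ hinj']
          · refine Finset.sum_congr rfl fun i _ => ?_
            congr 1
            abel
          · intro i
            have := hb0 i
            by_cases h : i = j
            · subst h; simpa using hj
            · simpa [h] using this
          · intro _ p hp hpK
            obtain ⟨i, hi⟩ := hbK hinj p hp hpK
            by_cases h : i = j
            · subst h
              obtain ⟨i', hi'⟩ := hbK hinj (p - s) (by omega) (by omega)
              have hne : i' ≠ i := by rintro rfl; omega
              exact absurd (hinj' (a₁ := i') (a₂ := i) (by simp [hne]; omega)) hne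
            · exact ⟨i, by simpa [h] using hi⟩
        · rw [((alt_eps κ).mn _).eq_zero hinj', mul_zero]
          rw [← ((alt_eps κ).mn l).sum_add r |>.eq_zero hinj']
          refine Finset.sum_congr rfl fun i _ => ?_
          congr 1
          abel
      · rw [hneg (l.erase r) _ j (by simp; omega), mul_zero, zero_add,
          Finset.sum_eq_single j]
        rotate_left
        · intro i _ hij
          exact hneg _ _ j (by simp [hij.symm]; omega)
        · simp
        by_cases hrs : r = s
        · subst hrs
          simp at hj
          simp [hj]
        · rw [if_neg (by tauto)]
          rcases lt_or_ge (b j + r - s) 0 with h | h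
          · exact hneg _ _ j (by simpa using h)
          · apply ((alt_eps κ).mn _).eq_zero
            intro hinj'
            obtain ⟨i', hi'⟩ := hbK hinj (b j + r - s) h (by omega)
            have hne : i' ≠ j := by rintro rfl; omega
            exact hne (hinj' (by simp [hne, hi']))
    simp only [mn]
    rw [Finset.sum_comm]
    rw [Finset.sum_congr rfl fun j _ => key j, Finset.sum_add_distrib, ← Finset.mul_sum]
    by_cases hrs : r = s
    · subst hrs
      have hcard : (Finset.univ.filter fun j => b j < r).card = r := by
        have : ((Finset.univ.filter fun j => b j < r).image b) = Finset.Ico 0 (r : ℤ) := by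
          ext x
          simp only [Finset.mem_image, Finset.mem_filter, Finset.mem_univ, true_and, Finset.mem_Ico]
          constructor
          · rintro ⟨i, hi, rfl⟩
            exact ⟨hb0 i, hi⟩
          · rintro ⟨h1, h2⟩
            obtain ⟨i, hi⟩ := hbK hinj x h1 (by omega)
            exact ⟨i, by omega, hi⟩
        have := congrArg Finset.card this
        rw [Finset.card_image_of_injective _ hinj] at this
        simpa using this
      have h2 : ∑ j, (if r = r ∧ b j < r then mn (eps κ) l b else 0) = r * mn (eps κ) l b := by
        simp only [true_and]
        rw [← Finset.sum_filter, Finset.sum_const, hcard, nsmul_eq_mul]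
      rw [h2]
      simp only [List.count_cons_self, List.erase_cons_head]
      by_cases hmem : r ∈ l
      · have := mn_perm (eps κ) (List.perm_cons_erase hmem) b
        simp only [mn] at this
        rw [← this]
        push_cast
        ring
      · rw [List.count_eq_zero_of_not_mem hmem]
        push_cast
        ring
    · have : ∀ j, (if r = s ∧ b j < s then mn (eps κ) l b else 0) = 0 := fun j =>
        if_neg (by tauto)
      simp only [this, Finset.sum_const_zero, add_zero]
      rw [List.erase_cons_tail (by simpa using Ne.symm hrs), List.count_cons_of_ne (Ne.symm hrs)]
      simp only [mn]

end Kernel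

section Kernel

/-- The order of the centralizer of a permutation with cycle lengths `l` if `l'` is a
rearrangement of `l`, and zero otherwise. -/
def zf : List ℕ → List ℕ → ℤ
  | [], l' => if l' = [] then 1 else 0
  | r :: l, l' => r * l'.count r * zf l (l'.erase r)

lemma perm_of_zf_ne_zero {l l' : List ℕ} (h : zf l l' ≠ 0) : l.Perm l' := by
  induction l generalizing l' with
  | nil => simp [zf] at h; simp [h]
  | cons r l ih =>
    simp only [zf] at h
    have h1 : l'.count r ≠ 0 := by rintro h0; simp [h0] at h
    have h2 := ih (right_ne_zero_of_mul h)
    exact (h2.cons r).trans (List.perm_cons_erase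
      (List.count_pos_iff.mp (Nat.pos_of_ne_zero h1))).symm

lemma zf_of_perm {l l' : List ℕ} (h : l.Perm l') (S : Finset ℕ) (hS : ∀ r ∈ l, r ∈ S) :
    zf l l' = (l.prod * ∏ r ∈ S, (l.count r).factorial : ℕ) := by
  induction l generalizing l' with
  | nil => simp [zf, h.symm.eq_nil]
  | cons r l ih =>
    have h1 : l.Perm (l'.erase r) := by
      simpa using h.erase r
    rw [zf, ih h1 (fun t ht => hS t (by simp [ht])), ← h.count_eq r,
      ← Finset.mul_prod_erase S _ (hS r (by simp)), ← Finset.mul_prod_erase S _ (hS r (by simp))]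
    have h2 : ∀ t ∈ S.erase r, ((r :: l).count t).factorial = (l.count t).factorial := by
      intro t ht
      rw [List.count_cons_of_ne (Finset.ne_of_mem_erase ht).symm]
    rw [Finset.prod_congr rfl h2, List.count_cons_self, Nat.factorial_succ, List.prod_cons]
    push_cast
    ring

variable {I : Type} [Fintype I] [DecidableEq I]

lemma finite_bounded (S : ℤ) : {b : I → ℤ | (∀ i, 0 ≤ b i) ∧ ∑ i, b i = S}.Finite := by
  refine (Set.Finite.pi' (t := fun _ : I => Set.Icc 0 S) fun _ => Set.finite_Icc 0 S).subset ?_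
  rintro b ⟨h0, h1⟩ i
  exact ⟨h0 i, h1 ▸ Finset.single_le_sum (fun j _ => h0 j) (Finset.mem_univ i)⟩

lemma mn_support_finite {κ : I → ℤ} (hκ : IsBase κ) (l : List ℕ) :
    (Function.support (mn (eps κ) l)).Finite :=
  (finite_bounded (∑ i, κ i + l.sum)).subset fun _ hb =>
    (mn_eps_ne_zero (fun i => (hκ.2 i).1) hb).2

lemma finsum_eps_sq {κ : I → ℤ} (hκ : IsBase κ) :
    ∑ᶠ b, eps κ b * eps κ b = (Fintype.card I).factorial := by
  have hinj : Function.Injective fun τ : Equiv.Perm I => κ ∘ τ := by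
    intro σ τ h
    ext i
    exact hκ.1 (congrFun h i)
  rw [finsum_eq_sum_of_support_subset (s := Finset.univ.image fun τ : Equiv.Perm I => κ ∘ τ)]
  · rw [Finset.sum_image (fun _ _ _ _ h => hinj h)]
    have : ∀ τ : Equiv.Perm I, eps κ (κ ∘ τ) * eps κ (κ ∘ τ) = 1 := by
      intro τ
      rw [alt_eps, eps_self hκ.1, mul_one, ← Units.val_mul, Int.units_mul_self]
      rfl
    simp [this, Fintype.card_perm]
  · intro b hb
    obtain ⟨τ, rfl⟩ := eps_ne_zero (left_ne_zero_of_mul hb)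
    simp

lemma finsum_mn_mul {κ : I → ℤ} (hκ : IsBase κ) {n : ℕ} (hn : 2 * n ≤ Fintype.card I)
    (l l' : List ℕ) (hl : l.sum ≤ n) (hl0 : ∀ s ∈ l, 0 < s) (hl' : ∀ s ∈ l', 0 < s ∧ s ≤ n) :
    ∑ᶠ b, mn (eps κ) l b * mn (eps κ) l' b = (Fintype.card I).factorial * zf l l' := by
  induction l generalizing l' with
  | nil =>
    by_cases h : l' = []
    · subst h
      simp [zf, mn, finsum_eps_sq hκ]
    · rw [zf, if_neg h, mul_zero]
      rw [← finsum_zero (α := I → ℤ)]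
      refine finsum_congr fun b => ?_
      by_contra hb
      have h1 := (mn_eps_ne_zero (fun i => (hκ.2 i).1) (left_ne_zero_of_mul hb)).2.2
      have h2 := (mn_eps_ne_zero (fun i => (hκ.2 i).1) (right_ne_zero_of_mul hb)).2.2
      obtain ⟨s, hs⟩ := List.exists_mem_of_ne_nil l' h
      have h3 := List.single_le_sum (fun _ _ => Nat.zero_le _) s hs
      have := hl' s hs
      rw [h1, List.sum_nil] at h2
      omega
  | cons r l ih =>
    rw [List.sum_cons] at hl
    have h1 : ∀ b : I → ℤ, mn (eps κ) (r :: l) b * mn (eps κ) l' b =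
        ∑ i, mn (eps κ) l (b - Pi.single i (r : ℤ)) * mn (eps κ) l' b := by
      intro b
      rw [mn, Finset.sum_mul]
    rw [finsum_congr h1, finsum_sum_comm]
    · have h2 : ∀ i, ∑ᶠ b : I → ℤ, mn (eps κ) l (b - Pi.single i (r : ℤ)) * mn (eps κ) l' b =
          ∑ᶠ b : I → ℤ, mn (eps κ) l b * mn (eps κ) l' (b + Pi.single i (r : ℤ)) := by
        intro i
        rw [← finsum_comp_equiv (Equiv.addRight (Pi.single i (r : ℤ) : I → ℤ))]
        simp
      rw [Finset.sum_congr rfl fun i _ => h2 i, ← finsum_sum_comm]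
      · have h3 : ∀ b : I → ℤ, ∑ i, mn (eps κ) l b * mn (eps κ) l' (b + Pi.single i (r : ℤ)) =
            (r * l'.count r) * (mn (eps κ) l b * mn (eps κ) (l'.erase r) b) := by
          intro b
          by_cases hb : mn (eps κ) l b = 0
          · simp [hb]
          obtain ⟨hb1, hb2, hb3⟩ := mn_eps_ne_zero (fun i => (hκ.2 i).1) hb
          rw [← Finset.mul_sum, sum_mn_add hκ (K := n) (hl0 r (by simp)) (by omega) l' hl' b hb2]
          · ring
          · intro _ p hp hpK
            exact hκ.exists_eq hb1 hb2 hb3 hp (by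
              have : (2 * n : ℤ) ≤ Fintype.card I := by exact_mod_cast hn
              have : (l.sum : ℤ) ≤ n := by exact_mod_cast (by omega : l.sum ≤ n)
              omega)
        rw [finsum_congr h3, ← mul_finsum, ih _ (by omega) (fun s hs => hl0 s (by simp [hs]))
          (fun s hs => hl' s (List.mem_of_mem_erase hs)), zf]
        ring
      · intro i _
        exact (mn_support_finite hκ l).subset fun b hb => left_ne_zero_of_mul hb
    · intro i _
      exact (mn_support_finite hκ l').subset fun b hb => right_ne_zero_of_mul hb

end Kernel

section Cycles

variable {A B Ω : Type} [Fintype A] [DecidableEq A] [Fintype B] [DecidableEq B] [Fintype Ω]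
  [DecidableEq Ω]

/-- The multiset of cycle lengths of a permutation, including fixed points. -/
def cyc (g : Equiv.Perm Ω) : Multiset ℕ :=
  g.cycleType + Multiset.replicate (Fintype.card Ω - g.support.card) 1

/-- The permutation consists of a single cycle. -/
def FullCycle {Ω : Type} (g : Equiv.Perm Ω) : Prop := ∀ a b, g.SameCycle a b

lemma cyc_sum (g : Equiv.Perm Ω) : (cyc g).sum = Fintype.card Ω := by
  rw [cyc, Multiset.sum_add, Equiv.Perm.sum_cycleType, Multiset.sum_replicate, smul_eq_mul, mul_one]
  have := Finset.card_le_univ g.support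
  omega

lemma cyc_pos {g : Equiv.Perm Ω} {r : ℕ} (h : r ∈ cyc g) : 0 < r := by
  rcases Multiset.mem_add.mp h with h | h
  · have := Equiv.Perm.two_le_of_mem_cycleType h
    omega
  · rw [Multiset.eq_of_mem_replicate h]
    exact one_pos

lemma cycleType_permCongr (e : A ≃ B) (g : Equiv.Perm A) :
    (e.permCongr g).cycleType = g.cycleType := by
  rw [← Equiv.Perm.cycleType_extendDomain (p := fun _ : B => True)
    (e.trans (Equiv.subtypeUnivEquiv (fun _ => trivial)).symm)]
  congr 1

lemma cyc_permCongr (e : A ≃ B) (g : Equiv.Perm A) : cyc (e.permCongr g) = cyc g := by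
  have := cycleType_permCongr e g
  rw [cyc, cyc, ← Equiv.Perm.sum_cycleType, ← Equiv.Perm.sum_cycleType, this,
    Fintype.card_congr e]

lemma isConj_iff_cyc_eq {g h : Equiv.Perm Ω} : IsConj g h ↔ cyc g = cyc h := by
  have hf : ∀ g : Equiv.Perm Ω, (cyc g).filter (2 ≤ ·) = g.cycleType := by
    intro g
    rw [cyc, Multiset.filter_add, Multiset.filter_eq_self.mpr
      (fun a ha => Equiv.Perm.two_le_of_mem_cycleType ha), Multiset.filter_eq_nil.mpr, add_zero]
    intro a ha
    rw [Multiset.eq_of_mem_replicate ha]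
    omega
  rw [Equiv.Perm.isConj_iff_cycleType_eq]
  constructor
  · intro h1
    rw [cyc, cyc, ← Equiv.Perm.sum_cycleType, ← Equiv.Perm.sum_cycleType, h1]
  · intro h1
    rw [← hf, ← hf, h1]

lemma exists_equiv_of_cyc_eq {g : Equiv.Perm A} {h : Equiv.Perm B} (hgh : cyc g = cyc h) :
    ∃ e : A ≃ B, e.permCongr g = h := by
  have hc : Fintype.card A = Fintype.card B := by rw [← cyc_sum g, hgh, cyc_sum]
  have e := Fintype.equivOfCardEq hc
  have h1 : IsConj (e.permCongr g) h := by
    rw [isConj_iff_cyc_eq, cyc_permCongr, hgh]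
  obtain ⟨c, hc⟩ := isConj_iff.mp h1
  refine ⟨e.trans c, ?_⟩
  rw [← hc]
  ext b
  simp [Equiv.permCongr_apply]

lemma cycleType_sumCongr (g : Equiv.Perm A) (h : Equiv.Perm B) :
    (Equiv.Perm.sumCongr g h).cycleType = g.cycleType + h.cycleType := by
  have h1 : Equiv.Perm.sumCongr g h = Equiv.Perm.sumCongr g 1 * Equiv.Perm.sumCongr 1 h := by
    rw [Equiv.Perm.sumCongr_mul, one_mul, mul_one]
  have hd : (Equiv.Perm.sumCongr g (1 : Equiv.Perm B)).Disjoint (Equiv.Perm.sumCongr 1 h) := by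
    rintro (a | b)
    · right; simp
    · left; simp
  have hl : Equiv.Perm.sumCongr g (1 : Equiv.Perm B) =
      g.extendDomain (Equiv.ofInjective (Sum.inl : A → A ⊕ B) Sum.inl_injective) := by
    ext x
    rcases x with a | b
    · have := Equiv.Perm.extendDomain_apply_image g
        (Equiv.ofInjective (Sum.inl : A → A ⊕ B) Sum.inl_injective) a
      simp only [Equiv.ofInjective_apply] at this
      rw [this]; simp
    · rw [Equiv.Perm.extendDomain_apply_not_subtype]
      · simp
      · simp
  have hr : Equiv.Perm.sumCongr (1 : Equiv.Perm A) h =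
      h.extendDomain (Equiv.ofInjective (Sum.inr : B → A ⊕ B) Sum.inr_injective) := by
    ext x
    rcases x with a | b
    · rw [Equiv.Perm.extendDomain_apply_not_subtype]
      · simp
      · simp
    · have := Equiv.Perm.extendDomain_apply_image h
        (Equiv.ofInjective (Sum.inr : B → A ⊕ B) Sum.inr_injective) b
      simp only [Equiv.ofInjective_apply] at this
      rw [this]; simp
  rw [h1, hd.cycleType_mul, hl, hr, Equiv.Perm.cycleType_extendDomain,
    Equiv.Perm.cycleType_extendDomain]

lemma cyc_sumCongr (g : Equiv.Perm A) (h : Equiv.Perm B) :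
    cyc (Equiv.Perm.sumCongr g h) = cyc g + cyc h := by
  have h1 := cycleType_sumCongr g h
  have hg := Finset.card_le_univ g.support
  have hh := Finset.card_le_univ h.support
  have : Fintype.card (A ⊕ B) - (Equiv.Perm.sumCongr g h).support.card =
      (Fintype.card A - g.support.card) + (Fintype.card B - h.support.card) := by
    rw [← Equiv.Perm.sum_cycleType, h1, Multiset.sum_add, Equiv.Perm.sum_cycleType,
      Equiv.Perm.sum_cycleType, Fintype.card_sum]
    omega
  rw [cyc, this, h1, cyc, cyc, Multiset.replicate_add]
  abel

lemma FullCycle.cyc_eq [Nonempty A] {g : Equiv.Perm A} (h : FullCycle g) :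
    cyc g = {Fintype.card A} := by
  rcases Nat.lt_or_ge 1 (Fintype.card A) with h1 | h1
  · have hmv : ∀ a, g a ≠ a := by
      intro a ha
      obtain ⟨b, hb⟩ := Fintype.exists_ne_of_one_lt_card h1 a
      obtain ⟨k, hk⟩ := h a b
      rw [Equiv.Perm.zpow_apply_eq_self_of_apply_eq_self ha] at hk
      exact hb hk.symm
    have hs : g.support = Finset.univ := by
      ext a; simp [hmv]
    have hcy : g.IsCycle := by
      obtain ⟨a⟩ := ‹Nonempty A›
      exact ⟨a, hmv a, fun b _ => h a b⟩
    simp [cyc, hcy.cycleType, hs]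
  · have hsub : Subsingleton A := Fintype.card_le_one_iff_subsingleton.mp h1
    have h2 : Fintype.card A = 1 := le_antisymm h1 Fintype.card_pos
    have hg : g = 1 := Subsingleton.elim _ _
    simp [cyc, hg, h2]

lemma exists_cycle_split (g : Equiv.Perm Ω) (ω : Ω) :
    ∃ (g₁ : Equiv.Perm {u // g.SameCycle ω u}) (g₂ : Equiv.Perm {u // ¬ g.SameCycle ω u}),
      FullCycle g₁ ∧ (∀ u, (g₁ u : Ω) = g u) ∧ (∀ u, (g₂ u : Ω) = g u) ∧
      (Equiv.sumCompl fun u => g.SameCycle ω u).permCongr (Equiv.Perm.sumCongr g₁ g₂) = g := by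
  have h1 : ∀ u, g.SameCycle ω (g u) ↔ g.SameCycle ω u := fun u => Equiv.Perm.sameCycle_apply_right
  refine ⟨g.subtypePerm h1, g.subtypePerm (fun u => not_congr (h1 u)), ?_, fun u => rfl,
    fun u => rfl, ?_⟩
  · rintro ⟨a, ha⟩ ⟨b, hb⟩
    obtain ⟨k, hk⟩ := ha.symm.trans hb
    refine ⟨k, ?_⟩
    ext
    simp [hk]
  · ext u
    by_cases hu : g.SameCycle ω u
    · simp [Equiv.permCongr_apply, Equiv.sumCompl_symm_apply_of_pos hu]
    · simp [Equiv.permCongr_apply, Equiv.sumCompl_symm_apply_of_neg hu]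

/-- Induction on a permutation by splitting off cycles. -/
lemma perm_induction (P : ∀ (Ω : Type) [Fintype Ω] [DecidableEq Ω], Equiv.Perm Ω → Prop)
    (h0 : ∀ (Ω : Type) [Fintype Ω] [DecidableEq Ω] [IsEmpty Ω] (g : Equiv.Perm Ω), P Ω g)
    (hc : ∀ (A B : Type) [Fintype A] [DecidableEq A] [Fintype B] [DecidableEq B] (e : A ≃ B)
      (g : Equiv.Perm A), P A g → P B (e.permCongr g))
    (hs : ∀ (A B : Type) [Fintype A] [DecidableEq A] [Fintype B] [DecidableEq B] [Nonempty A]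
      (g₁ : Equiv.Perm A) (g₂ : Equiv.Perm B), FullCycle g₁ → P B g₂ →
        P (A ⊕ B) (Equiv.Perm.sumCongr g₁ g₂))
    {Ω : Type} [Fintype Ω] [DecidableEq Ω] (g : Equiv.Perm Ω) : P Ω g := by
  induction hn : Fintype.card Ω using Nat.strong_induction_on generalizing Ω with
  | _ n ih =>
    rcases isEmpty_or_nonempty Ω with hΩ | ⟨⟨ω⟩⟩
    · exact h0 Ω g
    · obtain ⟨g₁, g₂, hf, -, -, he⟩ := exists_cycle_split g ω
      rw [← he]
      have : Nonempty {u // g.SameCycle ω u} := ⟨⟨ω, Equiv.Perm.SameCycle.refl _ _⟩⟩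
      refine hc _ _ _ _ (hs _ _ g₁ g₂ hf (ih _ ?_ g₂ rfl))
      rw [← hn]
      exact Fintype.card_subtype_lt (x := ω) (fun h => h (Equiv.Perm.SameCycle.refl _ _))

lemma card_centralizer (g : Equiv.Perm Ω) {l : List ℕ} (hl : (l : Multiset ℕ) = cyc g) :
    (Nat.card (Subgroup.centralizer {g}) : ℤ) = zf l l := by
  rw [zf_of_perm (List.Perm.refl l) (insert 1 g.cycleType.toFinset)]
  · rw [Equiv.Perm.nat_card_centralizer]
    congr 1
    have h1 : ∀ r, l.count r = (cyc g).count r := fun r => by rw [← hl, Multiset.coe_count]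
    have h2 : l.prod = (cyc g).prod := by rw [← hl, Multiset.prod_coe]
    have hn : 1 ∉ g.cycleType := fun h => by
      have := Equiv.Perm.two_le_of_mem_cycleType h
      omega
    rw [h2, Finset.prod_insert (by simpa using hn)]
    simp only [h1, cyc, Multiset.prod_add, Multiset.count_add, Multiset.count_replicate]
    rw [Multiset.count_eq_zero_of_notMem hn, Equiv.Perm.sum_cycleType]
    have h3 : ∀ r ∈ g.cycleType.toFinset, (Multiset.count r g.cycleType +
        if 1 = r then Fintype.card Ω - g.support.card else 0).factorial =
        (Multiset.count r g.cycleType).factorial := by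
      intro r hr
      rw [if_neg, add_zero]
      rintro rfl
      exact hn (by simpa using hr)
    rw [Finset.prod_congr rfl h3]
    simp
    ring
  · intro r hr
    have : r ∈ cyc g := by rw [← hl]; exact hr
    rcases Multiset.mem_add.mp this with h | h
    · simp [h]
    · simp [Multiset.eq_of_mem_replicate h]

end Cycles

section Colorings

variable {I : Type} [Fintype I] [DecidableEq I]
variable {A B Ω : Type} [Fintype A] [DecidableEq A] [Fintype B] [DecidableEq B] [Fintype Ω]
  [DecidableEq Ω]

/-- The content of a coloring. -/
def cnt (F : Ω → I) : I → ℤ := ∑ ω, Pi.single (F ω) 1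

/-- Weighted count of the colorings fixed by a permutation. -/
def psi (E : (I → ℤ) → ℤ) (b : I → ℤ) (g : Equiv.Perm Ω) : ℤ :=
  ∑ F : Ω → I, if F ∘ g = F then E (b - cnt F) else 0

lemma psi_permCongr (E : (I → ℤ) → ℤ) (b : I → ℤ) (e : A ≃ B) (g : Equiv.Perm A) :
    psi E b (e.permCongr g) = psi E b g := by
  rw [psi, psi, ← Equiv.sum_comp (e.arrowCongr (Equiv.refl I))]
  refine Finset.sum_congr rfl fun F _ => ?_
  have h1 : (e.arrowCongr (Equiv.refl I)) F = F ∘ e.symm := rfl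
  have h2 : (F ∘ e.symm) ∘ e.permCongr g = F ∘ e.symm ↔ F ∘ g = F := by
    constructor
    · intro h
      ext a
      simpa [Equiv.permCongr_apply] using congrFun h (e a)
    · intro h
      ext a
      simpa [Equiv.permCongr_apply] using congrFun h (e.symm a)
  have h3 : cnt (F ∘ e.symm) = cnt F := by
    rw [cnt, ← Equiv.sum_comp e]
    simp [cnt]
  rw [h1, h3]
  exact if_congr h2 rfl rfl

lemma psi_sumCongr (E : (I → ℤ) → ℤ) (b : I → ℤ) (g₁ : Equiv.Perm A) (g₂ : Equiv.Perm B) :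
    psi E b (Equiv.Perm.sumCongr g₁ g₂) =
      ∑ F : A → I, if F ∘ g₁ = F then psi E (b - cnt F) g₂ else 0 := by
  rw [psi, ← Equiv.sum_comp (Equiv.sumArrowEquivProdArrow A B I).symm, Fintype.sum_prod_type]
  refine Finset.sum_congr rfl fun F _ => ?_
  rw [psi]
  have h1 : ∀ F' : B → I, (Equiv.sumArrowEquivProdArrow A B I).symm (F, F') = Sum.elim F F' :=
    fun _ => rfl
  have h2 : ∀ F' : B → I, Sum.elim F F' ∘ Equiv.Perm.sumCongr g₁ g₂ = Sum.elim F F' ↔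
      F ∘ g₁ = F ∧ F' ∘ g₂ = F' := by
    intro F'
    constructor
    · intro h
      exact ⟨funext fun a => congrFun h (Sum.inl a), funext fun a => congrFun h (Sum.inr a)⟩
    · rintro ⟨h, h'⟩
      ext (a | a)
      · exact congrFun h a
      · exact congrFun h' a
  have h3 : ∀ F' : B → I, cnt (Sum.elim F F') = cnt F + cnt F' := by
    intro F'
    simp [cnt, Fintype.sum_sum_type]
  simp only [h1, h3, h2]
  split_ifs with h
  · simp [h, sub_sub]
  · simp [h]

lemma sum_fixed_fullCycle [Nonempty A] {g : Equiv.Perm A} (hg : FullCycle g)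
    (f : (I → ℤ) → ℤ) : (∑ F : A → I, if F ∘ g = F then f (cnt F) else 0) =
      ∑ i, f (Pi.single i (Fintype.card A : ℤ)) := by
  rw [← Finset.sum_filter]
  symm
  obtain ⟨a⟩ := ‹Nonempty A›
  refine Finset.sum_bij (fun i _ => fun _ => i) ?_ ?_ ?_ ?_
  · intro i _
    simp only [Finset.mem_filter, Finset.mem_univ, true_and]
    rfl
  · intro i _ j _ h
    exact congrFun h a
  · intro F hF
    have hF : F ∘ g = F := by simpa using hF
    refine ⟨F a, Finset.mem_univ _, funext fun b => ?_⟩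
    obtain ⟨k, hk⟩ := Equiv.Perm.SameCycle.exists_nat_pow_eq (hg a b)
    rw [← hk]
    have : ∀ k : ℕ, ∀ c, F ((g ^ k) c) = F c := by
      intro k
      induction k with
      | zero => intro c; simp
      | succ k ih => intro c; rw [pow_succ, Equiv.Perm.mul_apply, ih]; exact congrFun hF c
    exact (this k a).symm
  · intro i _
    congr 1
    rw [cnt, Finset.sum_const, Finset.card_univ, ← Pi.single_smul]
    simp

lemma psi_eq_mn (E : (I → ℤ) → ℤ) (b : I → ℤ) (g : Equiv.Perm Ω) :
    ∀ l : List ℕ, (l : Multiset ℕ) = cyc g → psi E b g = mn E l b := by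
  revert b
  refine perm_induction (fun Ω _ _ g => ∀ (b : I → ℤ) (l : List ℕ), (l : Multiset ℕ) = cyc g →
    psi E b g = mn E l b) ?_ ?_ ?_ g
  · intro Ω _ _ _ g b l hl
    have h0 : cyc g = 0 := by
      have : g = 1 := Subsingleton.elim _ _
      simp [cyc, this]
    have : l = [] := by rw [h0] at hl; simpa using hl
    subst this
    rw [psi, Fintype.sum_unique, if_pos (Subsingleton.elim _ _)]
    simp [mn, cnt]
  · intro A B _ _ _ _ e g h b l hl
    rw [cyc_permCongr] at hl
    rw [psi_permCongr, h b l hl]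
  · intro A B _ _ _ _ _ g₁ g₂ h₁ h₂ b l hl
    rw [cyc_sumCongr, h₁.cyc_eq] at hl
    have h3 : l.Perm (Fintype.card A :: (cyc g₂).toList) := by
      rw [← Multiset.coe_eq_coe, hl, ← Multiset.cons_coe, Multiset.coe_toList,
        Multiset.singleton_add]
    rw [mn_perm E h3, psi_sumCongr, mn, sum_fixed_fullCycle h₁ (fun c => psi E (b - c) g₂)]
    exact Finset.sum_congr rfl fun i _ => h₂ _ _ (Multiset.coe_toList _)

/-- The list of cycle lengths. -/
def cl (g : Equiv.Perm Ω) : List ℕ := (cyc g).toList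

lemma coe_cl (g : Equiv.Perm Ω) : (cl g : Multiset ℕ) = cyc g := Multiset.coe_toList _

instance colorAction (α : I → ℤ) :
    MulAction (Equiv.Perm Ω) {F : Ω → I // cnt F = α} where
  smul g F := ⟨F.1 ∘ (g⁻¹ : Equiv.Perm Ω), by
    refine Eq.trans ?_ F.2
    rw [cnt, ← Equiv.sum_comp g]
    simp [cnt]⟩
  one_smul F := rfl
  mul_smul g h F := by
    ext a
    change F.1 ((g * h)⁻¹ a) = F.1 (h⁻¹ (g⁻¹ a))
    rw [mul_inv_rev]
    rfl

lemma mn_mem_Virt (E : (I → ℤ) → ℤ) (b : I → ℤ) :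
    (fun g : Equiv.Perm Ω => (mn E (cl g) b : ℂ)) ∈ Virt (Equiv.Perm Ω) := by
  have h : (fun g : Equiv.Perm Ω => (mn E (cl g) b : ℂ)) =
      ∑ α ∈ Finset.univ.image (cnt : (Ω → I) → I → ℤ), E (b - α) • fun g : Equiv.Perm Ω =>
        ((Finset.univ.filter fun F : {F : Ω → I // cnt F = α} => g • F = F).card : ℂ) := by
    ext g
    rw [← psi_eq_mn E b g _ (coe_cl g), psi]
    rw [← Finset.sum_fiberwise_of_maps_to (s := Finset.univ)
      (t := Finset.univ.image (cnt : (Ω → I) → I → ℤ)) (g := cnt) (by simp)]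
    simp only [Finset.sum_apply, Pi.smul_apply, Int.cast_sum]
    refine Finset.sum_congr rfl fun α _ => ?_
    have hc : (Finset.univ.filter fun F : {F : Ω → I // cnt F = α} => g • F = F).card =
        ((Finset.univ.filter fun F : Ω → I => cnt F = α).filter fun F => F ∘ g = F).card := by
      refine Finset.card_bij (fun F _ => F.1) ?_ ?_ ?_
      · intro F hF
        have hF : g • F = F := by simpa using hF
        simp only [Finset.mem_filter, Finset.mem_univ, true_and]
        refine ⟨F.2, ?_⟩
        have h1 : F.1 ∘ (g⁻¹ : Equiv.Perm Ω) = F.1 := congrArg Subtype.val hF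
        ext ω
        simpa using (congrFun h1 (g ω)).symm
      · intro F _ F' _ h
        exact Subtype.ext h
      · intro F hF
        simp only [Finset.mem_filter, Finset.mem_univ, true_and] at hF
        refine ⟨⟨F, hF.1⟩, ?_, rfl⟩
        simp only [Finset.mem_filter, Finset.mem_univ, true_and]
        ext ω
        have := congrFun hF.2 (g⁻¹ ω)
        change F ((g⁻¹ : Equiv.Perm Ω) ω) = F ω
        simpa using this.symm
    rw [hc, Finset.card_filter, Nat.cast_sum, zsmul_eq_mul, Finset.mul_sum]
    refine Finset.sum_congr rfl fun F hF => ?_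
    rw [(Finset.mem_filter.mp hF).2]
    split_ifs <;> simp
  rw [h]
  refine AddSubgroup.sum_mem _ fun α _ => AddSubgroup.zsmul_mem _ fixedPoints_mem_Virt _

end Colorings

section Degree

variable {I : Type} [Fintype I] [DecidableEq I]

/-- The reciprocal factorial, extended by zero to negative integers. -/
def rfac (a : ℤ) : ℚ := if 0 ≤ a then ((a.toNat.factorial : ℚ))⁻¹ else 0

lemma rfac_neg {a : ℤ} (h : a < 0) : rfac a = 0 := if_neg (not_le.2 h)

lemma rfac_natCast (a : ℕ) : rfac a = ((a.factorial : ℚ))⁻¹ := by simp [rfac]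

lemma rfac_sub_one (a : ℤ) : rfac (a - 1) = a * rfac a := by
  rcases lt_trichotomy a 0 with h | h | h
  · rw [rfac_neg h, rfac_neg (by lia)]; simp
  · subst h; rw [rfac_neg (by lia)]; simp
  · obtain ⟨m, rfl⟩ : ∃ m : ℕ, a = ((m + 1 : ℕ) : ℤ) := ⟨(a - 1).toNat, by lia⟩
    rw [show (((m + 1 : ℕ) : ℤ) - 1) = (m : ℤ) by push_cast; ring, rfac_natCast, rfac_natCast,
      Nat.factorial_succ]
    have := m.factorial_ne_zero
    push_cast
    field_simp

lemma rfac_sub_nat (a : ℤ) (j : ℕ) :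
    rfac (a - j) = rfac a * (descPochhammer ℚ j).eval (a : ℚ) := by
  induction j with
  | zero => simp
  | succ j ih =>
    rw [show a - ((j + 1 : ℕ) : ℤ) = a - j - 1 by push_cast; ring, rfac_sub_one, ih,
      descPochhammer_succ_eval]
    push_cast; ring

lemma mn_indicator_ones (κ : I → ℤ) (n : ℕ) (b : I → ℤ) (h : ∑ i, (b i - κ i) = n) :
    ((mn (fun b => if b = κ then 1 else 0) (List.replicate n 1) b : ℤ) : ℚ) =
      n.factorial * ∏ i, rfac (b i - κ i) := by
  induction n generalizing b with
  | zero =>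
    simp only [List.replicate_zero, mn]
    by_cases hb : b = κ
    · subst hb; simp [rfac]
    · rw [if_neg hb]
      obtain ⟨i, hi⟩ : ∃ i, b i - κ i < 0 := by
        by_contra! hc
        apply hb
        have := (Finset.sum_eq_zero_iff_of_nonneg (fun i _ => hc i)).1 (by simpa using h)
        ext i; have := this i (Finset.mem_univ i); lia
      rw [Finset.prod_eq_zero (Finset.mem_univ i) (rfac_neg hi)]; simp
  | succ n ih =>
    rw [List.replicate_succ, mn]
    push_cast
    have hstep : ∀ i, ((mn (fun b => if b = κ then (1 : ℤ) else 0) (List.replicate n 1)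
        (b - Pi.single i (1 : ℤ)) : ℤ) : ℚ) =
        n.factorial * ((b i - κ i : ℤ) * ∏ j, rfac (b j - κ j)) := by
      intro i
      rw [ih]
      · congr 1
        rw [← Finset.mul_prod_erase _ _ (Finset.mem_univ i),
          ← Finset.mul_prod_erase Finset.univ (fun j => rfac (b j - κ j)) (Finset.mem_univ i)]
        rw [← mul_assoc, ← rfac_sub_one]
        congr 1
        · simp only [Pi.sub_apply, Pi.single_eq_same]; congr 1; ring
        · refine Finset.prod_congr rfl fun j hj => ?_
          simp [Pi.single_eq_of_ne (Finset.ne_of_mem_erase hj)]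
      · have : ∑ j, ((b - (Pi.single i (1 : ℤ) : I → ℤ)) j - κ j) = ∑ j, (b j - κ j) - 1 := by
          have h1 : ∑ j, (Pi.single i (1 : ℤ) : I → ℤ) j = 1 := by simp
          conv_rhs => rw [← h1]
          rw [← Finset.sum_sub_distrib]
          exact Finset.sum_congr rfl fun j _ => by simp only [Pi.sub_apply]; ring
        rw [this, h]; push_cast; ring
    have h1 : ((1 : ℕ) : ℤ) = 1 := rfl
    simp only [h1] at *
    rw [Finset.sum_congr rfl fun i _ => hstep i, ← Finset.mul_sum, ← Finset.sum_mul,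
      ← Int.cast_sum, h, Nat.factorial_succ]
    push_cast; ring

lemma mn_ones {N : ℕ} (n : ℕ) (b : Fin N → ℤ) (h : ∑ i, b i = n + ∑ i : Fin N, (i : ℤ)) :
    ((mn (eps fun i : Fin N => (i : ℤ)) (List.replicate n 1) b : ℤ) : ℚ) =
      n.factorial * ((∏ i, rfac (b i)) * (Matrix.vandermonde fun i => (b i : ℚ)).det) := by
  have h1 : (eps fun i : Fin N => (i : ℤ)) = fun b => ∑ τ : Equiv.Perm (Fin N), (τ.sign : ℤ) *
      (fun (τ : Equiv.Perm (Fin N)) b => if b = (fun i : Fin N => (i : ℤ)) ∘ τ then 1 else 0) τ b :=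
    rfl
  rw [h1, mn_sum]
  push_cast
  have h2 : ∀ τ : Equiv.Perm (Fin N), ((mn (fun b => if b = (fun i : Fin N => (i : ℤ)) ∘ τ then
      (1 : ℤ) else 0) (List.replicate n 1) b : ℤ) : ℚ) = n.factorial *
        ∏ i, rfac (b i - ((τ i : ℕ) : ℤ)) := by
    intro τ
    refine mn_indicator_ones _ n b ?_
    rw [Finset.sum_sub_distrib, h]
    simp only [Function.comp_apply]
    rw [Equiv.sum_comp τ (fun i : Fin N => (i : ℤ))]; ring
  rw [Finset.sum_congr rfl fun τ _ => by rw [h2 τ]]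
  rw [Matrix.det_eval_matrixOfPolynomials_eq_det_vandermonde (fun i => (b i : ℚ))
    (fun j => descPochhammer ℚ j) (fun j => descPochhammer_natDegree _ _)
    (fun j => monic_descPochhammer _ _), ← Matrix.det_mul_column, ← Matrix.det_transpose,
    Matrix.det_apply', Finset.mul_sum]
  refine Finset.sum_congr rfl fun τ _ => ?_
  rw [mul_left_comm]
  congr 1
  congr 1
  refine Finset.prod_congr rfl fun i _ => ?_
  simp only [Matrix.transpose_apply, Matrix.of_apply]
  rw [rfac_sub_nat]

/-- Twice the `2`-adic valuation of the normalised degree attached to a set of beta numbers. -/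
def En (B : Finset ℤ) : ℤ :=
  ∑ p ∈ B, ∑ q ∈ B, (padicValInt 2 (p - q) : ℤ) - 2 * ∑ p ∈ B, (padicValNat 2 p.toNat.factorial : ℤ)

lemma padicVal_prod {T : Type} (s : Finset T) (f : T → ℚ) (h : ∀ i ∈ s, f i ≠ 0) :
    padicValRat 2 (∏ i ∈ s, f i) = ∑ i ∈ s, padicValRat 2 (f i) := by
  classical
  induction s using Finset.induction_on with
  | empty => simp
  | insert a s ha ih =>
    rw [Finset.prod_insert ha, Finset.sum_insert ha, padicValRat.mul (h a (by simp))
      (Finset.prod_ne_zero_iff.2 fun i hi => h i (by simp [hi])), ih fun i hi => h i (by simp [hi])]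

lemma mn_ones_val {N : ℕ} (n : ℕ) {b : Fin N → ℤ} (h : ∑ i, b i = n + ∑ i : Fin N, (i : ℤ))
    (hb : Function.Injective b) (h0 : ∀ i, 0 ≤ b i) :
    mn (eps fun i : Fin N => (i : ℤ)) (List.replicate n 1) b ≠ 0 ∧
    2 * (padicValInt 2 (mn (eps fun i : Fin N => (i : ℤ)) (List.replicate n 1) b) : ℤ) =
      2 * padicValNat 2 n.factorial + En (Finset.univ.image b) := by
  have key := mn_ones n b h
  have hV : (Matrix.vandermonde fun i => (b i : ℚ)).det ≠ 0 :=
    Matrix.det_vandermonde_ne_zero_iff.2 fun i j hij => hb (by exact_mod_cast hij)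
  have hr : ∀ i, rfac (b i) = (((b i).toNat.factorial : ℚ))⁻¹ := fun i => if_pos (h0 i)
  have hr0 : ∀ i, rfac (b i) ≠ 0 := fun i => by
    rw [hr]; exact inv_ne_zero (by exact_mod_cast (Nat.factorial_ne_zero _))
  have hP : ∏ i, rfac (b i) ≠ 0 := Finset.prod_ne_zero_iff.2 fun i _ => hr0 i
  have hn : (n.factorial : ℚ) ≠ 0 := by exact_mod_cast n.factorial_ne_zero
  constructor
  · intro h0
    rw [h0] at key
    exact mul_ne_zero hn (mul_ne_zero hP hV) key.symm
  · have hd : 2 * padicValRat 2 (Matrix.vandermonde fun i => (b i : ℚ)).det =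
        ∑ i, ∑ j, (padicValInt 2 (b i - b j) : ℤ) := by
      rw [Matrix.det_vandermonde, padicVal_prod]
      · have : ∀ i : Fin N, padicValRat 2 (∏ j ∈ Finset.Ioi i, ((b j : ℚ) - b i)) =
            ∑ j, if i < j then (padicValInt 2 (b i - b j) : ℤ) else 0 := by
          intro i
          rw [padicVal_prod, ← Finset.sum_filter]
          · refine Finset.sum_congr (by ext; simp) fun j _ => ?_
            rw [← Int.cast_sub, padicValRat.of_int, ← neg_sub, padicValInt, padicValInt, Int.natAbs_neg]
          · intro j hj
            rw [Finset.mem_Ioi] at hj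
            rw [sub_ne_zero]; intro he; exact hj.ne' (hb (by exact_mod_cast he))
        rw [Finset.sum_congr rfl fun i _ => this i, two_mul]
        nth_rewrite 2 [show (∑ i : Fin N, ∑ j : Fin N, if i < j then (padicValInt 2 (b i - b j) : ℤ) else 0) =
          ∑ i : Fin N, ∑ j : Fin N, if j < i then (padicValInt 2 (b i - b j) : ℤ) else 0 by
            rw [Finset.sum_comm]
            refine Finset.sum_congr rfl fun i _ => Finset.sum_congr rfl fun j _ => ?_
            rw [← neg_sub (b i), padicValInt, padicValInt, Int.natAbs_neg]] 
        rw [← Finset.sum_add_distrib]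
        refine Finset.sum_congr rfl fun i _ => ?_
        rw [← Finset.sum_add_distrib]
        refine Finset.sum_congr rfl fun j _ => ?_
        rcases lt_trichotomy i j with h | h | h
        · simp [h, not_lt.2 h.le]
        · subst h; simp
        · simp [h, not_lt.2 h.le]
      · intro i _
        refine Finset.prod_ne_zero_iff.2 fun j hj => ?_
        rw [Finset.mem_Ioi] at hj
        rw [sub_ne_zero]; intro he; exact hj.ne' (hb (by exact_mod_cast he))
    have := congrArg (padicValRat 2) key
    rw [padicValRat.of_int, padicValRat.mul hn (mul_ne_zero hP hV), padicValRat.mul hP hV,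
      padicVal_prod _ _ (fun i _ => hr0 i), padicValRat.of_nat] at this
    rw [this, En, Finset.sum_image (fun i _ j _ h => hb h), Finset.sum_image (fun i _ j _ h => hb h)]
    have h3 : ∀ i, padicValRat 2 (rfac (b i)) = -(padicValNat 2 (b i).toNat.factorial : ℤ) := by
      intro i; rw [hr, padicValRat.inv, padicValRat.of_nat]
    rw [Finset.sum_congr rfl fun i _ => h3 i, Finset.sum_neg_distrib]
    rw [Finset.sum_congr rfl fun i _ => Finset.sum_image (fun i _ j _ h => hb h), ← hd]
    ring

end Degree

section Labels

/-- `B` is the set of beta numbers, with `N` beads, of a partition of `n`. -/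
def IsLab (N n : ℕ) (B : Finset ℤ) : Prop :=
  B.card = N ∧ (∀ p ∈ B, 0 ≤ p) ∧ ∑ p ∈ B, p = n + ∑ x ∈ Finset.range N, (x : ℤ)

/-- Increasing enumeration of a set of beta numbers. -/
def enum (N : ℕ) (B : Finset ℤ) : Fin N → ℤ :=
  if h : B.card = N then fun i => B.orderEmbOfFin h i else 0

lemma enum_injective {N : ℕ} {B : Finset ℤ} (h : B.card = N) : Function.Injective (enum N B) := by
  rw [enum, dif_pos h]; exact (B.orderEmbOfFin h).injective

lemma image_enum {N : ℕ} {B : Finset ℤ} (h : B.card = N) : Finset.univ.image (enum N B) = B := by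
  rw [enum, dif_pos h]
  apply Finset.coe_injective
  rw [Finset.coe_image, Finset.coe_univ, Set.image_univ]
  exact B.range_orderEmbOfFin h

lemma enum_mem {N : ℕ} {B : Finset ℤ} (h : B.card = N) (i : Fin N) : enum N B i ∈ B := by
  have := Finset.mem_image_of_mem (enum N B) (Finset.mem_univ i)
  rwa [image_enum h] at this

/-- The character value (up to sign) attached to a set of beta numbers and a cycle type. -/
def chi (N : ℕ) (B : Finset ℤ) (l : List ℕ) : ℤ := mn (eps fun i : Fin N => (i : ℤ)) l (enum N B)

lemma exists_equiv_of_image_eq {I J : Type} [Fintype I] [Fintype J] {f : I → ℤ} {g : J → ℤ}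
    (hf : Function.Injective f) (hg : Function.Injective g)
    (h : Finset.univ.image f = Finset.univ.image g) : ∃ e : J ≃ I, ∀ j, f (e j) = g j := by
  have h1 : ∀ j, ∃ i, f i = g j := fun j => by
    have : g j ∈ Finset.univ.image f := h ▸ Finset.mem_image_of_mem _ (Finset.mem_univ j)
    simpa using this
  choose e he using h1
  refine ⟨Equiv.ofBijective e ⟨fun j j' hj => hg (by rw [← he, ← he, hj]), fun i => ?_⟩, he⟩
  have : f i ∈ Finset.univ.image g := h ▸ Finset.mem_image_of_mem _ (Finset.mem_univ i)
  obtain ⟨j, -, hj⟩ := Finset.mem_image.1 this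
  exact ⟨j, hf (by rw [he, hj])⟩

variable {I : Type} [Fintype I] [DecidableEq I]

lemma isBase_fin (N : ℕ) : IsBase (fun i : Fin N => (i : ℤ)) :=
  ⟨fun i j h => Fin.ext (by simpa using h), fun i => ⟨by positivity, by simp⟩⟩

lemma IsBase.image {κ : I → ℤ} (h : IsBase κ) :
    Finset.univ.image κ = Finset.Ico (0 : ℤ) (Fintype.card I) := by
  refine Finset.eq_of_subset_of_card_le (fun p hp => ?_) ?_
  · obtain ⟨i, -, rfl⟩ := Finset.mem_image.1 hp
    exact Finset.mem_Ico.2 (h.2 i)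
  · rw [Finset.card_image_of_injective _ h.1]; simp

lemma mn_eq_chi {κ : I → ℤ} (hκ : IsBase κ) {b : I → ℤ} (hb : Function.Injective b)
    {B : Finset ℤ} (hB : Finset.univ.image b = B) :
    ∃ s : ℤ, (s = 1 ∨ s = -1) ∧ ∀ l, mn (eps κ) l b = s * chi (Fintype.card I) B l := by
  have hc : B.card = Fintype.card I := by
    rw [← hB, Finset.card_image_of_injective _ hb]; rfl
  obtain ⟨e, he⟩ := exists_equiv_of_image_eq hκ.1 (isBase_fin (Fintype.card I)).1 (by
    rw [hκ.image, (isBase_fin _).image]; simp)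
  obtain ⟨e', he'⟩ := exists_equiv_of_image_eq (enum_injective hc)
    (hb.comp e.injective) (by
      rw [image_enum hc, ← hB]
      ext p; simp only [Finset.mem_image, Finset.mem_univ, true_and, Function.comp_apply]
      exact ⟨fun ⟨i, hi⟩ => ⟨e.symm i, by simpa using hi⟩, fun ⟨i, hi⟩ => ⟨_, hi⟩⟩)
  refine ⟨Equiv.Perm.sign e', ?_, fun l => ?_⟩
  · rcases Int.units_eq_one_or (Equiv.Perm.sign e') with h | h <;> simp [h]
  · rw [← mn_eps_equiv e κ b l]
    have h1 : κ ∘ e = fun i : Fin (Fintype.card I) => (i : ℤ) := funext he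
    have h2 : b ∘ e = enum (Fintype.card I) B ∘ e' := (funext he').symm
    rw [h1, h2, (alt_eps _).mn l]; rfl

lemma finite_lab (N n : ℕ) : {B : Finset ℤ | IsLab N n B}.Finite := by
  refine (Finset.finite_toSet ((Finset.Icc (0 : ℤ) (n + ∑ x ∈ Finset.range N, (x : ℤ))).powerset)).subset ?_
  rintro B ⟨h1, h2, h3⟩
  simp only [Finset.coe_powerset, Set.mem_preimage, Set.mem_powerset_iff, Finset.coe_subset]
  intro p hp
  rw [Finset.mem_Icc, ← h3]
  exact ⟨h2 p hp, Finset.single_le_sum (f := fun p => p) (fun q hq => h2 q hq) hp⟩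

/-- Partitions of `n`, encoded by sets of `N` beta numbers. -/
abbrev Lab (N n : ℕ) : Type := {B : Finset ℤ // IsLab N n B}

instance (N n : ℕ) : Fintype (Lab N n) := (finite_lab N n).fintype

lemma isLab_of_chi_ne_zero {N : ℕ} {b : Fin N → ℤ} {l : List ℕ}
    (h : mn (eps fun i : Fin N => (i : ℤ)) l b ≠ 0) : IsLab N l.sum (Finset.univ.image b) := by
  obtain ⟨h1, h2, h3⟩ := mn_eps_ne_zero (fun i => by positivity) h
  refine ⟨by rw [Finset.card_image_of_injective _ h1]; simp, ?_, ?_⟩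
  · intro p hp
    obtain ⟨i, -, rfl⟩ := Finset.mem_image.1 hp
    exact h2 i
  · rw [Finset.sum_image fun i _ j _ h => h1 h, h3, add_comm, (isBase_fin N).sum]
    simp

lemma sum_chi_mul {N n : ℕ} (hn : 2 * n ≤ N) {l l' : List ℕ} (hl : l.sum = n) (hl' : l'.sum = n)
    (h0 : ∀ s ∈ l, 0 < s) (h0' : ∀ s ∈ l', 0 < s) :
    ∑ B : Lab N n, chi N B.1 l * chi N B.1 l' = zf l l' := by
  have key := finsum_mn_mul (isBase_fin N) (n := n) (by simpa using hn) l l' hl.le h0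
    (fun s hs => ⟨h0' s hs, hl' ▸ List.le_sum_of_mem hs⟩)
  let g : Lab N n × Equiv.Perm (Fin N) → Fin N → ℤ := fun x => enum N x.1.1 ∘ x.2
  have hg : Function.Injective g := by
    rintro ⟨B, τ⟩ ⟨B', τ'⟩ h
    have him : ∀ (B : Lab N n) (τ : Equiv.Perm (Fin N)),
        Finset.univ.image (enum N B.1 ∘ τ) = B.1 := fun B τ => by
      rw [← Finset.image_image, Finset.image_univ_equiv, image_enum B.2.1]
    have hB : B = B' := Subtype.ext (by rw [← him B τ, ← him B' τ']; exact congrArg (fun f : Fin N → ℤ => Finset.univ.image f) h)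
    subst hB
    have : τ = τ' := by
      ext i : 1
      exact enum_injective B.2.1 (congrFun h i)
    rw [this]
  rw [finsum_eq_sum_of_support_subset (s := Finset.univ.image g), Finset.sum_image
    (fun x _ y _ h => hg h), Fintype.sum_prod_type] at key
  · have h1 : ∀ B : Lab N n, ∑ τ : Equiv.Perm (Fin N),
        mn (eps fun i : Fin N => (i : ℤ)) l (g (B, τ)) *
          mn (eps fun i : Fin N => (i : ℤ)) l' (g (B, τ)) =
        (Fintype.card (Fin N)).factorial * (chi N B.1 l * chi N B.1 l') := by
      intro B
      rw [← Fintype.card_perm, ← nsmul_eq_mul, ← Finset.card_univ, ← Finset.sum_const]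
      refine Finset.sum_congr rfl fun τ _ => ?_
      simp only [g]
      rw [(alt_eps _).mn l, (alt_eps _).mn l', chi, chi]
      have : ((Equiv.Perm.sign τ : ℤˣ) : ℤ) * (Equiv.Perm.sign τ : ℤˣ) = 1 := by
        rw [← Units.val_mul, Int.units_mul_self]; rfl
      linear_combination (mn (eps fun i : Fin N => (i : ℤ)) l (enum N B.1) *
        mn (eps fun i : Fin N => (i : ℤ)) l' (enum N B.1)) * this
    rw [Finset.sum_congr rfl fun B _ => h1 B, ← Finset.mul_sum] at key
    exact mul_left_cancel₀ (by exact_mod_cast Nat.factorial_ne_zero _) key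
  · intro b hb
    have h2 := isLab_of_chi_ne_zero (left_ne_zero_of_mul hb)
    rw [hl] at h2
    have hinj := (mn_eps_ne_zero (fun i => by positivity) (left_ne_zero_of_mul hb)).1
    obtain ⟨e, he⟩ := exists_equiv_of_image_eq (enum_injective h2.1) hinj (image_enum h2.1)
    rw [Finset.coe_image, Finset.coe_univ, Set.image_univ]
    exact ⟨(⟨_, h2⟩, e), funext he⟩

lemma chi_ones {N n : ℕ} {B : Finset ℤ} (h : IsLab N n B) :
    chi N B (List.replicate n 1) ≠ 0 ∧ 2 * (padicValInt 2 (chi N B (List.replicate n 1)) : ℤ) =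
      2 * padicValNat 2 n.factorial + En B := by
  have h1 := mn_ones_val (b := enum N B) n (by
    rw [← Finset.sum_image (f := fun p : ℤ => p) (g := enum N B) (s := Finset.univ)
      (fun i _ j _ hij => enum_injective h.1 hij),
      image_enum h.1, h.2.2, (isBase_fin N).sum]; simp) (enum_injective h.1) (fun i => h.2.1 _ (enum_mem h.1 i))
  rwa [image_enum h.1] at h1

lemma chi_perm {N : ℕ} {B : Finset ℤ} {l l' : List ℕ} (h : l.Perm l') : chi N B l = chi N B l' :=
  mn_perm (I := Fin N) _ h _

end Labels

section Classification

variable {Ω : Type} [Fintype Ω] [DecidableEq Ω]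

lemma cl_perm_iff {A : Type} [Fintype A] [DecidableEq A] {g : Equiv.Perm Ω} {h : Equiv.Perm A} :
    (cl g).Perm (cl h) ↔ cyc g = cyc h := by
  rw [← Multiset.coe_eq_coe, coe_cl, coe_cl]

lemma cl_sum (g : Equiv.Perm Ω) : (cl g).sum = Fintype.card Ω := by
  rw [← cyc_sum g, ← coe_cl g, Multiset.sum_coe]

lemma cl_pos (g : Equiv.Perm Ω) : ∀ s ∈ cl g, 0 < s := fun s hs =>
  cyc_pos (g := g) (by rw [← coe_cl g]; exact hs)

lemma cyc_inv (g : Equiv.Perm Ω) : cyc g⁻¹ = cyc g := by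
  simp [cyc]

lemma cl_one : cl (1 : Equiv.Perm Ω) = List.replicate (Fintype.card Ω) 1 := by
  rw [← List.perm_replicate, ← Multiset.coe_eq_coe, coe_cl]
  simp [cyc, Multiset.coe_replicate]

lemma card_conj_eq_zf (g h : Equiv.Perm Ω) :
    ((Finset.univ.filter fun t : Equiv.Perm Ω => t * g * t⁻¹ = h).card : ℤ) = zf (cl g) (cl h) := by
  by_cases hgh : cyc g = cyc h
  · have : Fintype (Subgroup.centralizer {g}) := Fintype.ofFinite _
    obtain ⟨t₀, ht₀⟩ := isConj_iff.1 (isConj_iff_cyc_eq.2 hgh)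
    have hz : zf (cl g) (cl h) = zf (cl g) (cl g) := by
      rw [zf_of_perm (cl_perm_iff.2 hgh) (cl g).toFinset (by simp),
        zf_of_perm (List.Perm.refl _) (cl g).toFinset (by simp)]
    rw [hz, ← card_centralizer g (coe_cl g), Nat.card_eq_fintype_card, ← Fintype.card_coe]
    congr 1
    refine Fintype.card_congr
      ⟨fun t => ⟨t₀⁻¹ * t.1, ?_⟩, fun t => ⟨t₀ * t.1, ?_⟩, fun t => ?_, fun t => ?_⟩
    · have := (Finset.mem_filter.1 t.2).2
      rw [Subgroup.mem_centralizer_singleton_iff]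
      have h2 : g = t₀⁻¹ * (t.1 * g * t.1⁻¹) * t₀ := by rw [this, ← ht₀]; group
      calc t₀⁻¹ * t.1 * g = (t₀⁻¹ * (t.1 * g * t.1⁻¹) * t₀) * (t₀⁻¹ * t.1) := by group
        _ = _ := by rw [← h2]
    · have := Subgroup.mem_centralizer_singleton_iff.1 t.2
      simp only [Finset.mem_filter, Finset.mem_univ, true_and]
      rw [← ht₀, mul_inv_rev]
      calc t₀ * t.1 * g * (t.1⁻¹ * t₀⁻¹) = t₀ * (t.1 * g) * t.1⁻¹ * t₀⁻¹ := by group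
        _ = _ := by rw [this]; group
    · ext1; simp
    · ext1; simp
  · rw [Finset.filter_false_of_mem]
    · by_contra hz
      exact hgh (cl_perm_iff.1 (perm_of_zf_ne_zero (Ne.symm (by simpa using hz))))
    · intro t _ ht
      exact hgh (isConj_iff_cyc_eq.1 (isConj_iff.2 ⟨t, ht⟩))

lemma sum_zf_mul (φ : Equiv.Perm Ω → ℂ) (hφ : ∀ g t, φ (t * g * t⁻¹) = φ g) (g : Equiv.Perm Ω) :
    ∑ h, (zf (cl g) (cl h) : ℂ) * φ h = Fintype.card (Equiv.Perm Ω) * φ g := by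
  have : ∀ h, (zf (cl g) (cl h) : ℂ) * φ h =
      ∑ t : Equiv.Perm Ω, if t * g * t⁻¹ = h then φ (t * g * t⁻¹) else 0 := by
    intro h
    rw [← card_conj_eq_zf, Int.cast_natCast, Finset.card_filter, Nat.cast_sum, Finset.sum_mul]
    refine Finset.sum_congr rfl fun t _ => ?_
    split_ifs with h1 <;> simp [h1]
  rw [Finset.sum_congr rfl fun h _ => this h, Finset.sum_comm]
  simp [hφ]

lemma chi_cl_inv (N : ℕ) (B : Finset ℤ) (g : Equiv.Perm Ω) :
    chi N B (cl g⁻¹) = chi N B (cl g) := chi_perm (cl_perm_iff.2 (cyc_inv g))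

lemma chi_cl_conj (N : ℕ) (B : Finset ℤ) (g t : Equiv.Perm Ω) :
    chi N B (cl (t * g * t⁻¹)) = chi N B (cl g) :=
  chi_perm (cl_perm_iff.2 (isConj_iff_cyc_eq.1 (isConj_iff.2 ⟨t, rfl⟩).symm))

/-- The irreducible characters of a symmetric group are classified by sets of beta numbers, with
values given, up to a global sign, by the Murnaghan–Nakayama recursion. -/
theorem exists_lab_equiv {N n : ℕ} (hn : Fintype.card Ω = n) (hN : 2 * n ≤ N) :
    ∃ e : Lab N n ≃ Irr (Equiv.Perm Ω), ∀ B, ∃ s : ℤ, (s = 1 ∨ s = -1) ∧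
      ∀ g, (e B : Equiv.Perm Ω → ℂ) g = (s * chi N B.1 (cl g) : ℤ) := by
  let f : Lab N n → Equiv.Perm Ω → ℂ := fun B g => (chi N B.1 (cl g) : ℂ)
  have hv : ∀ B, f B ∈ Virt (Equiv.Perm Ω) := fun B => mn_mem_Virt _ _
  have hker : ∀ g h, ∑ B, f B g * f B h = (zf (cl g) (cl h) : ℂ) := by
    intro g h
    rw [← sum_chi_mul hN ((cl_sum g).trans hn) ((cl_sum h).trans hn) (cl_pos g) (cl_pos h)]
    simp [f]
  have hinv : ∀ B g, f B g⁻¹ = f B g := fun B g => by simp only [f, chi_cl_inv]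
  have hconj : ∀ B g t, f B (t * g * t⁻¹) = f B g := fun B g t => by simp only [f, chi_cl_conj]
  have hcard : (Nat.card (Equiv.Perm Ω) : ℂ) ≠ 0 := card_ne_zero'
  have hexp : ∀ φ : Equiv.Perm Ω → ℂ, (∀ g t, φ (t * g * t⁻¹) = φ g) → ∀ g,
      ∑ B, pair φ (f B) * f B g = φ g := by
    intro φ hφ g
    have : ∀ B, pair φ (f B) * f B g =
        (Nat.card (Equiv.Perm Ω) : ℂ)⁻¹ * ∑ h, φ h * (f B g * f B h) := by
      intro B
      rw [pair, mul_assoc, Finset.sum_mul]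
      congr 1
      exact Finset.sum_congr rfl fun h _ => by rw [hinv]; ring
    rw [Finset.sum_congr rfl fun B _ => this B, ← Finset.mul_sum, Finset.sum_comm]
    simp only [← Finset.mul_sum, hker]
    rw [Finset.sum_congr rfl fun h _ => mul_comm (φ h) _, sum_zf_mul φ hφ,
      ← Nat.card_eq_fintype_card, inv_mul_cancel_left₀ hcard]
  choose G hG using fun B C => pair_Virt_int (hv B) (hv C)
  have hGs : ∀ B C, G B C = G C B := fun B C => by
    have := hG B C
    rw [pair_comm, hG C B] at this
    exact_mod_cast this.symm
  have hG2 : ∀ B C, ∑ D, G B D * G D C = G B C := by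
    intro B C
    have : f B = ∑ D, G B D • f D := by
      ext g
      rw [← hexp (f B) (hconj B) g]
      simp [hG]
    have h2 := hG B C
    rw [this, pair_sum_left] at h2
    simp only [pair_zsmul_left, hG] at h2
    exact_mod_cast h2
  have hpos : ∀ B, G B B ≠ 0 := by
    intro B h0
    have h1 := hG B B
    rw [h0, pair] at h1
    have h2 : ∑ g : Equiv.Perm Ω, chi N B.1 (cl g) * chi N B.1 (cl g) = 0 := by
      have := (mul_eq_zero.1 (h1.trans Int.cast_zero)).resolve_left (inv_ne_zero hcard)
      simp only [hinv, f] at this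
      exact_mod_cast this
    have h3 := (Finset.sum_eq_zero_iff_of_nonneg fun g _ => mul_self_nonneg _).1 h2 1
      (Finset.mem_univ _)
    rw [cl_one, hn] at h3
    exact (chi_ones B.2).1 (mul_self_eq_zero.1 h3)
  have hG1 : ∀ B, G B B = 1 ∧ ∀ C, B ≠ C → G B C = 0 := by
    intro B
    have h1 := hG2 B B
    rw [← Finset.add_sum_erase _ _ (Finset.mem_univ B)] at h1
    have h2 : 0 ≤ ∑ D ∈ Finset.univ.erase B, G B D * G D B :=
      Finset.sum_nonneg fun D _ => by rw [hGs D B]; exact mul_self_nonneg _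
    have h3 : G B B = 1 := by
      have := hpos B
      have h4 : G B B * (G B B - 1) ≤ 0 := by linarith
      have h5 : 0 < G B B := by
        rcases lt_or_gt_of_ne this with h | h
        · nlinarith
        · exact h
      nlinarith
    refine ⟨h3, fun C hC => ?_⟩
    rw [h3] at h1
    have h4 : ∑ D ∈ Finset.univ.erase B, G B D * G D B = 0 := by linarith
    have h5 := (Finset.sum_eq_zero_iff_of_nonneg fun D _ => by
      rw [hGs D B]; exact mul_self_nonneg _).1 h4 C (by simp [hC.symm])
    rw [hGs C B] at h5
    exact mul_self_eq_zero.1 h5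
  obtain ⟨e, he⟩ := orthonormal_equiv f hv (fun B => by rw [hG, (hG1 B).1]; simp)
    (fun B C hBC => by rw [hG, (hG1 B).2 C hBC]; simp) (fun χ hχ => by
      by_contra! hc
      obtain ⟨m, hm, h1⟩ := Irr_one hχ
      have := hexp χ (fun g t => Irr_conj hχ g t) 1
      simp only [hc, zero_mul, Finset.sum_const_zero] at this
      rw [h1] at this
      exact hm.ne (by exact_mod_cast this))
  refine ⟨e, fun B => ?_⟩
  obtain ⟨s, hs, h⟩ := he B
  exact ⟨s, hs, fun g => by rw [h]; simp [f]⟩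

end Classification

section Arithmetic

lemma padicValNat_factorial_two_pow_mul_add (k a : ℕ) {t : ℕ} (ht : t < 2 ^ k) :
    padicValNat 2 (2 ^ k * a + t).factorial =
      padicValNat 2 a.factorial + (2 ^ k - 1) * a + padicValNat 2 t.factorial := by
  have half : ∀ m, padicValNat 2 m.factorial = padicValNat 2 (m / 2).factorial + m / 2 := by
    intro m
    conv_lhs => rw [← Nat.div_add_mod m 2]
    rw [padicValNat_factorial_mul_add _ (Nat.mod_lt _ two_pos), padicValNat_factorial_mul]
  induction k generalizing t with
  | zero => simp at ht; subst ht; simp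
  | succ k ih =>
    rw [half, half t]
    have h1 : (2 ^ (k + 1) * a + t) / 2 = 2 ^ k * a + t / 2 := by
      rw [pow_succ, mul_comm (2 ^ k) 2, mul_assoc]; omega
    rw [h1, ih (by rw [pow_succ] at ht; omega)]
    have : 1 ≤ 2 ^ k := Nat.one_le_two_pow
    rw [pow_succ]
    zify [this, show 1 ≤ 2 ^ k * 2 by omega]
    ring

lemma padicValInt_add_two_pow {k : ℕ} {d : ℤ} (h : ¬ ((2 ^ k : ℕ) : ℤ) ∣ d) (e : ℤ)
    (he : ((2 ^ k : ℕ) : ℤ) ∣ e) : padicValInt 2 (d + e) = padicValInt 2 d := by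
  have hd : d ≠ 0 := by rintro rfl; simp at h
  have hde : d + e ≠ 0 := by intro h0; exact h (by rw [eq_neg_of_add_eq_zero_left h0]; exact he.neg_right)
  have hk : ∀ j, ((2 : ℕ) : ℤ) ^ j ∣ d ↔ ((2 : ℕ) : ℤ) ^ j ∣ d + e := by
    intro j
    by_cases hj : j ≤ k
    · have : ((2 : ℕ) : ℤ) ^ j ∣ e := (pow_dvd_pow _ hj).trans (by exact_mod_cast he)
      exact (dvd_add_left this).symm
    · have hj' : ((2 ^ k : ℕ) : ℤ) ∣ ((2 : ℕ) : ℤ) ^ j := by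
        push_cast; exact pow_dvd_pow _ (by omega)
      exact ⟨fun h1 => absurd (hj'.trans h1) h,
        fun h1 => absurd ((dvd_add_left he).1 (hj'.trans h1)) h⟩
  refine le_antisymm ?_ ?_
  · have h1 : ((2 : ℕ) : ℤ) ^ padicValInt 2 (d + e) ∣ d + e := padicValInt_dvd _
    exact ((padicValInt_dvd_iff _ _).1 ((hk _).2 h1)).resolve_left hd
  · have h1 : ((2 : ℕ) : ℤ) ^ padicValInt 2 d ∣ d := padicValInt_dvd _
    exact ((padicValInt_dvd_iff _ _).1 ((hk _).1 h1)).resolve_left hde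

end Arithmetic

section Flush

variable {q : ℕ}

/-- A set of beta numbers from which no bead can be moved down by `q`. -/
def Flush (q : ℕ) (K : Finset ℤ) : Prop := ∀ p ∈ K, (q : ℤ) ≤ p → p - q ∈ K

lemma Flush.down {K : Finset ℤ} (h : Flush q K) (hq : 0 < q) {p p' : ℤ} (hp : p ∈ K) (h0 : 0 ≤ p')
    (hle : p' ≤ p) (hd : (q : ℤ) ∣ p - p') : p' ∈ K := by
  obtain ⟨a, ha⟩ := hd
  have ha0 : 0 ≤ a := by
    by_contra! hn
    have : (q : ℤ) * a < 0 := mul_neg_of_pos_of_neg (by exact_mod_cast hq) hn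
    lia
  obtain ⟨m, rfl⟩ := Int.eq_ofNat_of_zero_le ha0
  induction m generalizing p with
  | zero => simp at ha; rwa [show p' = p by lia]
  | succ m ih =>
    have hqm : (0 : ℤ) ≤ q * m := by positivity
    push_cast at ha
    refine ih (h p hp (by nlinarith)) (by nlinarith) (by linarith) (by positivity)

lemma Flush.eq {I : Type} [Fintype I] {κ c : I → ℤ} (hq : 0 < q) (hκ : Function.Injective κ)
    (hc : Function.Injective c) (h0κ : ∀ i, 0 ≤ κ i) (h0c : ∀ i, 0 ≤ c i)
    (hfκ : Flush q (Finset.univ.image κ)) (hfc : Flush q (Finset.univ.image c))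
    (h : ∀ i, (q : ℤ) ∣ κ i - c i) : Finset.univ.image κ = Finset.univ.image c := by
  classical
  have key : ∀ {κ c : I → ℤ}, Function.Injective κ → Function.Injective c → (∀ i, 0 ≤ κ i) →
      (∀ i, 0 ≤ c i) → Flush q (Finset.univ.image κ) → Flush q (Finset.univ.image c) →
      (∀ i, (q : ℤ) ∣ κ i - c i) → Finset.univ.image κ ⊆ Finset.univ.image c := by
    intro κ c hκ hc h0κ h0c hfκ hfc h p hp
    by_contra hpc
    obtain ⟨i, -, rfl⟩ := Finset.mem_image.1 hp
    -- the beads of `c` in this residue class are at positions below `κ i`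
    let R : Finset I := Finset.univ.filter fun j => (q : ℤ) ∣ κ j - κ i
    have h1 : ∀ j ∈ R, c j ∈ (R.erase i).image κ := by
      intro j hj
      have hj' : (q : ℤ) ∣ κ j - κ i := (Finset.mem_filter.1 hj).2
      have hd : (q : ℤ) ∣ c j - κ i := by
        have := dvd_sub hj' (h j)
        rwa [show κ j - κ i - (κ j - c j) = c j - κ i by ring] at this
      have hlt : c j < κ i := by
        by_contra! hge
        exact hpc (hfc.down hq (Finset.mem_image_of_mem _ (Finset.mem_univ j)) (h0κ i) hge hd)
      obtain ⟨j', -, hj''⟩ := Finset.mem_image.1 (hfκ.down hq hp (h0c j) hlt.le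
        (by rw [← neg_sub]; exact hd.neg_right))
      refine Finset.mem_image.2 ⟨j', ?_, hj''⟩
      rw [Finset.mem_erase]
      refine ⟨by rintro rfl; lia, Finset.mem_filter.2 ⟨Finset.mem_univ _, by rwa [hj'']⟩⟩
    have h2 : R.card ≤ (R.erase i).card := by
      calc R.card = (R.image c).card := (Finset.card_image_of_injective _ hc).symm
        _ ≤ ((R.erase i).image κ).card := Finset.card_le_card fun p hp => by
            obtain ⟨j, hj, rfl⟩ := Finset.mem_image.1 hp
            exact h1 j hj
        _ = _ := Finset.card_image_of_injective _ hκ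
    have h3 : i ∈ R := Finset.mem_filter.2 ⟨Finset.mem_univ _, by simp⟩
    exact absurd (Finset.card_erase_lt_of_mem h3) (not_lt.2 h2)
  exact (key hκ hc h0κ h0c hfκ hfc h).antisymm
    (key hc hκ h0c h0κ hfc hfκ fun i => by rw [← neg_sub]; exact (h i).neg_right)

variable {I : Type} [Fintype I] [DecidableEq I]

lemma flush_of_sum {b : I → ℤ} (hb : Function.Injective b) (h0 : ∀ i, 0 ≤ b i)
    (hs : ∑ i, b i < ∑ x ∈ Finset.range (Fintype.card I), (x : ℤ) + q) :
    Flush q (Finset.univ.image b) := by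
  intro p hp hqp
  by_contra hc
  obtain ⟨i, -, rfl⟩ := Finset.mem_image.1 hp
  have hb' : Function.Injective (b - (Pi.single i (q : ℤ) : I → ℤ)) := by
    have key : ∀ j, j ≠ i → b j - q * 0 ≠ b i - q := fun j _ hj =>
      hc (Finset.mem_image.2 ⟨j, Finset.mem_univ _, by simpa using hj⟩)
    intro j j' hjj
    by_cases hj : j = i <;> by_cases hj' : j' = i
    · rw [hj, hj']
    · subst hj
      simp only [Pi.sub_apply, Pi.single_eq_same, Pi.single_eq_of_ne hj'] at hjj
      exact absurd (by linarith) (key j' hj')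
    · subst hj'
      simp only [Pi.sub_apply, Pi.single_eq_same, Pi.single_eq_of_ne hj] at hjj
      exact absurd (by linarith) (key j hj)
    · simp only [Pi.sub_apply, Pi.single_eq_of_ne hj, Pi.single_eq_of_ne hj'] at hjj
      exact hb (by linarith)
  have h2 := range_sum_le hb' (fun j => by
    by_cases hj : j = i
    · subst hj; simp only [Pi.sub_apply, Pi.single_eq_same]; linarith
    · simp only [Pi.sub_apply, Pi.single_eq_of_ne hj]; linarith [h0 j])
  simp only [Pi.sub_apply, Finset.sum_sub_distrib] at h2
  rw [Finset.sum_pi_single'] at h2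
  simp at h2
  linarith

/-- Evaluating the recursion along parts divisible by `q` only involves beta numbers in the same
residue classes modulo `q`. -/
lemma mn_congr_mod {E E' : (I → ℤ) → ℤ} {k : ℤ} {l : List ℕ} (hl : ∀ r ∈ l, q ∣ r) {b : I → ℤ}
    (h : ∀ c : I → ℤ, (∀ i, (q : ℤ) ∣ b i - c i) → E c = E' c * k) : mn E l b = mn E' l b * k := by
  induction l generalizing b with
  | nil => exact h b fun i => by simp
  | cons r l ih =>
    simp only [mn]
    rw [Finset.sum_mul]
    refine Finset.sum_congr rfl fun i _ => ih (fun r hr => hl r (by simp [hr])) fun c hc => h c ?_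
    intro j
    have hr : (q : ℤ) ∣ r := by exact_mod_cast hl r (by simp)
    have := hc j
    by_cases hj : j = i
    · subst hj
      simp only [Pi.sub_apply, Pi.single_eq_same] at this
      rw [show b j - c j = b j - r - c j + r by ring]
      exact dvd_add this hr
    · simpa [Pi.single_eq_of_ne hj] using this

lemma mn_eq_core_mul {P : (I → ℤ) → ℤ} (hP : Alt P) (hq : 0 < q)
    (hP' : ∀ b, P b ≠ 0 → Function.Injective b ∧ (∀ i, 0 ≤ b i) ∧ Flush q (Finset.univ.image b))
    {κ b : I → ℤ} (hκ : P κ ≠ 0) (hb : ∀ i, (q : ℤ) ∣ b i - κ i) {l : List ℕ}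
    (hl : ∀ r ∈ l, q ∣ r) : mn P l b = mn (eps κ) l b * P κ := by
  refine mn_congr_mod hl fun c hc => ?_
  have hκc : ∀ i, (q : ℤ) ∣ κ i - c i := fun i => by
    have := dvd_sub (hc i) (hb i); rwa [show b i - c i - (b i - κ i) = κ i - c i by ring] at this
  obtain ⟨h1, h2, h3⟩ := hP' κ hκ
  have key : ∀ τ : Equiv.Perm I, P (κ ∘ τ) = eps κ (κ ∘ τ) * P κ := fun τ => by
    rw [hP, alt_eps, eps_self h1, mul_one]
  by_cases hPc : P c = 0
  · rw [hPc]
    by_contra hne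
    obtain ⟨τ, rfl⟩ := eps_ne_zero (left_ne_zero_of_mul (Ne.symm hne))
    rw [← key, hPc] at hne
    exact hne rfl
  · obtain ⟨h1', h2', h3'⟩ := hP' c hPc
    obtain ⟨τ, hτ⟩ := exists_equiv_of_image_eq h1 h1' (Flush.eq hq h1 h1' h2 h2' h3 h3' hκc)
    rw [← funext hτ]
    exact key τ

end Flush

section AddBead

variable {I : Type} [Fintype I] [DecidableEq I] {q : ℕ}

/-- Shift the integers congruent to `ρ` modulo `q` by `q`. -/
def shift (q : ℕ) (ρ p : ℤ) : ℤ := if (q : ℤ) ∣ p - ρ then p + q else p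

lemma shift_dvd_iff (ρ p : ℤ) : (q : ℤ) ∣ shift q ρ p - ρ ↔ (q : ℤ) ∣ p - ρ := by
  unfold shift
  split_ifs with h
  · rw [show p + q - ρ = (p - ρ) + q by ring]; simp
  · rfl

lemma shift_injective (ρ : ℤ) : Function.Injective (shift q ρ) := by
  intro p p' h
  have := shift_dvd_iff (q := q) ρ p
  rw [h, shift_dvd_iff] at this
  unfold shift at h
  simp only [this] at h
  split_ifs at h <;> linarith

/-- Add a bead at the bottom of the runner `ρ`, moving up the other beads of this runner. -/
def addBead (q : ℕ) (ρ : ℤ) (B : Finset ℤ) : Finset ℤ := insert ρ (B.image (shift q ρ))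

/-- Function version of `addBead`. -/
def addB (q : ℕ) (ρ : ℤ) (b : I → ℤ) : Option I → ℤ := fun o => o.elim ρ fun i => shift q ρ (b i)

lemma image_addB (ρ : ℤ) (b : I → ℤ) :
    Finset.univ.image (addB q ρ b) = addBead q ρ (Finset.univ.image b) := by
  ext p
  simp [addBead, addB, Option.exists, eq_comm]

lemma shift_ne {ρ : ℤ} (hρq : ρ < q) {p : ℤ} (hp : 0 ≤ p) : shift q ρ p ≠ ρ := by
  intro h
  have := shift_dvd_iff (q := q) ρ p
  rw [h, sub_self] at this
  have := this.1 (dvd_zero _)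
  rw [shift, if_pos this] at h
  linarith

lemma le_shift (ρ p : ℤ) : p ≤ shift q ρ p := by
  unfold shift; split_ifs <;> simp

lemma addBead_injective {ρ : ℤ} (hρq : ρ < q) {B B' : Finset ℤ} (h0 : ∀ p ∈ B, 0 ≤ p)
    (h0' : ∀ p ∈ B', 0 ≤ p) (h : addBead q ρ B = addBead q ρ B') : B = B' := by
  have hn : ∀ {B : Finset ℤ}, (∀ p ∈ B, 0 ≤ p) → ρ ∉ B.image (shift q ρ) := by
    intro B h0 hm
    obtain ⟨p, hp, he⟩ := Finset.mem_image.1 hm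
    exact shift_ne hρq (h0 p hp) he
  have := congrArg (Finset.erase · ρ) h
  simp only [addBead, Finset.erase_insert (hn h0), Finset.erase_insert (hn h0')] at this
  exact Finset.image_injective (shift_injective ρ) this

lemma addB_injective {ρ : ℤ} (hρq : ρ < q) {b : I → ℤ} (hb : Function.Injective b)
    (h0 : ∀ i, 0 ≤ b i) : Function.Injective (addB q ρ b) := by
  rintro (_ | i) (_ | j) h
  · rfl
  · exact absurd h.symm (shift_ne hρq (h0 j))
  · exact absurd h (shift_ne hρq (h0 i))
  · rw [hb (shift_injective ρ h)]

lemma addB_nonneg {ρ : ℤ} (hρ : 0 ≤ ρ) {b : I → ℤ} (h0 : ∀ i, 0 ≤ b i) : ∀ i, 0 ≤ addB q ρ b i := by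
  rintro (_ | i)
  · exact hρ
  · exact (h0 i).trans (le_shift _ _)

lemma eps_addB {ρ : ℤ} (hρq : ρ < q) {κ : I → ℤ} (hκ : Function.Injective κ)
    (h0 : ∀ i, 0 ≤ κ i) (b : I → ℤ) : eps (addB q ρ κ) (addB q ρ b) = eps κ b := by
  have hinj := addB_injective hρq hκ h0
  by_cases hb : eps κ b = 0
  · rw [hb]
    by_contra hne
    obtain ⟨τ, hτ⟩ := eps_ne_zero hne
    have h1 : τ none = none := hinj (by
      have := congrFun hτ none
      exact this.symm)
    have h2 : τ = Equiv.optionCongr (Equiv.removeNone τ) := by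
      rw [map_equiv_removeNone, h1, Equiv.swap_self]; rfl
    have h3 : b = κ ∘ Equiv.removeNone τ := by
      ext i
      have := congrFun hτ (some i)
      rw [h2] at this
      exact shift_injective ρ this
    rw [h3, alt_eps, eps_self hκ] at hb
    rcases Int.units_eq_one_or (Equiv.Perm.sign (Equiv.removeNone τ)) with h | h <;> simp [h] at hb
  · obtain ⟨τ, rfl⟩ := eps_ne_zero hb
    have : addB q ρ (κ ∘ τ) = addB q ρ κ ∘ (Equiv.optionCongr τ) := by
      ext (_ | i) <;> rfl
    rw [this, alt_eps, alt_eps, eps_self hκ, eps_self hinj, Equiv.optionCongr_sign]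

lemma mn_addB {ρ : ℤ} (hρ : 0 ≤ ρ) (hρq : ρ < q) {κ : I → ℤ} (hκ : Function.Injective κ)
    (h0 : ∀ i, 0 ≤ κ i) {l : List ℕ} (hl : ∀ r ∈ l, 0 < r ∧ q ∣ r) (b : I → ℤ) :
    mn (eps (addB q ρ κ)) l (addB q ρ b) = mn (eps κ) l b := by
  induction l generalizing b with
  | nil => exact eps_addB hρq hκ h0 b
  | cons r l ih =>
    have ih' := ih (fun r hr => hl r (by simp [hr]))
    obtain ⟨hr0, hr⟩ := hl r (by simp)
    simp only [mn]
    rw [Fintype.sum_option]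
    have h1 : mn (eps (addB q ρ κ)) l (addB q ρ b - Pi.single none (r : ℤ)) = 0 := by
      by_contra hne
      have := (mn_eps_ne_zero (addB_nonneg hρ h0) hne).2.1 none
      simp only [Pi.sub_apply, Pi.single_eq_same, addB, Option.elim_none] at this
      have : (q : ℤ) ≤ r := by exact_mod_cast Nat.le_of_dvd hr0 hr
      linarith
    rw [h1, zero_add]
    refine Finset.sum_congr rfl fun i _ => ?_
    rw [← ih']
    congr 1
    ext (_ | j)
    · simp [addB]
    · by_cases hj : j = i
      · subst hj
        simp only [addB, Pi.sub_apply, Pi.single_eq_same, Option.elim_some, shift]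
        have hr' : (q : ℤ) ∣ r := by exact_mod_cast hr
        have : (q : ℤ) ∣ b j - r - ρ ↔ (q : ℤ) ∣ b j - ρ := by
          rw [show b j - r - ρ = b j - ρ - r by ring]; exact dvd_sub_left hr'
        simp only [this]
        split_ifs <;> ring
      · simp [addB, Pi.single_eq_of_ne hj, Pi.single_eq_of_ne (show some j ≠ some i by simpa using hj)]

/-- `En` for a family of beta numbers. -/
def Ef (b : I → ℤ) : ℤ :=
  ∑ i, ∑ j, (padicValInt 2 (b i - b j) : ℤ) - 2 * ∑ i, (padicValNat 2 (b i).toNat.factorial : ℤ)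

lemma En_image {b : I → ℤ} (hb : Function.Injective b) : En (Finset.univ.image b) = Ef b := by
  rw [En, Ef, Finset.sum_image (fun i _ j _ h => hb h), Finset.sum_image (fun i _ j _ h => hb h),
    Finset.sum_congr rfl fun i _ => Finset.sum_image (fun i _ j _ h => hb h)]

lemma padicValInt_comm (a b : ℤ) : padicValInt 2 (a - b) = padicValInt 2 (b - a) := by
  rw [← neg_sub, padicValInt, padicValInt, Int.natAbs_neg]

lemma val_shift_sub {k : ℕ} (ρ p p' : ℤ) :
    padicValInt 2 (shift (2 ^ k) ρ p - shift (2 ^ k) ρ p') = padicValInt 2 (p - p') := by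
  unfold shift
  split_ifs with h1 h2 h2
  · congr 1; ring
  · rw [show p + (2 ^ k : ℕ) - p' = p - p' + (2 ^ k : ℕ) by ring]
    refine padicValInt_add_two_pow (fun h => h2 ?_) _ dvd_rfl
    have := dvd_sub h1 h
    rwa [show p - ρ - (p - p') = p' - ρ by ring] at this
  · rw [show p - (p' + (2 ^ k : ℕ)) = p - p' + -(2 ^ k : ℕ) by ring]
    refine padicValInt_add_two_pow (fun h => h1 ?_) _ dvd_rfl.neg_right
    have := dvd_add h2 h
    rwa [show p' - ρ + (p - p') = p - ρ by ring] at this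
  · rfl

/-- Contribution of a bead when a new bead is added to a runner. -/
def cost (k : ℕ) (ρ p : ℤ) : ℤ :=
  2 * padicValInt 2 (shift (2 ^ k) ρ p - ρ) - 2 * (padicValNat 2 (shift (2 ^ k) ρ p).toNat.factorial : ℤ)
    + 2 * (padicValNat 2 p.toNat.factorial : ℤ)

lemma cost_congr {k : ℕ} {ρ p p' : ℤ} (hρ : 0 ≤ ρ) (hρq : ρ < (2 ^ k : ℕ)) (hp : 0 ≤ p) (hp' : 0 ≤ p')
    (h : ((2 ^ k : ℕ) : ℤ) ∣ p - p') : cost k ρ p = cost k ρ p' := by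
  have hiff : ((2 ^ k : ℕ) : ℤ) ∣ p - ρ ↔ ((2 ^ k : ℕ) : ℤ) ∣ p' - ρ := by
    rw [show p - ρ = p - p' + (p' - ρ) by ring]; exact dvd_add_right h
  by_cases hd : ((2 ^ k : ℕ) : ℤ) ∣ p - ρ
  · have key : ∀ p : ℤ, 0 ≤ p → ((2 ^ k : ℕ) : ℤ) ∣ p - ρ →
        cost k ρ p = 2 * k - 2 * (2 ^ k - 1 : ℕ) := by
      intro p hp hd
      rw [cost, shift, if_pos hd]
      obtain ⟨a, ha⟩ := hd
      have hq : (0 : ℤ) < (2 ^ k : ℕ) := by positivity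
      have ha0 : 0 ≤ a := by
        by_contra! hn
        have : ((2 ^ k : ℕ) : ℤ) * a ≤ (2 ^ k : ℕ) * (-1) := by gcongr; lia
        lia
      lift a to ℕ using ha0
      lift ρ to ℕ using hρ
      have hp1 : p = ((2 ^ k * a + ρ : ℕ) : ℤ) := by push_cast; push_cast at ha; linarith
      have hp2 : p + (2 ^ k : ℕ) = ((2 ^ k * (a + 1) + ρ : ℕ) : ℤ) := by rw [hp1]; push_cast; ring
      have hp3 : p + (2 ^ k : ℕ) - ρ = ((2 ^ k * (a + 1) : ℕ) : ℤ) := by rw [hp2]; push_cast; ring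
      have hρ' : ρ < 2 ^ k := by exact_mod_cast hρq
      rw [hp3, hp2, hp1, Int.toNat_natCast, Int.toNat_natCast,
        padicValNat_factorial_two_pow_mul_add _ _ hρ', padicValNat_factorial_two_pow_mul_add _ _ hρ',
        padicValInt.of_nat, padicValNat.mul (by positivity) (by omega), padicValNat.prime_pow,
        Nat.factorial_succ, padicValNat.mul (by omega) (Nat.factorial_ne_zero _)]
      push_cast
      ring
    rw [key p hp hd, key p' hp' (hiff.1 hd)]
  · have h2 : padicValInt 2 (p - ρ) = padicValInt 2 (p' - ρ) := by
      rw [show p - ρ = p' - ρ + (p - p') by ring]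
      exact padicValInt_add_two_pow (fun hh => hd (hiff.2 hh)) _ h
    rw [cost, cost, shift, if_neg hd, shift, if_neg (fun hh => hd (hiff.2 hh)), h2]
    ring

lemma Ef_addB {k : ℕ} (ρ : ℤ) (b : I → ℤ) :
    Ef (addB (2 ^ k) ρ b) = Ef b + ∑ i, cost k ρ (b i) - 2 * (padicValNat 2 ρ.toNat.factorial : ℤ) := by
  simp only [Ef, Fintype.sum_option, addB, Option.elim_none, Option.elim_some, sub_self, val_shift_sub,
    cost]
  rw [Finset.sum_add_distrib, Finset.sum_add_distrib, Finset.sum_sub_distrib, ← Finset.mul_sum,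
    ← Finset.mul_sum, ← Finset.mul_sum]
  simp only [padicValInt_comm ρ]
  simp
  ring

lemma Ef_addB_sub {k : ℕ} {ρ : ℤ} (hρ : 0 ≤ ρ) (hρq : ρ < (2 ^ k : ℕ)) {κ b : I → ℤ}
    (hκ : ∀ i, 0 ≤ κ i) (hb : ∀ i, 0 ≤ b i) (h : ∀ i, ((2 ^ k : ℕ) : ℤ) ∣ b i - κ i) :
    Ef (addB (2 ^ k) ρ b) - Ef (addB (2 ^ k) ρ κ) = Ef b - Ef κ := by
  rw [Ef_addB, Ef_addB, Finset.sum_congr rfl fun i _ => cost_congr hρ hρq (hb i) (hκ i) (h i)]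
  ring

lemma addB_dvd (ρ : ℤ) {κ b : I → ℤ} (h : ∀ i, (q : ℤ) ∣ b i - κ i) :
    ∀ i, (q : ℤ) ∣ addB q ρ b i - addB q ρ κ i := by
  rintro (_ | i)
  · simp [addB]
  · have : (q : ℤ) ∣ b i - ρ ↔ (q : ℤ) ∣ κ i - ρ := by
      rw [show b i - ρ = b i - κ i + (κ i - ρ) by ring]; exact dvd_add_right (h i)
    simp only [addB, Option.elim_some, shift, this]
    split_ifs
    · rw [show b i + q - (κ i + q) = b i - κ i by ring]; exact h i
    · exact h i

lemma Flush.addBead {K : Finset ℤ} (h : Flush q K) {ρ : ℤ} (hρ : 0 ≤ ρ) (hρq : ρ < q)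
    (h0 : ∀ p ∈ K, 0 ≤ p) : Flush q (addBead q ρ K) := by
  intro p hp hqp
  rcases Finset.mem_insert.1 hp with rfl | hp
  · lia
  obtain ⟨p₀, hp₀, rfl⟩ := Finset.mem_image.1 hp
  by_cases hd : (q : ℤ) ∣ p₀ - ρ
  · have hs : shift q ρ p₀ - q = p₀ := by rw [shift, if_pos hd]; ring
    rw [hs]
    by_cases hqp₀ : (q : ℤ) ≤ p₀
    · refine Finset.mem_insert_of_mem (Finset.mem_image.2 ⟨p₀ - q, h p₀ hp₀ hqp₀, ?_⟩)
      rw [shift, if_pos (by rw [show p₀ - q - ρ = p₀ - ρ - q by ring]; exact dvd_sub_self_right.2 hd)]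
      ring
    · have : p₀ = ρ := by
        have h1 := h0 p₀ hp₀
        have := Int.eq_zero_of_abs_lt_dvd hd (by rw [abs_lt]; constructor <;> lia)
        linarith
      rw [this]; exact Finset.mem_insert_self _ _
  · have hs : shift q ρ p₀ = p₀ := by rw [shift, if_neg hd]
    rw [hs] at hqp ⊢
    refine Finset.mem_insert_of_mem (Finset.mem_image.2 ⟨p₀ - q, h p₀ hp₀ hqp, ?_⟩)
    rw [shift, if_neg]
    intro hh
    apply hd
    rw [show p₀ - q - ρ = p₀ - ρ - q by ring] at hh
    exact dvd_sub_self_right.1 hh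

lemma exists_addBead_chain {T : ℕ} {K : Finset ℤ} (hq : 0 < q) (h : Flush q K) (h0 : ∀ p ∈ K, 0 ≤ p)
    (hT : ∀ p ∈ K, p < q * T) : ∃ L : List ℤ, (∀ ρ ∈ L, 0 ≤ ρ ∧ ρ < q) ∧
      L.foldl (fun B ρ => addBead q ρ B) K = Finset.Ico (0 : ℤ) (q * T) := by
  have hsub : K ⊆ Finset.Ico (0 : ℤ) (q * T) := fun p hp => Finset.mem_Ico.2 ⟨h0 p hp, hT p hp⟩
  induction hn : (Finset.Ico (0 : ℤ) (q * T)).card - K.card generalizing K with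
  | zero =>
    have := Finset.eq_of_subset_of_card_le hsub (by omega)
    exact ⟨[], by simp, this⟩
  | succ n ih =>
    obtain ⟨p, hp, hpK⟩ := Finset.exists_mem_notMem_of_card_lt_card
      (s := K) (t := Finset.Ico (0 : ℤ) (q * T)) (by omega)
    rw [Finset.mem_Ico] at hp
    have hq' : (0 : ℤ) < q := by exact_mod_cast hq
    have hρ : 0 ≤ p % q := Int.emod_nonneg _ hq'.ne'
    have hρq : p % q < q := Int.emod_lt_of_pos _ hq'
    have hpd : (q : ℤ) ∣ p - p % q := Int.dvd_self_sub_emod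
    have hlt : ∀ p' ∈ K, shift q (p % q) p' < q * T := by
      intro p' hp'
      unfold shift
      split_ifs with hd
      · have hd' : (q : ℤ) ∣ p' - p := by
          have := dvd_sub hd hpd; rwa [show p' - p % q - (p - p % q) = p' - p by ring] at this
        have h1 : p' < p := by
          by_contra! hge
          exact hpK (h.down hq hp' hp.1 hge hd')
        have h2 : (q : ℤ) ≤ p - p' := Int.le_of_dvd (by linarith) (by
          rw [← neg_sub]; exact hd'.neg_right)
        linarith [hp.2]
      · exact hT p' hp'
    have h0' : ∀ p' ∈ addBead q (p % q) K, 0 ≤ p' ∧ p' < q * T := by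
      intro p' hp'
      rcases Finset.mem_insert.1 hp' with rfl | hp'
      · refine ⟨hρ, lt_of_le_of_lt ?_ hp.2⟩
        by_contra! hgt
        have h4 := Int.emod_add_mul_ediv p q
        have h5 : 0 ≤ p / q := Int.ediv_nonneg hp.1 hq'.le
        nlinarith
      · obtain ⟨p'', hp'', rfl⟩ := Finset.mem_image.1 hp'
        exact ⟨(h0 _ hp'').trans (le_shift _ _), hlt _ hp''⟩
    have hcard : (addBead q (p % q) K).card = K.card + 1 := by
      rw [addBead, Finset.card_insert_of_notMem, Finset.card_image_of_injective _ (shift_injective _)]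
      intro hm
      obtain ⟨p', hp', he⟩ := Finset.mem_image.1 hm
      exact shift_ne hρq (h0 p' hp') he
    obtain ⟨L, hL, hL'⟩ := ih (h.addBead hρ hρq h0) (fun p hp => (h0' p hp).1)
      (fun p hp => (h0' p hp).2) (fun p hp => Finset.mem_Ico.2 (h0' p hp)) (by omega)
    exact ⟨p % q :: L, by simpa using ⟨⟨hρ, hρq⟩, hL⟩, hL'⟩

lemma foldl_addBead_nonneg {L : List ℤ} (hL : ∀ ρ ∈ L, 0 ≤ ρ ∧ ρ < q) {B : Finset ℤ}
    (h0 : ∀ p ∈ B, 0 ≤ p) : ∀ p ∈ L.foldl (fun B ρ => addBead q ρ B) B, 0 ≤ p := by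
  induction L generalizing B with
  | nil => exact h0
  | cons ρ L ih =>
    refine ih (fun ρ hρ => hL ρ (by simp [hρ])) fun p hp => ?_
    rcases Finset.mem_insert.1 hp with rfl | hp
    · exact (hL _ (by simp)).1
    · obtain ⟨p', hp', rfl⟩ := Finset.mem_image.1 hp
      exact (h0 _ hp').trans (le_shift _ _)

lemma foldl_addBead_injective {L : List ℤ} (hL : ∀ ρ ∈ L, 0 ≤ ρ ∧ ρ < q) {B B' : Finset ℤ}
    (h0 : ∀ p ∈ B, 0 ≤ p) (h0' : ∀ p ∈ B', 0 ≤ p)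
    (h : L.foldl (fun B ρ => addBead q ρ B) B = L.foldl (fun B ρ => addBead q ρ B) B') : B = B' := by
  induction L generalizing B B' with
  | nil => exact h
  | cons ρ L ih =>
    have hρ := hL ρ (by simp)
    have hL' : ∀ ρ ∈ L, 0 ≤ ρ ∧ ρ < q := fun ρ hρ => hL ρ (by simp [hρ])
    refine addBead_injective hρ.2 h0 h0' (ih hL' ?_ ?_ h)
    · exact foldl_addBead_nonneg (L := [ρ]) (by simpa using hρ) h0
    · exact foldl_addBead_nonneg (L := [ρ]) (by simpa using hρ) h0'

lemma exists_foldl_addB {k : ℕ} {L : List ℤ} (hL : ∀ ρ ∈ L, 0 ≤ ρ ∧ ρ < (2 ^ k : ℕ)) {κ b : I → ℤ}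
    (hκ : Function.Injective κ) (hb : Function.Injective b) (h0κ : ∀ i, 0 ≤ κ i) (h0b : ∀ i, 0 ≤ b i)
    (h : ∀ i, ((2 ^ k : ℕ) : ℤ) ∣ b i - κ i) :
    ∃ (J : Type) (_ : Fintype J) (_ : DecidableEq J) (κ' b' : J → ℤ), Function.Injective κ' ∧
      Function.Injective b' ∧
      Finset.univ.image κ' = L.foldl (fun B ρ => addBead (2 ^ k) ρ B) (Finset.univ.image κ) ∧
      Finset.univ.image b' = L.foldl (fun B ρ => addBead (2 ^ k) ρ B) (Finset.univ.image b) ∧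
      (∀ l : List ℕ, (∀ r ∈ l, 0 < r ∧ 2 ^ k ∣ r) → mn (eps κ') l b' = mn (eps κ) l b) ∧
      Ef b' - Ef κ' = Ef b - Ef κ := by
  induction L generalizing I with
  | nil => exact ⟨I, inferInstance, inferInstance, κ, b, hκ, hb, rfl, rfl, fun _ _ => rfl, rfl⟩
  | cons ρ L ih =>
    have hρ := hL ρ (by simp)
    obtain ⟨J, _, _, κ', b', h1, h2, h3, h4, h5, h6⟩ := ih (fun ρ hρ => hL ρ (by simp [hρ]))
      (addB_injective hρ.2 hκ h0κ) (addB_injective hρ.2 hb h0b) (addB_nonneg hρ.1 h0κ)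
      (addB_nonneg hρ.1 h0b) (addB_dvd ρ h)
    refine ⟨J, inferInstance, inferInstance, κ', b', h1, h2, ?_, ?_, fun l hl => ?_, ?_⟩
    · rw [h3, image_addB]; rfl
    · rw [h4, image_addB]; rfl
    · rw [h5 l hl, mn_addB hρ.1 hρ.2 hκ h0κ hl]
    · rw [h6, Ef_addB_sub hρ.1 hρ.2 h0κ h0b h]

end AddBead

section Split

lemma bijective_of_sum_eq {X Y : Type} [Fintype X] [Fintype Y] {Φ : X → Y} (hΦ : Function.Injective Φ)
    (g : Y → ℤ) (hg : ∀ y, 0 < g y) (h : ∑ y, g y ≤ ∑ x, g (Φ x)) : Function.Bijective Φ := by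
  classical
  refine ⟨hΦ, fun y => ?_⟩
  by_contra hy
  have h1 : ∑ x, g (Φ x) = ∑ y ∈ Finset.univ.image Φ, g y :=
    (Finset.sum_image fun x _ x' _ h => hΦ h).symm
  have h2 : ∑ y ∈ Finset.univ.image Φ, g y < ∑ y, g y :=
    Finset.sum_lt_sum_of_subset (Finset.subset_univ _) (Finset.mem_univ y) (by
      simpa using hy) (hg y) (fun y _ _ => (hg y).le)
  linarith

lemma sum_subtype_sq {X : Type} [Fintype X] (f : X → ℤ) (p : X → Prop) [DecidablePred p]
    (hp : ∀ x, ¬ p x → f x = 0) :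
    ∑ x : {x // p x}, f x * f x = ∑ x, f x * f x := by
  rw [← Finset.sum_filter_of_ne (s := Finset.univ) (p := p)]
  · exact (Finset.sum_subtype (Finset.univ.filter p) (by simp) fun x => f x * f x).symm
  · intro x _ h
    by_contra hx
    exact h (by rw [hp x hx]; simp)

lemma zf_append {l l' : List ℕ} (h : ∀ r ∈ l, r ∉ l') :
    zf (l ++ l') (l ++ l') = zf l l * zf l' l' := by
  have hS : ∀ r ∈ l ++ l', r ∈ (l ++ l').toFinset := by simp
  rw [zf_of_perm (List.Perm.refl _) _ hS, zf_of_perm (List.Perm.refl _) (l ++ l').toFinset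
      (fun r hr => hS r (by simp [hr])),
    zf_of_perm (List.Perm.refl _) (l ++ l').toFinset (fun r hr => hS r (by simp [hr]))]
  have : ∀ r ∈ (l ++ l').toFinset, ((l ++ l').count r).factorial =
      (l.count r).factorial * (l'.count r).factorial := by
    intro r _
    rw [List.count_append]
    by_cases hr : r ∈ l
    · rw [List.count_eq_zero_of_not_mem (h r hr)]; simp
    · rw [List.count_eq_zero_of_not_mem hr]; simp
  rw [Finset.prod_congr rfl this, Finset.prod_mul_distrib, List.prod_append]
  push_cast
  ring

/-- The `2`-adic valuation of the character degree attached to a set of beta numbers. -/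
def chiVal (N n : ℕ) (B : Finset ℤ) : ℕ := padicValInt 2 (chi N B (List.replicate n 1))

lemma two_mul_chiVal {N n : ℕ} {B : Finset ℤ} (h : IsLab N n B) :
    2 * (chiVal N n B : ℤ) = 2 * padicValNat 2 n.factorial + En B := (chi_ones h).2

lemma En_base (N : ℕ) : En (Finset.Ico (0 : ℤ) N) = 0 := by
  have hL : IsLab N 0 (Finset.Ico (0 : ℤ) N) := by
    have h2 := (isBase_fin N).image
    rw [Fintype.card_fin] at h2
    refine ⟨by simp, fun p hp => (Finset.mem_Ico.1 hp).1, ?_⟩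
    have := (isBase_fin N).sum
    rw [Fintype.card_fin] at this
    rw [← h2, Finset.sum_image fun i _ j _ h => (isBase_fin N).1 h, this]
    simp
  have h1 := two_mul_chiVal hL
  obtain ⟨s, hs, h3⟩ := mn_eq_chi (isBase_fin N) (isBase_fin N).1 (isBase_fin N).image
  have h4 := h3 []
  rw [mn, eps_self (isBase_fin N).1] at h4
  simp only [Fintype.card_fin] at h4
  have h5 : (chi N (Finset.Ico (0 : ℤ) N) []).natAbs = 1 := by
    have := congrArg Int.natAbs h4
    rcases hs with rfl | rfl <;> simpa using this.symm
  rw [chiVal, List.replicate_zero, padicValInt, h5] at h1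
  simpa using h1.symm

theorem split_lab {k r m N : ℕ} {ll lh : List ℕ} (hr : r < 2 ^ k) (hll : ll.sum = r)
    (hlh : lh.sum = m) (hll0 : ∀ s ∈ ll, 0 < s) (hlh0 : ∀ s ∈ lh, 0 < s ∧ 2 ^ k ∣ s)
    (hN : 2 * (r + m) ≤ N) :
    ∃ N', 2 * m ≤ N' ∧ ∃ Φ : {B : Lab N (r + m) // chi N B.1 (lh ++ ll) ≠ 0} ≃
        {K : Lab N r // chi N K.1 ll ≠ 0} × {B : Lab N' m // chi N' B.1 lh ≠ 0},
      ∀ B, (∃ s : ℤ, (s = 1 ∨ s = -1) ∧ chi N B.1.1 (lh ++ ll) =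
          s * (chi N (Φ B).1.1.1 ll * chi N' (Φ B).2.1.1 lh)) ∧
        chiVal N (r + m) B.1.1 = chiVal N r (Φ B).1.1.1 + chiVal N' m (Φ B).2.1.1 := by
  classical
  have hq : 0 < 2 ^ k := by positivity
  set T : ℕ := N + r + ∑ x ∈ Finset.range N, x + 2 * m + 1 with hT
  set κ₀ : Fin N → ℤ := fun i => (i : ℤ) with hκ₀
  have h0κ₀ : ∀ i, 0 ≤ κ₀ i := fun i => by positivity
  have hP' : ∀ b, mn (eps κ₀) ll b ≠ 0 → Function.Injective b ∧ (∀ i, 0 ≤ b i) ∧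
      Flush (2 ^ k) (Finset.univ.image b) := by
    intro b hb
    obtain ⟨h1, h2, h3⟩ := mn_eps_ne_zero h0κ₀ hb
    refine ⟨h1, h2, flush_of_sum h1 h2 ?_⟩
    rw [h3, (isBase_fin N).sum, hll]
    have : (r : ℤ) < (2 ^ k : ℕ) := by exact_mod_cast hr
    linarith
  -- the core of a label not vanishing
  have hcore : ∀ B : {B : Lab N (r + m) // chi N B.1 (lh ++ ll) ≠ 0}, ∃ κ : Fin N → ℤ,
      mn (eps κ₀) ll κ ≠ 0 ∧ ∀ i, ((2 ^ k : ℕ) : ℤ) ∣ enum N B.1.1 i - κ i := by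
    intro B
    by_contra! hc
    apply B.2
    rw [chi, mn_append, mn_congr_mod (q := 2 ^ k) (E' := fun _ => 0) (k := 0) (fun r hr => (hlh0 r hr).2),
      mul_zero]
    intro c hcc
    by_contra hne
    obtain ⟨i, hi⟩ := hc c (by simpa using hne)
    exact hi (hcc i)
  choose κ hκ hκB using hcore
  have hKlab : ∀ B, IsLab N r (Finset.univ.image (κ B)) := fun B => hll ▸ isLab_of_chi_ne_zero (hκ B)
  have hchain : ∀ K : {K : Finset ℤ // IsLab N r K ∧ Flush (2 ^ k) K}, ∃ L : List ℤ,
      (∀ ρ ∈ L, 0 ≤ ρ ∧ ρ < (2 ^ k : ℕ)) ∧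
      L.foldl (fun B ρ => addBead (2 ^ k) ρ B) K.1 = Finset.Ico (0 : ℤ) ((2 ^ k : ℕ) * T) := by
    rintro ⟨K, hK, hKf⟩
    refine exists_addBead_chain hq hKf hK.2.1 fun p hp => ?_
    have h1 : p ≤ ∑ p ∈ K, p := Finset.single_le_sum (f := fun p => p) (fun p hp => hK.2.1 p hp) hp
    have h2 : p < (T : ℤ) := by
      rw [hK.2.2] at h1
      rw [hT]; push_cast; linarith
    have h3 : (1 : ℤ) ≤ (2 ^ k : ℕ) := by exact_mod_cast hq
    nlinarith
  choose L hL hL' using hchain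
  let K : {B : Lab N (r + m) // chi N B.1 (lh ++ ll) ≠ 0} →
      {K : Finset ℤ // IsLab N r K ∧ Flush (2 ^ k) K} :=
    fun B => ⟨Finset.univ.image (κ B), hKlab B, (hP' _ (hκ B)).2.2⟩
  set N' : ℕ := 2 ^ k * T with hN'
  have hmain : ∀ B : {B : Lab N (r + m) // chi N B.1 (lh ++ ll) ≠ 0}, ∃ B' : Finset ℤ,
      B' = (L (K B)).foldl (fun B ρ => addBead (2 ^ k) ρ B) B.1.1 ∧ IsLab N' m B' ∧
      (∃ s : ℤ, (s = 1 ∨ s = -1) ∧ chi N B.1.1 (lh ++ ll) = s * (chi N (K B).1 ll * chi N' B' lh)) ∧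
      En B' = En B.1.1 - En (K B).1 := by
    intro B
    have hb := enum_injective B.1.2.1
    obtain ⟨hκi, hκ0, hκf⟩ := hP' _ (hκ B)
    obtain ⟨J, _, _, κ', b', h1, h2, h3, h4, h5, h6⟩ := exists_foldl_addB (hL (K B)) hκi hb hκ0
      (fun i => B.1.2.2.1 _ (enum_mem B.1.2.1 i)) (hκB B)
    have h3' : Finset.univ.image κ' = Finset.Ico (0 : ℤ) N' := by
      rw [h3]; exact (hL' (K B)).trans (by rw [hN']; push_cast; rfl)
    have hJ : Fintype.card J = N' := by
      have := congrArg Finset.card h3'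
      rw [Finset.card_image_of_injective _ h1] at this
      simpa using this
    have hbase : IsBase κ' := ⟨h1, fun i => by
      have : κ' i ∈ Finset.Ico (0 : ℤ) N' := h3' ▸ Finset.mem_image_of_mem _ (Finset.mem_univ i)
      rw [hJ]; exact Finset.mem_Ico.1 this⟩
    rw [image_enum B.1.2.1] at h4
    obtain ⟨s, hs, hs'⟩ := mn_eq_chi hbase h2 h4
    obtain ⟨t, ht, ht'⟩ := mn_eq_chi (isBase_fin N) hκi rfl
    rw [hJ] at hs'
    rw [Fintype.card_fin] at ht'
    have hval : chi N B.1.1 (lh ++ ll) = mn (eps κ') lh b' * mn (eps κ₀) ll (κ B) := by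
      rw [chi, mn_append, mn_eq_core_mul ((alt_eps κ₀).mn ll) hq hP' (hκ B) (hκB B)
        (fun r hr => (hlh0 r hr).2), h5 lh hlh0]
    refine ⟨_, rfl, ?_, ⟨s * t, ?_, ?_⟩, ?_⟩
    · have hne : chi N' (List.foldl (fun B ρ => addBead (2 ^ k) ρ B) B.1.1 (L (K B))) lh ≠ 0 := by
        intro h0
        apply B.2
        rw [hval, hs', h0]; simp
      have hcard : (List.foldl (fun B ρ => addBead (2 ^ k) ρ B) B.1.1 (L (K B))).card = N' := by
        rw [← h4, Finset.card_image_of_injective _ h2]; exact hJ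
      have := isLab_of_chi_ne_zero hne
      rwa [image_enum hcard, hlh] at this
    · rcases hs with rfl | rfl <;> rcases ht with rfl | rfl <;> simp
    · rw [hval, hs', ht']; ring
    · rw [← h4, En_image h2, show Ef b' = Ef κ' + (Ef (enum N B.1.1) - Ef (κ B)) by linarith,
        ← En_image h1, h3', En_base, ← En_image hb, image_enum B.1.2.1, ← En_image hκi]
      simp only [K]; ring
  choose B' hB' hB'lab hB'v hB'E using hmain
  have hne : ∀ B, chi N (K B).1 ll ≠ 0 ∧ chi N' (B' B) lh ≠ 0 := by
    intro B
    obtain ⟨s, -, h⟩ := hB'v B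
    have := B.2
    rw [h] at this
    exact ⟨left_ne_zero_of_mul (right_ne_zero_of_mul this),
      right_ne_zero_of_mul (right_ne_zero_of_mul this)⟩
  let Φ : {B : Lab N (r + m) // chi N B.1 (lh ++ ll) ≠ 0} →
      {K : Lab N r // chi N K.1 ll ≠ 0} × {B : Lab N' m // chi N' B.1 lh ≠ 0} :=
    fun B => (⟨⟨(K B).1, (K B).2.1⟩, (hne B).1⟩, ⟨⟨B' B, hB'lab B⟩, (hne B).2⟩)
  have hΦ : Function.Injective Φ := by
    intro B C h
    have hK : K B = K C := Subtype.ext (congrArg (fun y => y.1.1.1) h)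
    have hB : B' B = B' C := congrArg (fun y => y.2.1.1) h
    rw [hB', hB', hK] at hB
    exact Subtype.ext (Subtype.ext (foldl_addBead_injective (hL (K C)) B.1.2.2.1 C.1.2.2.1 hB))
  have hN'm : 2 * m ≤ N' := by
    have h1 : T ≤ 2 ^ k * T := Nat.le_mul_of_pos_left T hq
    omega
  have hbij : Function.Bijective Φ := by
    refine bijective_of_sum_eq hΦ (fun y => (chi N y.1.1.1 ll * chi N y.1.1.1 ll) *
      (chi N' y.2.1.1 lh * chi N' y.2.1.1 lh)) (fun y => ?_) (le_of_eq ?_)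
    · have h1 := mul_self_pos.2 y.1.2
      have h2 := mul_self_pos.2 y.2.2
      positivity
    · rw [Fintype.sum_prod_type]
      simp only [← Finset.mul_sum, ← Finset.sum_mul]
      rw [sum_subtype_sq (fun K : Lab N r => chi N K.1 ll) _ (by simp),
        sum_subtype_sq (fun B : Lab N' m => chi N' B.1 lh) _ (by simp),
        sum_chi_mul (by omega) hll hll hll0 hll0, sum_chi_mul hN'm hlh hlh (fun s hs => (hlh0 s hs).1)
          (fun s hs => (hlh0 s hs).1), mul_comm, ← zf_append]
      · rw [← sum_chi_mul hN (l := lh ++ ll) (l' := lh ++ ll) (by simp [hll, hlh, add_comm])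
          (by simp [hll, hlh, add_comm]) (by
            intro s hs; rcases List.mem_append.1 hs with h | h; exacts [(hlh0 s h).1, hll0 s h]) (by
            intro s hs; rcases List.mem_append.1 hs with h | h; exacts [(hlh0 s h).1, hll0 s h]),
          ← sum_subtype_sq (fun B : Lab N (r + m) => chi N B.1 (lh ++ ll))
            (fun B => chi N B.1 (lh ++ ll) ≠ 0) (by simp)]
        refine Finset.sum_congr rfl fun B _ => ?_
        obtain ⟨s, hs, h⟩ := hB'v B
        simp only [Φ]
        rw [h]
        rcases hs with rfl | rfl <;> ring
      · intro s hs hs'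
        have h1 := Nat.le_of_dvd (hlh0 s hs).1 (hlh0 s hs).2
        have h2 := List.le_sum_of_mem hs'
        omega
  refine ⟨N', hN'm, Equiv.ofBijective Φ hbij, fun B => ⟨hB'v B, ?_⟩⟩
  have e1 := two_mul_chiVal B.1.2
  have e2 := two_mul_chiVal (hKlab B)
  have e3 := two_mul_chiVal (hB'lab B)
  have e4 := hB'E B
  have hdm : 2 ^ k ∣ m := hlh ▸ List.dvd_sum fun s hs => (hlh0 s hs).2
  obtain ⟨a, rfl⟩ := hdm
  have e5 : padicValNat 2 (r + 2 ^ k * a).factorial =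
      padicValNat 2 (2 ^ k * a).factorial + padicValNat 2 r.factorial := by
    rw [add_comm, padicValNat_factorial_two_pow_mul_add _ _ hr]
    have := padicValNat_factorial_two_pow_mul_add k a (t := 0) hq
    rw [add_zero] at this
    rw [this]; simp
  have : (chiVal N (r + 2 ^ k * a) B.1.1 : ℤ) = chiVal N r (K B).1 + chiVal N' (2 ^ k * a) (B' B) := by
    simp only [K] at *
    rw [e5, Nat.cast_add] at e1
    linarith
  exact_mod_cast this

end Split

section LabRealizes

variable {G : Type} [Group G] {y c : G} {ι κ : Type} {v w : ι → ℤ} {d : ι → ℕ} {v' w' : κ → ℤ}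
  {d' : κ → ℕ}

lemma Realizes.reindex (h : Realizes y c v w d) (f : κ ≃ ι)
    (hf : ∀ k, ∃ s : ℤ, (s = 1 ∨ s = -1) ∧ v (f k) = s * v' k ∧ w (f k) = s * w' k)
    (hd : ∀ k, d (f k) = d' k) : Realizes y c v' w' d' := by
  obtain ⟨e, hi, hirr, hval, hdeg, hrest⟩ := h
  refine ⟨fun k => e (f k), hi.comp f.injective, fun k => hirr _, fun k => ?_, fun k => ?_,
    fun χ hχ hn => hrest χ hχ fun ⟨i, hi⟩ => hn ⟨f.symm i, by simpa using hi⟩⟩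
  · obtain ⟨s, hs, h1, h2⟩ := hval (f k)
    obtain ⟨t, ht, h3, h4⟩ := hf k
    refine ⟨s * t, ?_, ?_, ?_⟩
    · rcases hs with rfl | rfl <;> rcases ht with rfl | rfl <;> simp
    · rw [mul_assoc, ← h3]; exact h1
    · rw [mul_assoc, ← h4]; exact h2
  · rw [← hd]; exact hdeg (f k)

/-- Labels with a nonzero value at one of the two cycle types. -/
abbrev LabX (N n : ℕ) (l l' : List ℕ) : Type := {B : Lab N n // chi N B.1 l ≠ 0 ∨ chi N B.1 l' ≠ 0}

/-- The values at `y`, `c` of the irreducible characters are those of the symmetric group of degree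
`n` at elements of cycle types `l`, `l'`. -/
def LabReal (N n : ℕ) (y c : G) (l l' : List ℕ) : Prop :=
  Realizes y c (fun B : LabX N n l l' => chi N B.1.1 l) (fun B => chi N B.1.1 l')
    (fun B => chiVal N n B.1.1)

variable {Ω : Type} [Fintype Ω] [DecidableEq Ω]

lemma exists_lab_equiv_val {N n : ℕ} (hn : Fintype.card Ω = n) (hN : 2 * n ≤ N) :
    ∃ e : Lab N n ≃ Irr (Equiv.Perm Ω), ∀ B, (∃ s : ℤ, (s = 1 ∨ s = -1) ∧
      ∀ g, (e B : Equiv.Perm Ω → ℂ) g = (s * chi N B.1 (cl g) : ℤ)) ∧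
      ∃ m : ℕ, (e B : Equiv.Perm Ω → ℂ) 1 = m ∧ padicValNat 2 m = chiVal N n B.1 := by
  obtain ⟨e, he⟩ := exists_lab_equiv (Ω := Ω) hn hN
  refine ⟨e, fun B => ⟨he B, ?_⟩⟩
  obtain ⟨m, hm, h1⟩ := Irr_one (e B).2
  obtain ⟨s, hs, h2⟩ := he B
  refine ⟨m, h1, ?_⟩
  have h3 := h2 1
  rw [h1, cl_one, hn] at h3
  have h4 : (m : ℤ) = s * chi N B.1 (List.replicate n 1) := by exact_mod_cast h3
  have h5 : m = (chi N B.1 (List.replicate n 1)).natAbs := by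
    have := congrArg Int.natAbs h4
    rcases hs with rfl | rfl <;> simpa using this
  rw [h5]; rfl

lemma labReal_perm {N n : ℕ} (hn : Fintype.card Ω = n) (hN : 2 * n ≤ N) (g h : Equiv.Perm Ω) :
    LabReal N n g h (cl g) (cl h) := by
  obtain ⟨e, he⟩ := exists_lab_equiv_val (Ω := Ω) hn hN
  refine Realizes.restrict (v := fun B : Lab N n => chi N B.1 (cl g)) (w := fun B => chi N B.1 (cl h))
    (d := fun B => chiVal N n B.1) ⟨fun B => e B, ?_, fun B => (e B).2, fun B => ?_, fun B => (he B).2,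
    fun χ hχ hn => absurd ⟨e.symm ⟨χ, hχ⟩, by simp⟩ hn⟩ _ (fun B hB => by push Not at hB; exact hB)
  · exact Subtype.val_injective.comp e.injective
  · obtain ⟨s, hs, h1⟩ := (he B).1
    exact ⟨s, hs, h1 g, h1 h⟩

lemma LabReal.perm_left {N n : ℕ} {l l' m m' : List ℕ} (hr : LabReal N n y c l l') (h : l.Perm m)
    (h' : l'.Perm m') : LabReal N n y c m m' := by
  refine Realizes.reindex hr (Equiv.subtypeEquivRight fun B => ?_) (fun B => ⟨1, Or.inl rfl, ?_, ?_⟩)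
    (fun B => rfl)
  · rw [chi_perm h, chi_perm h']
  · simp [chi_perm h]
  · simp [chi_perm h']

end LabRealizes

section Hooks

/-- Moving the bead at position `t` up by `q`. -/
def up (q : ℕ) (t : ℤ) (B : Finset ℤ) : Finset ℤ := insert (t + q) (B.erase t)

lemma isLab_base (N : ℕ) : IsLab N 0 (Finset.Ico (0 : ℤ) N) := by
  have h2 := (isBase_fin N).image
  rw [Fintype.card_fin] at h2
  refine ⟨by simp, fun p hp => (Finset.mem_Ico.1 hp).1, ?_⟩
  have := (isBase_fin N).sum
  rw [Fintype.card_fin] at this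
  rw [← h2, Finset.sum_image fun i _ j _ h => (isBase_fin N).1 h, this]
  simp

lemma IsLab.up {N n q : ℕ} {B : Finset ℤ} (h : IsLab N n B) {t : ℤ} (ht : t ∈ B)
    (ht' : t + q ∉ B) : IsLab N (n + q) (up q t B) := by
  obtain ⟨h1, h2, h3⟩ := h
  have h4 : t + q ∉ B.erase t := fun h => ht' (Finset.mem_of_mem_erase h)
  have h5 : 0 < B.card := Finset.card_pos.2 ⟨t, ht⟩
  refine ⟨?_, ?_, ?_⟩
  · rw [_root_.up, Finset.card_insert_of_notMem h4, Finset.card_erase_of_mem ht]; omega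
  · intro p hp
    rcases Finset.mem_insert.1 hp with rfl | hp
    · have := h2 t ht; omega
    · exact h2 p (Finset.mem_of_mem_erase hp)
  · rw [_root_.up, Finset.sum_insert h4]
    have := Finset.add_sum_erase B (fun p => p) ht
    push_cast
    linarith

variable {I : Type} [Fintype I] [DecidableEq I]

lemma image_add_single {b : I → ℤ} (hb : Function.Injective b) {q : ℕ} (i : I)
    (h : b i + q ∉ Finset.univ.image b) :
    Function.Injective (b + (Pi.single i (q : ℤ) : I → ℤ)) ∧
      Finset.univ.image (b + (Pi.single i (q : ℤ) : I → ℤ)) = up q (b i) (Finset.univ.image b) := by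
  have h' : ∀ j, b j ≠ b i + q := fun j hj => h (hj ▸ Finset.mem_image_of_mem _ (Finset.mem_univ j))
  constructor
  · intro j k hjk
    simp only [Pi.add_apply, Pi.single_apply] at hjk
    split_ifs at hjk with h1 h2 h2
    · rw [h1, h2]
    · exact absurd (by rw [← h1]; linarith) (h' k)
    · exact absurd (by rw [← h2]; linarith) (h' j)
    · exact hb (by linarith)
  · ext p
    simp only [up, Finset.mem_image, Finset.mem_univ, true_and, Finset.mem_insert, Finset.mem_erase,
      Pi.add_apply, Pi.single_apply]
    constructor
    · rintro ⟨j, rfl⟩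
      by_cases hj : j = i
      · left; simp [hj]
      · right; simp only [if_neg hj, add_zero]; exact ⟨fun h => hj (hb h), j, rfl⟩
    · rintro (rfl | ⟨h1, j, rfl⟩)
      · exact ⟨i, by simp⟩
      · exact ⟨j, by rw [if_neg (fun hj => h1 (by rw [hj])), add_zero]⟩

lemma mn_cons_of {κ b : I → ℤ} (hκ : ∀ i, 0 ≤ κ i) {r : ℕ} (l : List ℕ) (S : Finset I)
    (hS : ∀ i ∉ S, b i < r ∨ ∃ j, j ≠ i ∧ b j = b i - r) :
    mn (eps κ) (r :: l) b = ∑ i ∈ S, mn (eps κ) l (b - (Pi.single i (r : ℤ) : I → ℤ)) := by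
  rw [mn]
  refine (Finset.sum_subset (Finset.subset_univ S) fun i _ hi => ?_).symm
  by_contra hne
  obtain ⟨h1, h2, -⟩ := mn_eps_ne_zero hκ hne
  rcases hS i hi with h | ⟨j, hj, h⟩
  · have := h2 i
    simp at this
    linarith
  · exact hj (h1 (by simp [hj, h]))

variable {N q : ℕ}

/-- The basic beta numbers. -/
abbrev dl (N : ℕ) : Fin N → ℤ := fun i => (i : ℤ)

lemma dl_nonneg (i : Fin N) : 0 ≤ dl N i := by positivity

lemma exists_dl {t : ℤ} (h0 : 0 ≤ t) (h : t < N) : ∃ j : Fin N, (j : ℤ) = t :=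
  ⟨⟨t.toNat, by omega⟩, by simp [h0]⟩

lemma dl_apply (i : Fin N) : dl N i = (i : ℤ) := rfl

lemma mn_hook (hq : 0 < q) (p : Fin N) (hp : N ≤ p + q) (l : List ℕ) :
    mn (eps (dl N)) (q :: l) (dl N + (Pi.single p (q : ℤ) : Fin N → ℤ)) = mn (eps (dl N)) l (dl N) := by
  rw [mn_cons_of dl_nonneg l {p}]
  · rw [Finset.sum_singleton, add_sub_cancel_right]
  · intro i hi
    rw [Finset.mem_singleton, Fin.ext_iff] at hi
    simp only [Pi.add_apply, Pi.single_apply, dl_apply, Fin.ext_iff, if_neg hi, add_zero]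
    by_cases h : (i : ℤ) < q
    · exact Or.inl h
    · obtain ⟨j, hj⟩ := exists_dl (N := N) (t := i - q) (by omega) (by omega)
      refine Or.inr ⟨j, by omega, ?_⟩
      rw [if_neg (by omega)]; omega

lemma mn_two_hook (hq : 0 < q) (p : Fin N) (hp : N ≤ p + q) (l : List ℕ) :
    mn (eps (dl N)) (q :: l) (dl N + (Pi.single p ((2 * q : ℕ) : ℤ) : Fin N → ℤ)) =
      mn (eps (dl N)) l (dl N + (Pi.single p (q : ℤ) : Fin N → ℤ)) := by
  rw [mn_cons_of dl_nonneg l {p}]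
  · rw [Finset.sum_singleton]
    congr 1
    ext j
    simp only [Pi.sub_apply, Pi.add_apply, Pi.single_apply]
    split_ifs <;> push_cast <;> ring
  · intro i hi
    rw [Finset.mem_singleton, Fin.ext_iff] at hi
    simp only [Pi.add_apply, Pi.single_apply, dl_apply, Fin.ext_iff, if_neg hi, add_zero]
    by_cases h : (i : ℤ) < q
    · exact Or.inl h
    · obtain ⟨j, hj⟩ := exists_dl (N := N) (t := i - q) (by omega) (by omega)
      refine Or.inr ⟨j, by omega, ?_⟩
      rw [if_neg (by omega)]; omega

lemma mn_pair_adj (hq : 0 < q) (p p' : Fin N) (hp : N ≤ p + q) (hpp : (p : ℕ) = p' + q) (l : List ℕ) :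
    mn (eps (dl N)) (q :: l) (dl N + (Pi.single p (q : ℤ) : Fin N → ℤ) + (Pi.single p' (q : ℤ) : Fin N → ℤ)) =
      mn (eps (dl N)) l (dl N + (Pi.single p (q : ℤ) : Fin N → ℤ)) := by
  rw [mn_cons_of dl_nonneg l {p'}]
  · rw [Finset.sum_singleton, add_sub_cancel_right]
  · intro i hi
    rw [Finset.mem_singleton, Fin.ext_iff] at hi
    simp only [Pi.add_apply, Pi.single_apply, dl_apply, Fin.ext_iff, if_neg hi, add_zero]
    by_cases hip : (i : ℕ) = p
    · refine Or.inr ⟨p', by omega, ?_⟩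
      rw [if_pos hip, if_neg (by omega), if_pos rfl]; omega
    · rw [if_neg hip]
      by_cases h : (i : ℤ) < q
      · left; omega
      · obtain ⟨j, hj⟩ := exists_dl (N := N) (t := i - q) (by omega) (by omega)
        refine Or.inr ⟨j, by omega, ?_⟩
        rw [if_neg (by omega), if_neg (by omega)]; omega

lemma eps_swap (p p' : Fin N) (hne : p ≠ p') {b : Fin N → ℤ} (hb : b = dl N ∘ Equiv.swap p p') :
    eps (dl N) b = -1 := by
  rw [hb, alt_eps, Equiv.Perm.sign_swap hne, eps_self (isBase_fin N).1]
  simp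

lemma mn_pair_adj' (hq : 0 < q) (p p' : Fin N) (hp : N ≤ p + q) (hpp : (p : ℕ) = p' + q) :
    mn (eps (dl N)) [2 * q] (dl N + (Pi.single p (q : ℤ) : Fin N → ℤ) + (Pi.single p' (q : ℤ) : Fin N → ℤ)) =
      -1 := by
  have hne : p ≠ p' := fun h => by subst h; omega
  rw [mn_cons_of dl_nonneg [] {p}]
  · rw [Finset.sum_singleton, mn]
    refine eps_swap p p' hne ?_
    ext j
    simp only [Pi.sub_apply, Pi.add_apply, Pi.single_apply, Function.comp_apply,
      Equiv.swap_apply_def, dl_apply]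
    split_ifs with h1 h2 h3
    · subst h1; exact absurd h2 hne
    · subst h1; push_cast; omega
    · subst h3; omega
    · ring
  · intro i hi
    rw [Finset.mem_singleton, Fin.ext_iff] at hi
    simp only [Pi.add_apply, Pi.single_apply, dl_apply, Fin.ext_iff, if_neg hi, add_zero]
    by_cases hip : (i : ℕ) = p'
    · rw [if_pos hip]
      by_cases h : (i : ℤ) < q
      · left; push_cast; omega
      · obtain ⟨j, hj⟩ := exists_dl (N := N) (t := i - q) (by omega) (by omega)
        refine Or.inr ⟨j, by omega, ?_⟩
        rw [if_neg (by omega), if_neg (by omega)]; push_cast; omega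
    · rw [if_neg hip]
      by_cases h : (i : ℤ) < (2 * q : ℕ)
      · left; omega
      · obtain ⟨j, hj⟩ := exists_dl (N := N) (t := i - (2 * q : ℕ)) (by omega) (by omega)
        refine Or.inr ⟨j, by omega, ?_⟩
        rw [if_neg (by omega), if_neg (by omega)]; omega

lemma mn_pair (hq : 0 < q) (p p' : Fin N) (hne : p ≠ p') (hp : N ≤ p + q) (hp' : N ≤ p' + q) (l : List ℕ) :
    mn (eps (dl N)) (q :: l) (dl N + (Pi.single p (q : ℤ) : Fin N → ℤ) + (Pi.single p' (q : ℤ) : Fin N → ℤ)) =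
      mn (eps (dl N)) l (dl N + (Pi.single p (q : ℤ) : Fin N → ℤ)) +
      mn (eps (dl N)) l (dl N + (Pi.single p' (q : ℤ) : Fin N → ℤ)) := by
  rw [mn_cons_of dl_nonneg l {p, p'}]
  · rw [Finset.sum_pair hne, add_sub_cancel_right, add_sub_right_comm, add_sub_cancel_right, add_comm]
  · intro i hi
    simp only [Finset.mem_insert, Finset.mem_singleton, not_or, Fin.ext_iff] at hi
    simp only [Pi.add_apply, Pi.single_apply, dl_apply, Fin.ext_iff, if_neg hi.1, if_neg hi.2, add_zero]
    by_cases h : (i : ℤ) < q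
    · exact Or.inl h
    · obtain ⟨j, hj⟩ := exists_dl (N := N) (t := i - q) (by omega) (by omega)
      refine Or.inr ⟨j, by omega, ?_⟩
      rw [if_neg (by omega), if_neg (by omega)]; omega

lemma mn_pair' (hq : 0 < q) (p p' : Fin N) (hne : p ≠ p') (hp : N ≤ p + q) (hp' : N ≤ p' + q) (hN : 2 * q ≤ N) :
    mn (eps (dl N)) [2 * q] (dl N + (Pi.single p (q : ℤ) : Fin N → ℤ) + (Pi.single p' (q : ℤ) : Fin N → ℤ)) =
      0 := by
  rw [Ne, Fin.ext_iff] at hne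
  rw [mn_cons_of dl_nonneg [] ∅, Finset.sum_empty]
  intro i _
  simp only [Pi.add_apply, Pi.single_apply, dl_apply, Fin.ext_iff]
  by_cases h : (i : ℕ) = p ∨ (i : ℕ) = p'
  · obtain ⟨j, hj⟩ := exists_dl (N := N) (t := i - q) (by omega) (by omega)
    refine Or.inr ⟨j, by omega, ?_⟩
    split_ifs <;> omega
  · push Not at h
    rw [if_neg h.1, if_neg h.2]
    by_cases h3 : (i : ℤ) < (2 * q : ℕ)
    · left; omega
    · obtain ⟨j, hj⟩ := exists_dl (N := N) (t := i - (2 * q : ℕ)) (by omega) (by omega)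
      refine Or.inr ⟨j, by omega, ?_⟩
      rw [if_neg (by omega), if_neg (by omega)]; omega

lemma exists_enum {K : Finset ℤ} (hK : K.card = N) {t : ℤ} (ht : t ∈ K) : ∃ j, enum N K j = t := by
  have ht' : t ∈ Finset.univ.image (enum N K) := by rwa [image_enum hK]
  obtain ⟨j, -, hj⟩ := Finset.mem_image.1 ht'
  exact ⟨j, hj⟩

lemma mn_core (hq : 0 < q) {K : Finset ℤ} (hK : K.card = N) (hf : Flush q K) (i : Fin N)
    (htop : enum N K i + q ∉ K) (l : List ℕ) :
    mn (eps (dl N)) (q :: l) (enum N K + (Pi.single i (q : ℤ) : Fin N → ℤ)) = chi N K l := by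
  rw [mn_cons_of dl_nonneg l {i}]
  · rw [Finset.sum_singleton, add_sub_cancel_right]; rfl
  · intro j hj
    rw [Finset.mem_singleton] at hj
    simp only [Pi.add_apply, Pi.single_apply, if_neg hj, add_zero]
    by_cases h : enum N K j < q
    · exact Or.inl h
    · obtain ⟨k, hk⟩ := exists_enum hK (hf _ (enum_mem hK j) (by omega))
      have hki : k ≠ i := by
        rintro rfl
        exact htop (by rw [hk]; simpa using enum_mem hK j)
      refine Or.inr ⟨k, ?_, by rw [if_neg hki, add_zero, hk]⟩
      rintro rfl
      omega

lemma mn_core' (hq : 0 < q) {K : Finset ℤ} (hK : K.card = N) (hf : Flush q K) (i : Fin N)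
    (htop : enum N K i + q ∉ K) :
    mn (eps (dl N)) [2 * q] (enum N K + (Pi.single i (q : ℤ) : Fin N → ℤ)) = 0 := by
  rw [mn_cons_of dl_nonneg [] ∅, Finset.sum_empty]
  intro j _
  simp only [Pi.add_apply, Pi.single_apply]
  push_cast
  by_cases hj : j = i
  · subst hj
    rw [if_pos rfl]
    by_cases h : enum N K j < q
    · left; omega
    · obtain ⟨k, hk⟩ := exists_enum hK (hf _ (enum_mem hK j) (by omega))
      have hki : k ≠ j := by rintro rfl; omega
      exact Or.inr ⟨k, hki, by rw [if_neg hki]; omega⟩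
  · rw [if_neg hj]
    by_cases h : enum N K j < 2 * q
    · left; omega
    · have h1 := hf _ (enum_mem hK j) (by omega)
      obtain ⟨k, hk⟩ := exists_enum hK (hf _ h1 (by omega))
      have hki : k ≠ i := by
        rintro rfl
        exact htop (by rw [hk]; simpa using h1)
      exact Or.inr ⟨k, by rintro rfl; omega, by rw [if_neg hki]; omega⟩

end Hooks

section Degrees

lemma En_insert {a : ℤ} {C : Finset ℤ} (ha : a ∉ C) :
    En (insert a C) = En C + 2 * ∑ s ∈ C, (padicValInt 2 (a - s) : ℤ) -
      2 * padicValNat 2 a.toNat.factorial := by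
  have h : ∑ s ∈ C, (padicValInt 2 (s - a) : ℤ) = ∑ s ∈ C, (padicValInt 2 (a - s) : ℤ) :=
    Finset.sum_congr rfl fun s _ => by rw [padicValInt_comm s a]
  rw [En, En, Finset.sum_insert ha, Finset.sum_insert ha, Finset.sum_insert ha,
    Finset.sum_congr rfl fun s _ => Finset.sum_insert ha, Finset.sum_add_distrib, h]
  simp
  ring

lemma En_up {k : ℕ} {B : Finset ℤ} {t : ℤ} (ht : t ∈ B) (ht0 : 0 ≤ t) (ht' : t + (2 ^ k : ℕ) ∉ B)
    (h0 : ∀ s ∈ B, 0 ≤ s)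
    (h1 : ∀ s ∈ B, ((2 ^ k : ℕ) : ℤ) ∣ s - t → s ≤ t)
    (h2 : ∀ s, 0 ≤ s → s ≤ t → ((2 ^ k : ℕ) : ℤ) ∣ s - t → s ∈ B) :
    En (up (2 ^ k) t B) = En B - 2 * (2 ^ k - 1) := by
  set q : ℕ := 2 ^ k with hq
  have hq0 : 0 < q := by positivity
  have h3 : t + q ∉ B.erase t := fun h => ht' (Finset.mem_of_mem_erase h)
  obtain ⟨n, rfl⟩ := Int.eq_ofNat_of_zero_le ht0
  have hn : n = q * (n / q) + n % q := (Nat.div_add_mod _ _).symm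
  set m := n / q
  set ρ := n % q
  have hρ : ρ < q := Nat.mod_lt _ hq0
  have hB : En B = En (B.erase n) + 2 * ∑ s ∈ B.erase (n : ℤ), (padicValInt 2 (n - s) : ℤ) -
      2 * padicValNat 2 n.factorial := by
    conv_lhs => rw [← Finset.insert_erase ht]
    rw [En_insert (Finset.notMem_erase _ _)]; simp
  have e1 : ∑ s ∈ B.erase (n : ℤ), (padicValInt 2 (n + q - s) : ℤ) -
      ∑ s ∈ B.erase (n : ℤ), (padicValInt 2 (n - s) : ℤ) = padicValNat 2 (m + 1) := by
    rw [← Finset.sum_sub_distrib]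
    have hsub : (Finset.range m).image (fun j => (n : ℤ) - (j + 1 : ℕ) * q) ⊆ B.erase (n : ℤ) := by
      intro s hs
      obtain ⟨j, hj, rfl⟩ := Finset.mem_image.1 hs
      rw [Finset.mem_range] at hj
      have h4 : (j + 1) * q ≤ m * q := Nat.mul_le_mul_right _ hj
      have h4' : ((j + 1 : ℕ) : ℤ) * q ≤ n := by
        rw [hn]; push_cast; 
        have : (((j + 1) * q : ℕ) : ℤ) ≤ (m * q : ℕ) := by exact_mod_cast h4
        push_cast at this
        nlinarith
      have h5 : (0 : ℤ) < ((j + 1 : ℕ) : ℤ) * q := by positivity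
      refine Finset.mem_erase.2 ⟨by linarith, h2 _ (by linarith) (by linarith) ⟨-(j + 1 : ℕ), by ring⟩⟩
    rw [← Finset.sum_subset hsub, Finset.sum_image]
    · have : ∀ j ∈ Finset.range m, (padicValInt 2 ((n : ℤ) + q - (n - (j + 1 : ℕ) * q)) : ℤ) -
          padicValInt 2 ((n : ℤ) - (n - (j + 1 : ℕ) * q)) =
          (padicValNat 2 (j + 1 + 1) : ℤ) - padicValNat 2 (j + 1) := by
        intro j _
        have e : ∀ a : ℕ, 0 < a → padicValInt 2 ((a * q : ℕ) : ℤ) = padicValNat 2 a + k := by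
          intro a ha
          rw [padicValInt.of_nat, padicValNat.mul (by omega) (by omega), hq, padicValNat.prime_pow]
        rw [show (n : ℤ) + q - (n - (j + 1 : ℕ) * q) = (((j + 1 + 1) * q : ℕ) : ℤ) by push_cast; ring,
          show (n : ℤ) - (n - (j + 1 : ℕ) * q) = (((j + 1) * q : ℕ) : ℤ) by push_cast; ring,
          e _ (by omega), e _ (by omega), Nat.cast_add, Nat.cast_add]
        ring
      rw [Finset.sum_congr rfl this, Finset.sum_range_sub fun j => (padicValNat 2 (j + 1) : ℤ)]
      simp
    · intro i _ j _ hij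
      have : ((i + 1 : ℕ) : ℤ) * q = (j + 1 : ℕ) * q := by simpa using hij
      have := mul_right_cancel₀ (by omega) this
      omega
    · intro s hs hns
      rw [sub_eq_zero]
      congr 1
      have hd : ¬ (q : ℤ) ∣ (n : ℤ) - s := by
        rintro ⟨c, hc⟩
        apply hns
        have hsB := Finset.mem_of_mem_erase hs
        have hne := Finset.ne_of_mem_erase hs
        have h5 : s ≤ n := h1 s hsB ⟨-c, by linarith⟩
        have h6 := h0 s hsB
        have hc0 : 0 < c := by
          by_contra hc0
          push Not at hc0
          have : (q : ℤ) * c ≤ 0 := mul_nonpos_of_nonneg_of_nonpos (by positivity) hc0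
          exact hne (by linarith)
        obtain ⟨c, rfl⟩ := Int.eq_ofNat_of_zero_le hc0.le
        refine Finset.mem_image.2 ⟨c - 1, Finset.mem_range.2 ?_, ?_⟩
        · have h7 : q * c ≤ n := by
            have : ((q * c : ℕ) : ℤ) ≤ n := by push_cast; linarith
            exact_mod_cast this
          have h8 : c ≤ n / q := (Nat.le_div_iff_mul_le hq0).2 (by rwa [mul_comm])
          omega
        · rw [Nat.sub_add_cancel (by omega)]; linarith [mul_comm (c : ℤ) q]
      rw [show (n : ℤ) + q - s = n - s + q by ring]
      have := padicValInt_add_two_pow hd q (dvd_refl _)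
      exact this
  have e2 : (padicValNat 2 (n + q).factorial : ℤ) =
      padicValNat 2 n.factorial + padicValNat 2 (m + 1) + (2 ^ k - 1) := by
    have h4 : n + q = q * (m + 1) + ρ := by rw [Nat.mul_succ]; omega
    rw [h4, hn, hq, padicValNat_factorial_two_pow_mul_add _ _ hρ, padicValNat_factorial_two_pow_mul_add _ _ hρ,
      Nat.factorial_succ, padicValNat.mul (Nat.succ_ne_zero m) (Nat.factorial_ne_zero _)]
    have : 1 ≤ 2 ^ k := Nat.one_le_two_pow
    simp only [Nat.cast_add, Nat.cast_mul, Nat.cast_sub this]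
    push_cast
    ring
  rw [up, En_insert h3, hB, show ((n : ℤ) + q).toNat = n + q by rw [← Nat.cast_add, Int.toNat_natCast]]
  linarith

end Degrees

section Hooks

variable {N q : ℕ}

/-- The value at cycle type `l` of the hook character whose first-column bead is `p`. -/
def hookVal (q : ℕ) (p : Fin N) (l : List ℕ) : ℤ :=
  mn (eps (dl N)) l (dl N + (Pi.single p (q : ℤ) : Fin N → ℤ))

lemma image_dl : Finset.univ.image (dl N) = Finset.Ico (0 : ℤ) N := by
  have := (isBase_fin N).image
  rwa [Fintype.card_fin] at this

lemma dl_injective : Function.Injective (dl N) := (isBase_fin N).1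

lemma mn_eq_chi_fin {b : Fin N → ℤ} (hb : Function.Injective b) {B : Finset ℤ}
    (hB : Finset.univ.image b = B) :
    ∃ s : ℤ, (s = 1 ∨ s = -1) ∧ ∀ l, chi N B l = s * mn (eps (dl N)) l b := by
  obtain ⟨s, hs, h⟩ := mn_eq_chi (isBase_fin N) hb hB
  rw [Fintype.card_fin] at h
  refine ⟨s, hs, fun l => ?_⟩
  have := h l
  rcases hs with rfl | rfl <;> linarith

lemma hook_image (p : Fin N) (hp : N ≤ p + q) :
    Function.Injective (dl N + (Pi.single p (q : ℤ) : Fin N → ℤ)) ∧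
      Finset.univ.image (dl N + (Pi.single p (q : ℤ) : Fin N → ℤ)) = up q p (Finset.Ico (0 : ℤ) N) := by
  have := image_add_single (dl_injective (N := N)) (q := q) p (by
    rw [image_dl, Finset.mem_Ico, dl_apply]; omega)
  rwa [image_dl] at this

lemma chi_hook (p : Fin N) (hp : N ≤ p + q) :
    ∃ s : ℤ, (s = 1 ∨ s = -1) ∧ ∀ l, chi N (up q p (Finset.Ico (0 : ℤ) N)) l = s * hookVal q p l :=
  mn_eq_chi_fin (hook_image p hp).1 (hook_image p hp).2

lemma hookVal_self (hq : 0 < q) (p : Fin N) (hp : N ≤ p + q) : hookVal q p [q] = 1 := by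
  rw [hookVal, mn_hook hq p hp, mn, eps_self dl_injective]

lemma exists_hook (hq : 0 < q) {B : Finset ℤ} (hB : B.card = N) (h : chi N B [q] ≠ 0) :
    ∃ p : Fin N, N ≤ p + q ∧ B = up q p (Finset.Ico (0 : ℤ) N) := by
  rw [chi, mn] at h
  obtain ⟨i, -, hi⟩ := Finset.exists_ne_zero_of_sum_ne_zero h
  rw [mn] at hi
  obtain ⟨τ, hτ⟩ := eps_ne_zero hi
  have hb : Function.Injective (dl N ∘ τ) := dl_injective.comp τ.injective
  have h1 : enum N B = dl N ∘ τ + (Pi.single i (q : ℤ) : Fin N → ℤ) := by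
    rw [show dl N ∘ τ = enum N B - (Pi.single i (q : ℤ) : Fin N → ℤ) from hτ.symm, sub_add_cancel]
  have him : Finset.univ.image (dl N ∘ τ) = Finset.Ico (0 : ℤ) N := by
    rw [← image_dl]
    ext p; simp only [Finset.mem_image, Finset.mem_univ, true_and, Function.comp_apply]
    exact ⟨fun ⟨i, hi⟩ => ⟨_, hi⟩, fun ⟨i, hi⟩ => ⟨τ.symm i, by simpa using hi⟩⟩
  have h2 : (dl N ∘ τ) i + q ∉ Finset.univ.image (dl N ∘ τ) := by
    intro hmem
    obtain ⟨j, -, hj⟩ := Finset.mem_image.1 hmem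
    have hji : j ≠ i := by rintro rfl; omega
    refine hji (enum_injective hB ?_)
    rw [h1]
    simp [hji]
    exact hj
  have h3 := (image_add_single hb i h2).2
  rw [← h1, image_enum hB, him] at h3
  refine ⟨τ i, ?_, h3⟩
  rw [him, Finset.mem_Ico] at h2
  simp only [Function.comp_apply, dl_apply] at h2
  omega

lemma lab_zero {B : Finset ℤ} (h : IsLab N 0 B) : B = Finset.Ico (0 : ℤ) N := by
  refine (Finset.eq_of_subset_of_card_le (fun p hp => ?_) ?_).symm
  · rw [Finset.mem_Ico] at hp
    obtain ⟨i, hi⟩ := (isBase_fin N).exists_eq (enum_injective h.1) (fun i => h.2.1 _ (enum_mem h.1 i))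
      (m := 0) (p := p) (by
        rw [(isBase_fin N).sum, ← Finset.sum_image (f := fun p => p) (fun i _ j _ hij => enum_injective h.1 hij),
          image_enum h.1, h.2.2]; simp) hp.1 (by simpa using hp.2)
    rw [← hi]; exact enum_mem h.1 i
  · rw [h.1]; simp

lemma lab_small {n : ℕ} {B : Finset ℤ} (h : IsLab N n B) {p : ℤ} (hp : 0 ≤ p) (hp' : p < N - n) :
    p ∈ B := by
  obtain ⟨i, hi⟩ := (isBase_fin N).exists_eq (enum_injective h.1) (fun i => h.2.1 _ (enum_mem h.1 i))
    (m := n) (p := p) (by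
      rw [(isBase_fin N).sum, ← Finset.sum_image (f := fun p => p) (fun i _ j _ hij => enum_injective h.1 hij),
        image_enum h.1, h.2.2]; simp; ring) hp (by simpa using hp')
  rw [← hi]; exact enum_mem h.1 i

lemma flush_of_chi_eq_zero (hq : 0 < q) {K : Finset ℤ} (hK : IsLab N q K) (h : chi N K [q] = 0) :
    Flush q K := by
  intro t ht htq
  by_contra hc
  have h1 : IsLab N 0 (insert (t - q) (K.erase t)) := by
    obtain ⟨h1, h2, h3⟩ := hK
    have h4 : t - q ∉ K.erase t := fun h => hc (Finset.mem_of_mem_erase h)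
    have h5 : 0 < K.card := Finset.card_pos.2 ⟨t, ht⟩
    refine ⟨?_, ?_, ?_⟩
    · rw [Finset.card_insert_of_notMem h4, Finset.card_erase_of_mem ht]; omega
    · intro p hp
      rcases Finset.mem_insert.1 hp with rfl | hp
      · linarith
      · exact h2 p (Finset.mem_of_mem_erase hp)
    · rw [Finset.sum_insert h4]
      have := Finset.add_sum_erase K (fun p => p) ht
      push_cast
      linarith
  have h2 := lab_zero h1
  have h3 : t - q ∈ Finset.Ico (0 : ℤ) N := by rw [← h2]; exact Finset.mem_insert_self _ _
  have h3' := Finset.mem_Ico.1 h3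
  obtain ⟨p, hp⟩ := exists_dl h3'.1 h3'.2
  have hKt : K = up q p (Finset.Ico (0 : ℤ) N) := by
    rw [hp, up, ← h2, Finset.erase_insert (fun h => hc (Finset.mem_of_mem_erase h)), sub_add_cancel,
      Finset.insert_erase ht]
  have hpN : N ≤ p + q := by
    by_contra hlt
    have : t ∈ Finset.Ico (0 : ℤ) N := Finset.mem_Ico.2 ⟨by linarith, by omega⟩
    rw [← h2] at this
    rcases Finset.mem_insert.1 this with h | h
    · omega
    · exact Finset.notMem_erase _ _ h
  obtain ⟨s, hs, h4⟩ := chi_hook p hpN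
  rw [← hKt] at h4
  rw [h4, hookVal_self hq p hpN] at h
  rcases hs with rfl | rfl <;> simp at h

lemma exists_top (hq : 0 < q) (hN : 2 * q ≤ N) {K : Finset ℤ} (hK : IsLab N q K)
    (p : ℕ) : ∃ t ∈ K, t + q ∉ K ∧ (q : ℤ) ∣ t - p := by
  have h1 : ((p % q : ℕ) : ℤ) ∈ K := lab_small hK (by positivity) (by
    have := Nat.mod_lt p hq
    omega)
  obtain ⟨t, ht, htm⟩ := (K.filter fun t => (q : ℤ) ∣ t - p).exists_max_image id
    ⟨((p % q : ℕ) : ℤ), Finset.mem_filter.2 ⟨h1, by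
      rw [← dvd_neg, neg_sub, Int.natCast_mod]; exact Int.dvd_self_sub_emod⟩⟩
  rw [Finset.mem_filter] at ht
  refine ⟨t, ht.1, fun h => ?_, ht.2⟩
  have := htm (t + q) (Finset.mem_filter.2 ⟨h, by
    rw [add_sub_right_comm]; exact dvd_add ht.2 (dvd_refl _)⟩)
  simp at this
  omega

lemma chi_core_hook (hq : 0 < q) {K : Finset ℤ} (hK : IsLab N q K) (hf : Flush q K) {t : ℤ}
    (ht : t ∈ K) (ht' : t + q ∉ K) (l : List ℕ) :
    (∃ s : ℤ, (s = 1 ∨ s = -1) ∧ chi N (up q t K) (q :: l) = s * chi N K l) ∧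
      chi N (up q t K) [2 * q] = 0 := by
  obtain ⟨i, rfl⟩ := exists_enum hK.1 ht
  have h1 := image_add_single (enum_injective hK.1) i (by rwa [image_enum hK.1])
  rw [image_enum hK.1] at h1
  obtain ⟨s, hs, h2⟩ := mn_eq_chi_fin h1.1 h1.2
  refine ⟨⟨s, hs, ?_⟩, ?_⟩
  · rw [h2, mn_core hq hK.1 hf i ht']
  · rw [h2, mn_core' hq hK.1 hf i ht', mul_zero]

lemma pair_image (p p' : Fin N) (hne : p ≠ p') (hp : N ≤ p + q)
    (hp' : (p' : ℤ) + q ∉ up q p (Finset.Ico (0 : ℤ) N)) :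
    ∃ s : ℤ, (s = 1 ∨ s = -1) ∧ ∀ l, chi N (up q p' (up q p (Finset.Ico (0 : ℤ) N))) l =
      s * mn (eps (dl N)) l
        (dl N + (Pi.single p (q : ℤ) : Fin N → ℤ) + (Pi.single p' (q : ℤ) : Fin N → ℤ)) := by
  have h1 := hook_image p hp
  have h3 : (dl N + (Pi.single p (q : ℤ) : Fin N → ℤ)) p' = p' := by
    simp [hne.symm, dl]
  have h2 := image_add_single h1.1 (q := q) p' (by rwa [h1.2, h3])
  rw [h1.2, h3] at h2
  exact mn_eq_chi_fin h2.1 h2.2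

lemma two_hook (hq : 0 < q) (p : Fin N) (hp : N ≤ p + q) (l : List ℕ) :
    ∃ s : ℤ, (s = 1 ∨ s = -1) ∧
      chi N (up (2 * q) p (Finset.Ico (0 : ℤ) N)) (q :: l) = s * hookVal q p l ∧
      chi N (up (2 * q) p (Finset.Ico (0 : ℤ) N)) [2 * q] = s := by
  obtain ⟨s, hs, h⟩ := chi_hook (q := 2 * q) p (by omega)
  refine ⟨s, hs, ?_, ?_⟩
  · rw [h, hookVal, mn_two_hook hq p hp, hookVal]
  · rw [h, hookVal_self (by omega) p (by omega), mul_one]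

lemma adj_hook (hq : 0 < q) (p p' : Fin N) (hp : N ≤ p + q) (hpp : (p : ℕ) = p' + q) (l : List ℕ) :
    ∃ s : ℤ, (s = 1 ∨ s = -1) ∧
      chi N (up q p' (up q p (Finset.Ico (0 : ℤ) N))) (q :: l) = s * hookVal q p l ∧
      chi N (up q p' (up q p (Finset.Ico (0 : ℤ) N))) [2 * q] = -s := by
  obtain ⟨s, hs, h⟩ := pair_image p p' (by rintro rfl; omega) hp (by
    rw [up, Finset.mem_insert, Finset.mem_erase]; push Not
    exact ⟨by omega, fun h => by omega⟩)
  refine ⟨s, hs, ?_, ?_⟩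
  · rw [h, mn_pair_adj hq p p' hp hpp, hookVal]
  · rw [h, mn_pair_adj' hq p p' hp hpp, mul_neg_one]

lemma pair_hook (hq : 0 < q) (hN : 2 * q ≤ N) (p p' : Fin N) (hne : p ≠ p') (hp : N ≤ p + q)
    (hp' : N ≤ p' + q) (l : List ℕ) :
    (∃ s : ℤ, (s = 1 ∨ s = -1) ∧ chi N (up q p' (up q p (Finset.Ico (0 : ℤ) N))) (q :: l) =
      s * (hookVal q p l + hookVal q p' l)) ∧
      chi N (up q p' (up q p (Finset.Ico (0 : ℤ) N))) [2 * q] = 0 := by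
  have hne' : (p : ℕ) ≠ p' := fun h => hne (Fin.ext h)
  obtain ⟨s, hs, h⟩ := pair_image p p' hne hp (by
    rw [up, Finset.mem_insert, Finset.mem_erase, Finset.mem_Ico]; push Not
    exact ⟨by omega, fun h => by omega⟩)
  refine ⟨⟨s, hs, ?_⟩, ?_⟩
  · rw [h, mn_pair hq p p' hne hp hp', hookVal, hookVal]
  · rw [h, mn_pair' hq p p' hne hp hp' hN, mul_zero]

lemma chi_parity (N : ℕ) (B : Finset ℤ) (k : ℕ) :
    (2 : ℤ) ∣ chi N B (List.replicate (2 ^ k) 1) - chi N B [2 ^ k] := by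
  have key : ∀ (r m : ℕ) (l : List ℕ), (2 : ℤ) ∣
      chi N B (List.replicate (2 * m) r ++ l) - chi N B (List.replicate m (2 * r) ++ l) := by
    intro r m
    induction m with
    | zero => simp
    | succ m ih =>
      intro l
      have h1 := mn_halve (eps (dl N)) r (List.replicate (2 * m) r ++ l) (enum N B)
      have h2 := ih ((2 * r) :: l)
      have h3 : chi N B (List.replicate (2 * m) r ++ (2 * r) :: l) =
          chi N B ((2 * r) :: (List.replicate (2 * m) r ++ l)) := chi_perm List.perm_middle
      have h4 : chi N B (List.replicate m (2 * r) ++ (2 * r) :: l) =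
          chi N B ((2 * r) :: (List.replicate m (2 * r) ++ l)) := chi_perm List.perm_middle
      rw [h3, h4] at h2
      rw [Nat.mul_succ, List.replicate_add, List.replicate_succ (n := m)]
      have h5 : chi N B (List.replicate (2 * m) r ++ List.replicate 2 r ++ l) =
          chi N B (r :: r :: (List.replicate (2 * m) r ++ l)) := by
        refine chi_perm ?_
        rw [List.append_assoc]
        exact List.perm_append_comm_assoc _ _ _
      rw [h5, List.cons_append]
      have := dvd_add h1 h2
      rw [← two_mul] at this
      rwa [show ∀ a b c d : ℤ, a - b + (c - d) = a - b + c - d by intros; ring,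
        show mn (eps (dl N)) ((2 * r) :: (List.replicate (2 * m) r ++ l)) (enum N B) =
          chi N B ((2 * r) :: (List.replicate (2 * m) r ++ l)) from rfl, sub_add_cancel] at this
  have h2 : ∀ k j : ℕ, (2 : ℤ) ∣ chi N B (List.replicate (2 ^ k) (2 ^ j)) - chi N B [2 ^ (k + j)] := by
    intro k
    induction k with
    | zero => simp
    | succ k ih =>
      intro j
      have h1 := key (2 ^ j) (2 ^ k) []
      simp only [List.append_nil] at h1
      rw [pow_succ' 2 k, show k + 1 + j = k + (j + 1) by ring]
      have h3 := ih (j + 1)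
      rw [pow_succ' 2 j] at h3
      have := dvd_add h1 h3
      rwa [sub_add_sub_cancel] at this
  simpa using h2 k 0

lemma chiVal_eq_zero {k : ℕ} {B : Finset ℤ} {s : ℤ} (hs : s = 1 ∨ s = -1)
    (h : chi N B [2 ^ k] = s) : chiVal N (2 ^ k) B = 0 := by
  have h1 := chi_parity N B k
  rw [chiVal, padicValInt.eq_zero_of_not_dvd]
  intro h2
  rw [h] at h1
  rcases hs with rfl | rfl <;> norm_cast at * <;> omega

lemma chiVal_up {k : ℕ} {B : Finset ℤ} (hB : IsLab N (2 ^ k) B) {t : ℤ} (ht : t ∈ B)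
    (ht' : t + (2 ^ k : ℕ) ∉ B) (h1 : ∀ s ∈ B, ((2 ^ k : ℕ) : ℤ) ∣ s - t → s ≤ t)
    (h2 : ∀ s, 0 ≤ s → s ≤ t → ((2 ^ k : ℕ) : ℤ) ∣ s - t → s ∈ B) :
    chiVal N (2 * 2 ^ k) (up (2 ^ k) t B) = chiVal N (2 ^ k) B + 1 := by
  have e1 := two_mul_chiVal hB
  have e2 := two_mul_chiVal (hB.up ht ht')
  rw [En_up ht (hB.2.1 t ht) ht' hB.2.1 h1 h2, ← two_mul] at e2
  have e3 := padicValNat_factorial_two_pow_mul_add k 2 (t := 0) (by positivity)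
  have e4 := padicValNat_factorial_two_pow_mul_add k 1 (t := 0) (by positivity)
  simp only [add_zero, mul_one, mul_comm (2 ^ k) 2] at e3 e4
  have h6 : padicValNat 2 (Nat.factorial 2) = 1 := by simp [Nat.factorial]
  have h7 : padicValNat 2 (Nat.factorial 1) = 0 := by simp
  rw [h6] at e3
  rw [h7] at e4
  have h8 : 1 ≤ 2 ^ k := Nat.one_le_two_pow
  zify [h8] at e3 e4 ⊢
  simp at e3 e4
  rw [e3] at e2
  rw [e4] at e1
  linarith

end Hooks

section Targets

variable {N q : ℕ}

/-- `C` arises from the `q`-core `K` by adding a hook congruent to the hook `B`. -/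
def CoreId (N q : ℕ) (B K C : Finset ℤ) : Prop :=
  ∃ (p : Fin N) (t : ℤ), N ≤ p + q ∧ B = up q p (Finset.Ico (0 : ℤ) N) ∧ Flush q K ∧ 0 ≤ t ∧ t ∈ K ∧
    t + q ∉ K ∧ (q : ℤ) ∣ t - p ∧ C = up q t K

/-- `C` arises by adding both of the hooks `B` and `B'`. -/
def HookId (N q : ℕ) (B B' C : Finset ℤ) : Prop :=
  ∃ p p' : Fin N, N ≤ p + q ∧ N ≤ p' + q ∧ p ≠ p' ∧ B = up q p (Finset.Ico (0 : ℤ) N) ∧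
    B' = up q p' (Finset.Ico (0 : ℤ) N) ∧ C = up q p' (up q p (Finset.Ico (0 : ℤ) N))

lemma HookId.inj (hq : 0 < q) {B B' C E E' : Finset ℤ} (h : HookId N q B B' C)
    (h' : HookId N q E E' C) : B = E ∧ B' = E' ∨ B = E' ∧ B' = E := by
  obtain ⟨p, p', h1, h2, hne, rfl, rfl, hC⟩ := h
  obtain ⟨r, r', g1, g2, gne, rfl, rfl, rfl⟩ := h'
  have hne' : (p : ℕ) ≠ p' := fun h => hne (Fin.ext h)
  have gne' : (r : ℕ) ≠ r' := fun h => gne (Fin.ext h)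
  have key : ∀ x : Fin N, (x = r ∨ x = r') ↔ (x = p ∨ x = p') := by
    intro x
    have := Finset.ext_iff.1 hC x
    simp only [up, Finset.mem_insert, Finset.mem_erase, Finset.mem_Ico] at this
    simp only [Fin.ext_iff]
    omega
  have h3 := (key r).1 (Or.inl rfl)
  have h4 := (key r').1 (Or.inr rfl)
  rcases h3 with rfl | rfl <;> rcases h4 with rfl | rfl <;> simp_all

lemma CoreId.inj (hq : 0 < q) {B K C E L : Finset ℤ} (h : CoreId N q B K C)
    (h' : CoreId N q E L C) : B = E ∧ K = L := by
  obtain ⟨p, t, h1, rfl, hf, h0, ht, htt, hd, rfl⟩ := h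
  obtain ⟨r, u, g1, rfl, gf, g0, hu, huu, gd, hC⟩ := h'
  have htu : t = u := by
    by_contra hne
    have h2 : u + q ∈ up q t K := by rw [hC]; exact Finset.mem_insert_self _ _
    have h3 : u ∉ up q t K := by
      rw [hC, up, Finset.mem_insert, Finset.mem_erase]; push Not
      exact ⟨by omega, fun h => absurd rfl h⟩
    simp only [up, Finset.mem_insert, Finset.mem_erase, not_or, not_and] at h2 h3
    have h4 : u + q ∈ K := by
      rcases h2 with h2 | h2
      · exact absurd (by linarith) hne
      · exact h2.2
    have h5 := hf _ h4 (by linarith)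
    rw [add_sub_cancel_right] at h5
    exact h3.2 (fun h => hne h.symm) h5
  subst htu
  constructor
  · have h2 : (q : ℤ) ∣ (p : ℤ) - r := by
      have := dvd_sub gd hd
      rwa [sub_sub_sub_cancel_left] at this
    have h3 : (p : ℤ) - r = 0 := by
      refine Int.eq_zero_of_abs_lt_dvd h2 ?_
      have := p.2
      have := r.2
      rw [abs_lt]; omega
    rw [show (p : ℤ) = r by linarith]
  · have key : ∀ {M : Finset ℤ}, t ∈ M → t + q ∉ M → M = insert t ((up q t M).erase (t + q)) := by
      intro M h1 h2
      rw [up, Finset.erase_insert (fun h => h2 (Finset.mem_of_mem_erase h)), Finset.insert_erase h1]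
    rw [key ht htt, hC, ← key hu huu]

lemma HookId.not_coreId (hq : 0 < q) {B B' C E L : Finset ℤ} (h : HookId N q B B' C)
    (h' : CoreId N q E L C) : False := by
  obtain ⟨p, p', h1, h2, hne, rfl, rfl, rfl⟩ := h
  obtain ⟨r, u, g1, rfl, gf, g0, hu, huu, gd, hC⟩ := h'
  have hne' : (p : ℕ) ≠ p' := fun h => hne (Fin.ext h)
  have key : ∀ x : Fin N, (x : ℤ) + q ∈ up q u L → (x : ℤ) ∉ up q u L → (x : ℤ) = u := by
    intro x hx hx'
    by_contra hxu
    simp only [up, Finset.mem_insert, Finset.mem_erase, not_or, not_and] at hx hx'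
    have h4 : (x : ℤ) + q ∈ L := by
      rcases hx with hx | hx
      · exact absurd (by linarith) hxu
      · exact hx.2
    have h5 := gf _ h4 (by linarith [dl_nonneg x])
    rw [add_sub_cancel_right] at h5
    exact hx'.2 hxu h5
  have e1 := key p (by
    rw [← hC]; simp only [up, Finset.mem_insert, Finset.mem_erase, true_or, and_true]; omega) (by
    rw [← hC]; simp only [up, Finset.mem_insert, Finset.mem_erase, Finset.mem_Ico]; omega)
  have e2 := key p' (by rw [← hC]; simp [up]) (by
    rw [← hC]; simp only [up, Finset.mem_insert, Finset.mem_erase, Finset.mem_Ico]; omega)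
  omega

/-- `C` arises by adding a hook to the union of `B` and `B'`. -/
def PairId (N q : ℕ) (B B' C : Finset ℤ) : Prop :=
  HookId N q B B' C ∨ CoreId N q B B' C ∨ CoreId N q B' B C

lemma PairId.inj (hq : 0 < q) {B B' C E E' : Finset ℤ} (h : PairId N q B B' C)
    (h' : PairId N q E E' C) : B = E ∧ B' = E' ∨ B = E' ∧ B' = E := by
  rcases h with h | h | h <;> rcases h' with h' | h' | h'
  · exact h.inj hq h'
  · exact (h.not_coreId hq h').elim
  · exact (h.not_coreId hq h').elim
  · exact (h'.not_coreId hq h).elim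
  · exact Or.inl (h.inj hq h')
  · exact Or.inr (h.inj hq h')
  · exact (h'.not_coreId hq h).elim
  · exact Or.inr (h.inj hq h').symm
  · exact Or.inl (h.inj hq h').symm

/-- `C` is one of the two labels attached to the hook `B`; the sign `w` tells which. -/
def DiagId (N q : ℕ) (B : Finset ℤ) (w : ℤ) (C : Finset ℤ) : Prop :=
  ∃ p : Fin N, N ≤ p + q ∧ B = up q p (Finset.Ico (0 : ℤ) N) ∧
    (w = 1 ∧ C = up (2 * q) p (Finset.Ico (0 : ℤ) N) ∨
      w = -1 ∧ ∃ p' : Fin N, (p : ℕ) = p' + q ∧ C = up q p' (up q p (Finset.Ico (0 : ℤ) N)))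

lemma DiagId.inj (hq : 0 < q) {B C E : Finset ℤ} {w z : ℤ} (h : DiagId N q B w C)
    (h' : DiagId N q E z C) : B = E ∧ w = z := by
  obtain ⟨p, h1, rfl, h⟩ := h
  obtain ⟨r, g1, rfl, h'⟩ := h'
  have hp := p.2
  have hr := r.2
  rcases h with ⟨rfl, hC⟩ | ⟨rfl, p', h2, hC⟩ <;> rcases h' with ⟨rfl, rfl⟩ | ⟨rfl, r', g2, rfl⟩
  · have := Finset.ext_iff.1 hC p
    simp only [up, Finset.mem_insert, Finset.mem_erase, Finset.mem_Ico] at this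
    rw [show (p : ℤ) = r by omega]; simp
  · have := Finset.ext_iff.1 hC p
    simp only [up, Finset.mem_insert, Finset.mem_erase, Finset.mem_Ico] at this
    omega
  · have := Finset.ext_iff.1 hC r
    simp only [up, Finset.mem_insert, Finset.mem_erase, Finset.mem_Ico] at this
    omega
  · have := Finset.ext_iff.1 hC p'
    simp only [up, Finset.mem_insert, Finset.mem_erase, Finset.mem_Ico] at this
    rw [show (p : ℤ) = r by omega]; simp

lemma isLab_hook (p : Fin N) (hp : N ≤ p + q) : IsLab N q (up q p (Finset.Ico (0 : ℤ) N)) := by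
  have := (isLab_base N).up (t := p) (q := q) (Finset.mem_Ico.2 ⟨by omega, by omega⟩)
    (by rw [Finset.mem_Ico]; omega)
  rwa [zero_add] at this

lemma diag_target {k : ℕ} (hN : 2 * 2 ^ k ≤ N) {B : Finset ℤ} (hB : IsLab N (2 ^ k) B)
    (hw : chi N B [2 ^ k] ≠ 0) (β : Bool) (l : List ℕ) :
    ∃ C, IsLab N (2 * 2 ^ k) C ∧ DiagId N (2 ^ k) B ((bif β then 1 else -1) * chi N B [2 ^ k]) C ∧
      (∃ s : ℤ, (s = 1 ∨ s = -1) ∧ chi N C (2 ^ k :: l) = s * (chi N B [2 ^ k] * chi N B l) ∧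
        chi N C [2 * 2 ^ k] = s * ((bif β then 1 else -1) * chi N B [2 ^ k])) ∧
      chiVal N (2 * 2 ^ k) C = 2 * chiVal N (2 ^ k) B := by
  have hq : 0 < 2 ^ k := by positivity
  generalize hQ : 2 ^ k = q at *
  obtain ⟨p, hp, rfl⟩ := exists_hook hq hB.1 hw
  obtain ⟨s, hs, h1⟩ := chi_hook p hp
  have hs1 : chi N (up q p (Finset.Ico (0 : ℤ) N)) [q] = s := by rw [h1, hookVal_self hq p hp, mul_one]
  have hz : chiVal N q (up q p (Finset.Ico (0 : ℤ) N)) = 0 := by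
    subst hQ; exact chiVal_eq_zero hs hs1
  have hwv : s * chi N (up q p (Finset.Ico (0 : ℤ) N)) l = hookVal q p l := by
    rw [h1]; rcases hs with rfl | rfl <;> ring
  rw [hs1, hwv, hz]
  have hε : (bif β then (1 : ℤ) else -1) * s = 1 ∨ (bif β then (1 : ℤ) else -1) * s = -1 := by
    rcases hs with rfl | rfl <;> cases β <;> simp
  have hz' : ∀ C t, (t = 1 ∨ t = -1) → chi N C [2 * q] = t → chiVal N (2 * q) C = 0 := by
    intro C t ht h
    have e : 2 * q = 2 ^ (k + 1) := by rw [pow_succ, hQ, mul_comm]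
    rw [e] at h ⊢
    exact chiVal_eq_zero ht h
  rcases hε with h | h <;> rw [h]
  · obtain ⟨t, ht, e1, e2⟩ := two_hook hq p hp l
    refine ⟨_, isLab_hook p (by omega), ⟨p, hp, rfl, Or.inl ⟨rfl, rfl⟩⟩, ⟨t, ht, e1, ?_⟩, hz' _ t ht e2⟩
    rw [e2, mul_one]
  · have hpp : (p : ℕ) = (⟨p - q, by omega⟩ : Fin N) + q := by simp; omega
    generalize (⟨p - q, by omega⟩ : Fin N) = p' at hpp
    obtain ⟨t, ht, e1, e2⟩ := adj_hook hq p p' hp hpp l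
    refine ⟨_, ?_, ⟨p, hp, rfl, Or.inr ⟨rfl, p', hpp, rfl⟩⟩, ⟨t, ht, e1, ?_⟩, hz' _ (-t) (by omega) e2⟩
    · rw [two_mul]
      refine (isLab_hook p hp).up ?_ ?_
      · simp only [up, Finset.mem_insert, Finset.mem_erase, Finset.mem_Ico]; omega
      · simp only [up, Finset.mem_insert, Finset.mem_erase, Finset.mem_Ico]; omega
    · rw [e2, mul_neg_one]

lemma core_target {k : ℕ} (hN : 2 * 2 ^ k ≤ N) {B K : Finset ℤ} (hB : IsLab N (2 ^ k) B)
    (hK : IsLab N (2 ^ k) K) (hw : chi N B [2 ^ k] ≠ 0) (hw' : chi N K [2 ^ k] = 0) (l : List ℕ) :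
    ∃ C, IsLab N (2 * 2 ^ k) C ∧ CoreId N (2 ^ k) B K C ∧
      (∃ s : ℤ, (s = 1 ∨ s = -1) ∧ chi N C (2 ^ k :: l) = s * (chi N B [2 ^ k] * chi N K l)) ∧
      chi N C [2 * 2 ^ k] = 0 ∧
      chiVal N (2 * 2 ^ k) C = chiVal N (2 ^ k) B + chiVal N (2 ^ k) K + 1 := by
  have hq : 0 < 2 ^ k := by positivity
  obtain ⟨p, hp, rfl⟩ := exists_hook hq hB.1 hw
  obtain ⟨s, hs, h1⟩ := chi_hook p hp
  have hs1 : chi N (up (2 ^ k) p (Finset.Ico (0 : ℤ) N)) [2 ^ k] = s := by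
    rw [h1, hookVal_self hq p hp, mul_one]
  have hz := chiVal_eq_zero hs hs1
  have hf := flush_of_chi_eq_zero hq hK hw'
  obtain ⟨t, ht, ht', hd⟩ := exists_top hq hN hK p
  obtain ⟨⟨u, hu, e1⟩, e2⟩ := chi_core_hook hq hK hf ht ht' l
  refine ⟨_, two_mul (2 ^ k) ▸ hK.up ht ht', ⟨p, t, hp, rfl, hf, hK.2.1 t ht, ht, ht', hd, rfl⟩,
    ⟨u * s, ?_, ?_⟩, e2, ?_⟩
  · rcases hs with rfl | rfl <;> rcases hu with rfl | rfl <;> simp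
  · rw [e1, hs1]; rcases hs with rfl | rfl <;> ring
  · rw [hz, zero_add]
    refine chiVal_up hK ht ht' (fun s hs hds => ?_) fun s h0 hle hds => ?_
    · by_contra hlt
      push Not at hlt
      refine ht' (hf.down hq hs (by linarith [hK.2.1 t ht]) ?_ ?_)
      · have := Int.le_of_dvd (by linarith) hds
        linarith
      · rw [← sub_sub]; exact dvd_sub hds (dvd_refl _)
    · exact hf.down hq ht h0 hle (by rw [← neg_sub, dvd_neg]; exact hds)

lemma hook_target {k : ℕ} (hN : 2 * 2 ^ k ≤ N) {B B' : Finset ℤ} (hB : IsLab N (2 ^ k) B)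
    (hB' : IsLab N (2 ^ k) B') (hne : B ≠ B') (hw : chi N B [2 ^ k] ≠ 0)
    (hw' : chi N B' [2 ^ k] ≠ 0) (l : List ℕ) :
    ∃ C, IsLab N (2 * 2 ^ k) C ∧ HookId N (2 ^ k) B B' C ∧
      (∃ s : ℤ, (s = 1 ∨ s = -1) ∧ chi N C (2 ^ k :: l) =
        s * (chi N B [2 ^ k] * chi N B' l + chi N B l * chi N B' [2 ^ k])) ∧
      chi N C [2 * 2 ^ k] = 0 ∧
      chiVal N (2 * 2 ^ k) C = chiVal N (2 ^ k) B + chiVal N (2 ^ k) B' + 1 := by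
  have hq : 0 < 2 ^ k := by positivity
  obtain ⟨p, hp, rfl⟩ := exists_hook hq hB.1 hw
  obtain ⟨p', hp', rfl⟩ := exists_hook hq hB'.1 hw'
  have hpp : p ≠ p' := by rintro rfl; exact hne rfl
  have hpp' : (p : ℕ) ≠ p' := fun h => hpp (Fin.ext h)
  obtain ⟨s, hs, h1⟩ := chi_hook p hp
  obtain ⟨s', hs', h1'⟩ := chi_hook p' hp'
  have hs1 : chi N (up (2 ^ k) p (Finset.Ico (0 : ℤ) N)) [2 ^ k] = s := by
    rw [h1, hookVal_self hq p hp, mul_one]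
  have hs1' : chi N (up (2 ^ k) p' (Finset.Ico (0 : ℤ) N)) [2 ^ k] = s' := by
    rw [h1', hookVal_self hq p' hp', mul_one]
  obtain ⟨⟨u, hu, e1⟩, e2⟩ := pair_hook hq hN p p' hpp hp hp' l
  have hmem : (p' : ℤ) ∈ up (2 ^ k) p (Finset.Ico (0 : ℤ) N) := by
    simp only [up, Finset.mem_insert, Finset.mem_erase, Finset.mem_Ico]; omega
  have hnmem : (p' : ℤ) + (2 ^ k : ℕ) ∉ up (2 ^ k) p (Finset.Ico (0 : ℤ) N) := by
    simp only [up, Finset.mem_insert, Finset.mem_erase, Finset.mem_Ico]; omega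
  have hdvd : ¬ ((2 ^ k : ℕ) : ℤ) ∣ (p : ℤ) - p' := by
    intro h
    have := Int.eq_zero_of_abs_lt_dvd h (by rw [abs_lt]; omega)
    omega
  refine ⟨_, two_mul (2 ^ k) ▸ hB.up hmem hnmem, ⟨p, p', hp, hp', hpp, rfl, rfl, rfl⟩,
    ⟨u * (s * s'), ?_, ?_⟩, e2, ?_⟩
  · rcases hs with rfl | rfl <;> rcases hs' with rfl | rfl <;> rcases hu with rfl | rfl <;> simp
  · rw [e1, hs1, hs1', h1, h1']; rcases hs with rfl | rfl <;> rcases hs' with rfl | rfl <;> ring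
  · rw [chiVal_eq_zero hs' hs1', add_zero]
    refine chiVal_up hB hmem hnmem (fun s hs hds => ?_) fun s h0 hle hds => ?_
    · rcases Finset.mem_insert.1 hs with rfl | hs
      · refine (hdvd ?_).elim
        rw [add_sub_right_comm] at hds
        exact (Int.dvd_add_left (dvd_refl _)).1 hds
      · have h3 := Finset.mem_Ico.1 (Finset.mem_of_mem_erase hs)
        by_contra hlt
        have := Int.le_of_dvd (by linarith) hds
        omega
    · simp only [up, Finset.mem_insert, Finset.mem_erase, Finset.mem_Ico]
      refine Or.inr ⟨?_, h0, by omega⟩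
      rintro rfl
      exact hdvd hds

end Targets

section Descent

lemma sum_subtype_of {X : Type} [Fintype X] (f : X → ℤ) (p : X → Prop) [Fintype {x // p x}]
    (hp : ∀ x, ¬ p x → f x = 0) : ∑ x : {x // p x}, f x = ∑ x, f x := by
  classical
  rw [← Finset.sum_filter_of_ne (s := Finset.univ) (p := p)]
  · exact (Finset.sum_subtype (Finset.univ.filter p) (by simp) f).symm
  · intro x _ h
    by_contra hx
    exact h (hp x hx)

lemma sum_descIdx {ι : Type} [Fintype ι] [LinearOrder ι] (v w : ι → ℤ) :
    ∑ x, (descV v w x * descV v w x + descW w x * descW w x) =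
      (∑ i, w i * w i) * (∑ i, v i * v i) + (∑ i, w i * v i) * (∑ i, w i * v i) +
        2 * ∑ i, w i * w i := by
  have key : ∀ F : ι → ι → ℤ, ∑ i, ∑ j, F i j =
      ∑ i, F i i + ∑ p : {p : ι × ι // p.1 < p.2}, (F p.1.1 p.1.2 + F p.1.2 p.1.1) := by
    intro F
    have h1 : ∑ p : {p : ι × ι // p.1 < p.2}, F p.1.2 p.1.1 =
        ∑ p : {p : ι × ι // p.2 < p.1}, F p.1.1 p.1.2 :=
      Fintype.sum_equiv ⟨fun p => ⟨(p.1.2, p.1.1), p.2⟩, fun p => ⟨(p.1.2, p.1.1), p.2⟩,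
        fun _ => rfl, fun _ => rfl⟩ _ _ fun _ => rfl
    have hs : ∀ (p : ι × ι → Prop) [DecidablePred p],
        ∑ x : {x // p x}, F x.1.1 x.1.2 = ∑ x, if p x then F x.1 x.2 else 0 := by
      intro p _
      rw [← Finset.sum_filter]
      exact (Finset.sum_subtype (Finset.univ.filter p) (by simp) fun x => F x.1 x.2).symm
    have h2 : ∑ i, F i i = ∑ x : ι × ι, if x.1 = x.2 then F x.1 x.2 else 0 := by
      rw [Fintype.sum_prod_type]
      simp
    rw [Finset.sum_add_distrib, h1, hs, hs, h2, ← Fintype.sum_prod_type', ← Finset.sum_add_distrib,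
      ← Finset.sum_add_distrib]
    refine Finset.sum_congr rfl fun x _ => ?_
    rcases lt_trichotomy x.1 x.2 with h | h | h
    · simp [h, h.ne, h.not_gt]
    · simp [h]
    · simp [h, h.ne', h.not_gt]
  rw [Fintype.sum_sum_type, Fintype.sum_prod_type, Finset.sum_mul_sum, Finset.sum_mul_sum, key, key]
  simp only [descV, descW, Fintype.sum_bool, cond_true, cond_false, Finset.mul_sum]
  rw [add_add_add_comm, ← Finset.sum_add_distrib, ← Finset.sum_add_distrib, add_right_comm,
    ← Finset.sum_add_distrib]
  congr 1
  · exact Finset.sum_congr rfl fun i _ => by ring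
  · exact Finset.sum_congr rfl fun p _ => by ring

lemma descV_descW_eq_zero {ι : Type} [LinearOrder ι] {v w : ι → ℤ} {x : DescIdx ι} :
    ¬ (descV v w x ≠ 0 ∨ descW w x ≠ 0) → descV v w x = 0 ∧ descW w x = 0 := fun h => by
  push Not at h; exact h

variable {G : Type} [Group G] [Fintype G]

/-- The label `C` belongs to the index `x`. -/
def Ident {N q : ℕ} {l : List ℕ} [LinearOrder (LabX N q l [q])] :
    DescIdx (LabX N q l [q]) → Finset ℤ → Prop
  | .inl x, C => DiagId N q x.1.1.1 ((bif x.2 then 1 else -1) * chi N x.1.1.1 [q]) C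
  | .inr x, C => PairId N q x.1.1.1.1 x.1.2.1.1 C

theorem LabReal.wreath {k N : ℕ} (hN : 4 * 2 ^ k ≤ N) {l : List ℕ} (hl : l.sum = 2 ^ k)
    (hl0 : ∀ s ∈ l, 0 < s) (hql : 2 ^ k ∉ l) {y c : G} (h : LabReal N (2 ^ k) y c l [2 ^ k]) :
    LabReal N (2 * 2 ^ k) (⟨c, y, false⟩ : Wr G) ⟨c, 1, true⟩ (2 ^ k :: l) [2 * 2 ^ k] := by
  classical
  have hq : 0 < 2 ^ k := by positivity
  have : Fintype (LabX N (2 ^ k) l [2 ^ k]) := Fintype.ofFinite _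
  let ord : LinearOrder (LabX N (2 ^ k) l [2 ^ k]) :=
    LinearOrder.lift' (Fintype.equivFin _) (Equiv.injective _)
  have h1 := (Realizes.wreath h).restrict _ (fun x => descV_descW_eq_zero)
  set v : LabX N (2 ^ k) l [2 ^ k] → ℤ := fun B => chi N B.1.1 l with hv
  set w : LabX N (2 ^ k) l [2 ^ k] → ℤ := fun B => chi N B.1.1 [2 ^ k] with hw
  set d : LabX N (2 ^ k) l [2 ^ k] → ℕ := fun B => chiVal N (2 ^ k) B.1.1 with hd
  have key : ∀ x : {x // descV v w x ≠ 0 ∨ descW w x ≠ 0}, ∃ C, IsLab N (2 * 2 ^ k) C ∧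
      Ident x.1 C ∧ (∃ s : ℤ, (s = 1 ∨ s = -1) ∧ chi N C (2 ^ k :: l) = s * descV v w x.1 ∧
        chi N C [2 * 2 ^ k] = s * descW w x.1) ∧ chiVal N (2 * 2 ^ k) C = descD d x.1 := by
    rintro ⟨⟨B, β⟩ | ⟨⟨B, B'⟩, hlt⟩, hx⟩
    · have hwB : chi N B.1.1 [2 ^ k] ≠ 0 := by
        intro h0
        simp [descV, descW, hw, h0] at hx
      exact diag_target (by omega) B.1.2 hwB β l
    · have hx' : chi N B.1.1 [2 ^ k] * chi N B'.1.1 l + chi N B.1.1 l * chi N B'.1.1 [2 ^ k] ≠ 0 := by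
        simpa [descV, descW] using hx
      have hne : B.1.1 ≠ B'.1.1 := fun h => (@ne_of_lt _ ord.toPreorder _ _ hlt) (Subtype.ext (Subtype.ext h))
      simp only [Ident, descV, descW, descD, mul_zero, hv, hw, hd]
      by_cases e1 : chi N B.1.1 [2 ^ k] = 0 <;> by_cases e2 : chi N B'.1.1 [2 ^ k] = 0
      · simp [e1, e2] at hx'
      · obtain ⟨C, a1, a2, ⟨s, hs, a3⟩, a4, a5⟩ := core_target (by omega) B'.1.2 B.1.2 e2 e1 l
        refine ⟨C, a1, Or.inr (Or.inr a2), ⟨s, hs, ?_, a4⟩, by rw [a5]; ring⟩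
        rw [a3, e1]; ring
      · obtain ⟨C, a1, a2, ⟨s, hs, a3⟩, a4, a5⟩ := core_target (by omega) B.1.2 B'.1.2 e1 e2 l
        refine ⟨C, a1, Or.inr (Or.inl a2), ⟨s, hs, ?_, a4⟩, a5⟩
        rw [a3, e2]; ring
      · obtain ⟨C, a1, a2, ⟨s, hs, a3⟩, a4, a5⟩ := hook_target (by omega) B.1.2 B'.1.2 hne e1 e2 l
        exact ⟨C, a1, Or.inl a2, ⟨s, hs, a3, a4⟩, a5⟩
  choose Φ hΦL hΦI hΦs hΦd using key
  have hLX : ∀ x, chi N (Φ x) (2 ^ k :: l) ≠ 0 ∨ chi N (Φ x) [2 * 2 ^ k] ≠ 0 := by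
    intro x
    obtain ⟨s, hs, a1, a2⟩ := hΦs x
    have hs0 : s ≠ 0 := by rcases hs with rfl | rfl <;> simp
    rw [a1, a2]
    exact x.2.imp (mul_ne_zero hs0) (mul_ne_zero hs0)
  let Ψ : {x // descV v w x ≠ 0 ∨ descW w x ≠ 0} → LabX N (2 * 2 ^ k) (2 ^ k :: l) [2 * 2 ^ k] :=
    fun x => ⟨⟨Φ x, hΦL x⟩, hLX x⟩
  have hinj : Function.Injective Ψ := by
    intro x x' hxx
    have hC : Φ x = Φ x' := congrArg (fun B => B.1.1) hxx
    have hI := hΦI x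
    have hI' := hΦI x'
    obtain ⟨s, hs, -, a2⟩ := hΦs x
    obtain ⟨s', hs', -, a2'⟩ := hΦs x'
    rw [← hC] at hI' a2'
    rw [a2] at a2'
    have hmix : ∀ B β (u u' : ℤ), (u = 1 ∨ u = -1) → (u' = 1 ∨ u' = -1) →
        (descV v w (Sum.inl (B, β)) ≠ 0 ∨ descW w (Sum.inl (B, β)) ≠ 0) →
        u * descW w (Sum.inl (B, β)) = u' * 0 → False := by
      intro B β u u' hu hu' hx he
      have hw0 : w B ≠ 0 := by
        intro h0
        simp [descV, descW, h0] at hx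
      have hu0 : u ≠ 0 := by rcases hu with rfl | rfl <;> simp
      rw [mul_zero, descW] at he
      cases β <;> simp [hu0, hw0] at he
    obtain ⟨⟨B, β⟩ | ⟨⟨B, B'⟩, hlt⟩, hx⟩ := x <;> obtain ⟨⟨E, γ⟩ | ⟨⟨E, E'⟩, hlt'⟩, hx'⟩ := x'
    · obtain ⟨b1, b2⟩ := DiagId.inj hq hI hI'
      have hBE : B = E := Subtype.ext (Subtype.ext b1)
      subst hBE
      have hw0 : chi N B.1.1 [2 ^ k] ≠ 0 := by
        intro h0
        simp [descV, descW, hw, h0] at hx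
      have := mul_right_cancel₀ hw0 b2
      have : β = γ := by cases β <;> cases γ <;> simp at this ⊢
      rw [Subtype.mk.injEq, this]
    · exact (hmix B β s s' hs hs' hx a2').elim
    · exact (hmix E γ s' s hs' hs hx' a2'.symm).elim
    · rcases PairId.inj hq hI hI' with ⟨b1, b2⟩ | ⟨b1, b2⟩
      · have hBE : B = E := Subtype.ext (Subtype.ext b1)
        have hBE' : B' = E' := Subtype.ext (Subtype.ext b2)
        subst hBE hBE'; rfl
      · have hBE : B = E' := Subtype.ext (Subtype.ext b1)
        have hBE' : B' = E := Subtype.ext (Subtype.ext b2)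
        subst hBE hBE'
        exact absurd hlt (@LT.lt.not_gt _ ord.toPreorder _ _ hlt')
  have hbij : Function.Bijective Ψ := by
    have : Fintype (LabX N (2 * 2 ^ k) (2 ^ k :: l) [2 * 2 ^ k]) := Fintype.ofFinite _
    refine bijective_of_sum_eq hinj (fun C => chi N C.1.1 (2 ^ k :: l) * chi N C.1.1 (2 ^ k :: l) +
      chi N C.1.1 [2 * 2 ^ k] * chi N C.1.1 [2 * 2 ^ k]) (fun C => ?_) (le_of_eq ?_)
    · rcases C.2 with h | h
      · have := mul_self_pos.2 h
        have := mul_self_nonneg (chi N C.1.1 [2 * 2 ^ k])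
        linarith
      · have := mul_self_pos.2 h
        have := mul_self_nonneg (chi N C.1.1 (2 ^ k :: l))
        linarith
    · have e1 : ∀ x, chi N (Ψ x).1.1 (2 ^ k :: l) * chi N (Ψ x).1.1 (2 ^ k :: l) +
          chi N (Ψ x).1.1 [2 * 2 ^ k] * chi N (Ψ x).1.1 [2 * 2 ^ k] =
          descV v w x.1 * descV v w x.1 + descW w x.1 * descW w x.1 := by
        intro x
        obtain ⟨s, hs, a1, a2⟩ := hΦs x
        simp only [Ψ, a1, a2]
        rcases hs with rfl | rfl <;> ring
      have hsum0 : ∀ {m : ℕ} {l₁ l₂ : List ℕ} (f : Lab N m → ℤ)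
          [Fintype (LabX N m l₁ l₂)], (∀ B, chi N B.1 l₁ = 0 → chi N B.1 l₂ = 0 → f B = 0) →
          ∑ B : LabX N m l₁ l₂, f B.1 = ∑ B, f B := by
        intro m l₁ l₂ f _ hf
        exact sum_subtype_of f _ fun B hB => by push Not at hB; exact hf B hB.1 hB.2
      have hzq : ∀ {m : ℕ}, zf [m] [m] = m := by
        intro m
        rw [zf_of_perm (List.Perm.refl _) {m} (by simp)]; simp
      have hql0 : zf [2 ^ k] l = 0 := by
        by_contra hne
        exact hql ((perm_of_zf_ne_zero hne).subset (by simp))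
      rw [Finset.sum_congr rfl fun x _ => e1 x,
        sum_subtype_of (fun x => descV v w x * descV v w x + descW w x * descW w x) _ (fun x hx => by
          obtain ⟨b1, b2⟩ := descV_descW_eq_zero hx
          rw [b1, b2]; ring), sum_descIdx,
        hsum0 (fun B => chi N B.1 (2 ^ k :: l) * chi N B.1 (2 ^ k :: l) +
          chi N B.1 [2 * 2 ^ k] * chi N B.1 [2 * 2 ^ k]) (fun B b1 b2 => by rw [b1, b2]; ring),
        hsum0 (fun B => chi N B.1 [2 ^ k] * chi N B.1 [2 ^ k]) (fun B b1 b2 => by rw [b2]; ring),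
        hsum0 (fun B => chi N B.1 l * chi N B.1 l) (fun B b1 b2 => by rw [b1]; ring),
        hsum0 (fun B => chi N B.1 [2 ^ k] * chi N B.1 l) (fun B b1 b2 => by rw [b1]; ring),
        Finset.sum_add_distrib,
        sum_chi_mul (by omega) (by simp [hl]; ring) (by simp [hl]; ring) (by simpa using hl0) (by simpa using hl0),
        sum_chi_mul (by omega) (by simp) (by simp) (by simp) (by simp),
        sum_chi_mul (by omega) (by simp) (by simp) (by simp) (by simp),
        sum_chi_mul (by omega) hl hl hl0 hl0, sum_chi_mul (by omega) (by simp) hl (by simp) hl0,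
        hql0, hzq, hzq]
      have := zf_append (l := [2 ^ k]) (l' := l) (by simpa using hql)
      rw [hzq] at this
      rw [show 2 ^ k :: l = [2 ^ k] ++ l from rfl, this]
      push_cast; ring
  refine Realizes.reindex h1 (Equiv.ofBijective Ψ hbij).symm (fun C => ?_) (fun C => ?_)
  · obtain ⟨x, rfl⟩ := hbij.2 C
    rw [Equiv.ofBijective_symm_apply_apply]
    obtain ⟨s, hs, a1, a2⟩ := hΦs x
    refine ⟨s, hs, ?_, ?_⟩
    · simp only [Ψ, a1]; rcases hs with rfl | rfl <;> ring
    · simp only [Ψ, a2]; rcases hs with rfl | rfl <;> ring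
  · obtain ⟨x, rfl⟩ := hbij.2 C
    rw [Equiv.ofBijective_symm_apply_apply]
    exact (hΦd x).symm

end Descent

section Subnormalizer
variable {G : Type} [Group G]

/-- `g` normalizes a finite `2`-subgroup containing `x`. -/
def NS (x g : G) : Prop :=
  ∃ Q : Subgroup G, IsPGroup 2 Q ∧ x ∈ Q ∧ ∀ h ∈ Q, g * h * g⁻¹ ∈ Q

lemma le_normalizer_of_conj_mem [Finite G] {Q : Subgroup G} {g : G} (h : ∀ q ∈ Q, g * q * g⁻¹ ∈ Q) :
    g ∈ Subgroup.normalizer (Q : Set G) := by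
  have h1 : Q.map (MulAut.conj g).toMonoidHom ≤ Q := by
    rintro _ ⟨q, hq, rfl⟩
    exact h q hq
  have h2 : Q.map (MulAut.conj g).toMonoidHom = Q :=
    Subgroup.eq_of_le_of_card_ge h1 (Subgroup.card_map_of_injective (MulAut.conj g).injective).ge
  rw [Subgroup.mem_normalizer_iff_map_conj_eq]
  exact h2

lemma NormalIn.le_normalizer [Finite G] {H K : Subgroup G} (h : NormalIn H K) :
    K ≤ Subgroup.normalizer (H : Set G) := fun k hk => le_normalizer_of_conj_mem (h.2 k hk)

lemma normalIn_sup [Finite G] {P Q K : Subgroup G} (hP : NormalIn P K) (hQ : NormalIn Q K) :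
    NormalIn (P ⊔ Q) K := by
  refine ⟨sup_le hP.1 hQ.1, fun k hk h hh => ?_⟩
  have : (P ⊔ Q).map (MulAut.conj k).toMonoidHom ≤ P ⊔ Q := by
    rw [Subgroup.map_sup]
    refine sup_le_sup ?_ ?_
    · rintro _ ⟨q, hq, rfl⟩; exact hP.2 k hk q hq
    · rintro _ ⟨q, hq, rfl⟩; exact hQ.2 k hk q hq
  exact this ⟨h, hh, rfl⟩

lemma exists_pgroup_of_isSubnormalIn [Finite G] {x : G} (hx : IsPGroup 2 (Subgroup.zpowers x))
    {K : Subgroup G} (h : IsSubnormalIn (Subgroup.zpowers x) K) :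
    ∃ Q : Subgroup G, IsPGroup 2 Q ∧ x ∈ Q ∧ NormalIn Q K := by
  induction h with
  | refl =>
    exact ⟨_, hx, Subgroup.mem_zpowers x, le_rfl, fun k hk h hh =>
      mul_mem (mul_mem hk hh) (inv_mem hk)⟩
  | @tail H K _ hHK ih =>
    obtain ⟨Q₀, h1, h2, h3⟩ := ih
    let S : Set (Subgroup G) := {Q | IsPGroup 2 Q ∧ NormalIn Q H}
    obtain ⟨Q, ⟨hQ1, hQ2⟩, hmax⟩ := Set.Finite.exists_maximalFor (fun Q : Subgroup G => Nat.card Q) S (Set.toFinite S) ⟨Q₀, h1, h3⟩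
    have key : ∀ P : Subgroup G, IsPGroup 2 P → NormalIn P H → P ≤ Q := by
      intro P hP1 hP2
      have hs : IsPGroup 2 (P ⊔ Q : Subgroup G) :=
        hP1.to_sup_of_normal_right' hQ1 (hP2.1.trans hQ2.le_normalizer)
      have h4 := hmax (j := P ⊔ Q) ⟨hs, normalIn_sup hP2 hQ2⟩
        (Subgroup.card_le_of_le le_sup_right)
      have := Subgroup.eq_of_le_of_card_ge (le_sup_right : Q ≤ P ⊔ Q) h4
      rw [this]; exact le_sup_left
    refine ⟨Q, hQ1, key _ h1 h3 h2, hQ2.1.trans hHK.1, fun k hk q hq => ?_⟩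
    refine key (Q.map (MulAut.conj k).toMonoidHom) (hQ1.map _) ⟨?_, ?_⟩ ⟨q, hq, rfl⟩
    · rintro _ ⟨q, hq, rfl⟩
      exact hHK.2 k hk q (hQ2.1 hq)
    · rintro t ht _ ⟨q, hq, rfl⟩
      have hk' : k⁻¹ * t * k ∈ H := by simpa using hHK.2 k⁻¹ (inv_mem hk) t ht
      refine ⟨_, hQ2.2 _ hk' q hq, ?_⟩
      simp; group

lemma isSubnormalIn_of_isPGroup [Finite G] {A P : Subgroup G} (hAP : A ≤ P) (hP : IsPGroup 2 P) :
    IsSubnormalIn A P := by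
  induction hn : Nat.card P - Nat.card A using Nat.strong_induction_on generalizing A with
  | _ n ih =>
  by_cases h : A = P
  · subst h; exact Relation.ReflTransGen.refl
  have hlt : A.subgroupOf P < ⊤ := by
    rw [lt_top_iff_ne_top, Ne, Subgroup.subgroupOf_eq_top]
    exact fun h' => h (le_antisymm hAP h')
  have := hP.isNilpotent
  have h1 := Group.normalizerCondition_of_isNilpotent (G := P) _ hlt
  let B := (Subgroup.normalizer (A.subgroupOf P : Set P)).map P.subtype
  have hA : A = (A.subgroupOf P).map P.subtype := by
    rw [Subgroup.map_subgroupOf_eq_of_le hAP]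
  have hAB : A < B := by
    rw [hA]
    exact (Subgroup.map_lt_map_iff_of_injective P.subtype_injective).2 h1
  have hBP : B ≤ P := Subgroup.map_subtype_le _
  have hc1 : Nat.card A < Nat.card B := by
    by_contra hc
    exact hAB.ne (Subgroup.eq_of_le_of_card_ge hAB.le (not_lt.1 hc))
  have hc2 := Subgroup.card_le_of_le hBP
  refine Relation.ReflTransGen.head ⟨hAB.le, ?_⟩ (ih _ (by omega) hBP rfl)
  rintro _ ⟨k, hk, rfl⟩ h hh
  have := (Subgroup.mem_normalizer_iff.1 hk ⟨h, hAP hh⟩).1 hh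
  exact this

lemma isSubnormalIn_iff_NS [Finite G] {x : G} (hx : IsPGroup 2 (Subgroup.zpowers x)) (g : G) :
    IsSubnormalIn (Subgroup.zpowers x) (Subgroup.closure {x, g}) ↔ NS x g := by
  constructor
  · intro h
    obtain ⟨Q, h1, h2, h3⟩ := exists_pgroup_of_isSubnormalIn hx h
    exact ⟨Q, h1, h2, fun q hq => h3.2 g (Subgroup.subset_closure (by simp)) q hq⟩
  · rintro ⟨Q, h1, h2, h3⟩
    have hK : Subgroup.closure {x, g} ≤ Subgroup.normalizer (Q : Set G) := by
      rw [Subgroup.closure_le]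
      rintro y (rfl | rfl)
      · exact Subgroup.le_normalizer h2
      · exact le_normalizer_of_conj_mem h3
    refine (isSubnormalIn_of_isPGroup (P := Q ⊓ Subgroup.closure {x, g}) ?_
      (h1.to_le inf_le_left)).tail ⟨inf_le_right, fun k hk h hh => ⟨?_, ?_⟩⟩
    · rw [Subgroup.zpowers_le]
      exact ⟨h2, Subgroup.subset_closure (by simp)⟩
    · exact (Subgroup.mem_normalizer_iff.1 (hK hk) h).1 hh.1
    · exact (Subgroup.closure {x, g}).mul_mem (mul_mem hk hh.2) (inv_mem hk)

/-- `x` has order a power of two. -/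
def Two (x : G) : Prop := IsPGroup 2 (Subgroup.zpowers x)

lemma Two.of_mem {x : G} {P : Subgroup G} (hP : IsPGroup 2 P) (h : x ∈ P) : Two x :=
  hP.to_le (Subgroup.zpowers_le.2 h)

lemma subnormalizer_eq [Finite G] {x : G} (hx : Two x) :
    subnormalizer x = Subgroup.closure {g | NS x g} := by
  rw [subnormalizer]
  congr 1
  ext g
  exact isSubnormalIn_iff_NS hx g

lemma NS.mem [Finite G] {x g : G} (h : NS x g) : g ∈ subnormalizer x := by
  rw [subnormalizer_eq (Two.of_mem h.choose_spec.1 h.choose_spec.2.1)]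
  exact Subgroup.subset_closure h

lemma subnormalizer_le [Finite G] {x : G} (hx : Two x) {H : Subgroup G} (h : ∀ g, NS x g → g ∈ H) :
    subnormalizer x ≤ H := by
  rw [subnormalizer_eq hx, Subgroup.closure_le]
  exact h

lemma le_subnormalizer [Finite G] {x : G} {P : Subgroup G} (hP : IsPGroup 2 P) (hx : x ∈ P) :
    P ≤ subnormalizer x := fun _ hg =>
  NS.mem ⟨P, hP, hx, fun _ hh => mul_mem (mul_mem hg hh) (inv_mem hg)⟩

lemma subnormalizer_map [Finite G] {H : Type} [Group H] {x : G} (e : G ≃* H) (hx : Two x) :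
    (subnormalizer x).map e.toMonoidHom = subnormalizer (e x) := by
  have : Finite H := Finite.of_equiv G e.toEquiv
  have hx' : Two (e x) := by
    have := hx.map e.toMonoidHom
    rw [MonoidHom.map_zpowers] at this
    exact this
  have main : ∀ {A B : Type} [Group A] [Group B] [Finite A] [Finite B] (f : A ≃* B) (a : A), Two a →
      (subnormalizer a).map f.toMonoidHom ≤ subnormalizer (f a) := by
    intro A B _ _ _ _ f a ha
    rw [Subgroup.map_le_iff_le_comap]
    refine subnormalizer_le ha ?_
    rintro g ⟨Q, h1, h2, h3⟩
    refine NS.mem (g := f g) ⟨Q.map f.toMonoidHom, h1.map _, ⟨a, h2, rfl⟩, ?_⟩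
    rintro _ ⟨q, hq, rfl⟩
    exact ⟨_, h3 q hq, by simp⟩
  refine le_antisymm (main e x hx) fun y hy => ?_
  have := main e.symm (e x) hx' ⟨y, hy, rfl⟩
  rw [e.symm_apply_apply] at this
  exact ⟨_, this, by simp⟩

/-- An isomorphism of groups restricts to subnormalizers. -/
def subnormalizerCongr [Finite G] {H : Type} [Group H] {x : G} (e : G ≃* H) (hx : Two x)
    {y : H} (hy : e x = y) : subnormalizer x ≃* subnormalizer y :=
  (e.subgroupMap (subnormalizer x)).trans
    (MulEquiv.subgroupCongr (by rw [← hy, ← subnormalizer_map e hx]; rfl))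

lemma two_of_orderOf {x : G} (hx : ∃ k, orderOf x = 2 ^ k) : Two x := by
  obtain ⟨k, hk⟩ := hx
  exact IsPGroup.of_card (n := k) (by rw [Nat.card_zpowers, hk])

/-- Subnormalizers are invariant under conjugation by elements normalizing `⟨x⟩`;
here the conjugate by an arbitrary element. -/
lemma subnormalizer_conj [Finite G] {x : G} (hx : Two x) (b : G) :
    subnormalizer (b * x * b⁻¹) = (subnormalizer x).map (MulAut.conj b).toMonoidHom :=
  (subnormalizer_map (MulAut.conj b) hx).symm

end Subnormalizer

section WreathPerm

/-- Functoriality of the wreath product. -/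
def Wr.map {K K' : Type} [Group K] [Group K'] (f : K →* K') : Wr K →* Wr K' where
  toFun w := ⟨f w.a, f w.b, w.s⟩
  map_one' := by simp [Wr.one_def]
  map_mul' := by
    rintro ⟨a, b, s⟩ ⟨c, d, t⟩
    cases s <;> simp [Wr.mul_def]

lemma Wr.map_injective {K K' : Type} [Group K] [Group K'] {f : K →* K'} (hf : Function.Injective f) :
    Function.Injective (Wr.map f) := by
  rintro ⟨a, b, s⟩ ⟨c, d, t⟩ h
  simp only [Wr.map, MonoidHom.coe_mk, OneHom.coe_mk, Wr.mk.injEq] at h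
  obtain ⟨h1, h2, h3⟩ := h
  rw [hf h1, hf h2, h3]

lemma Wr.isPGroup {K : Type} [Group K] (h : IsPGroup 2 K) : IsPGroup 2 (Wr K) := by
  have base : ∀ a b : K, ∀ n : ℕ, (⟨a, b, false⟩ : Wr K) ^ n = ⟨a ^ n, b ^ n, false⟩ := by
    intro a b n
    induction n with
    | zero => simp [Wr.one_def]
    | succ n ih => rw [pow_succ, ih]; simp [Wr.mul_def, pow_succ]
  have hb : ∀ a b : K, ∃ k, (⟨a, b, false⟩ : Wr K) ^ 2 ^ k = 1 := by
    intro a b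
    obtain ⟨m, hm⟩ := h a
    obtain ⟨n, hn⟩ := h b
    refine ⟨m + n, ?_⟩
    rw [base, pow_add, pow_mul, hm, mul_comm, pow_mul, hn, one_pow, one_pow]; rfl
  rintro ⟨a, b, s⟩
  cases s
  · exact hb a b
  · obtain ⟨k, hk⟩ := hb (a * b) (b * a)
    refine ⟨k + 1, ?_⟩
    rw [pow_succ', pow_mul, ← hk, pow_two]
    simp [Wr.mul_def]

variable {Y : Type}

/-- The imprimitive action of the wreath product of a symmetric group. -/
def Wr.perm (Y : Type) : Wr (Equiv.Perm Y) →* Equiv.Perm (Y ⊕ Y) where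
  toFun w := Equiv.Perm.sumCongr w.a w.b * (if w.s then Equiv.sumComm Y Y else 1)
  map_one' := by simp [Wr.one_def]
  map_mul' := by
    rintro ⟨a, b, s⟩ ⟨c, d, t⟩
    ext z
    cases s <;> cases t <;> rcases z with z | z <;> simp [Wr.mul_def]

lemma Wr.perm_false (a b : Equiv.Perm Y) :
    Wr.perm Y ⟨a, b, false⟩ = Equiv.Perm.sumCongr a b := by
  simp [Wr.perm]

lemma Wr.perm_true_inl (a b : Equiv.Perm Y) (u : Y) :
    Wr.perm Y ⟨a, b, true⟩ (Sum.inl u) = Sum.inr (b u) := by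
  simp [Wr.perm]

lemma Wr.perm_true_inr (a b : Equiv.Perm Y) (u : Y) :
    Wr.perm Y ⟨a, b, true⟩ (Sum.inr u) = Sum.inl (a u) := by
  simp [Wr.perm]

lemma Wr.perm_injective [Nonempty Y] : Function.Injective (Wr.perm Y) := by
  obtain ⟨y⟩ := ‹Nonempty Y›
  rintro ⟨a, b, s⟩ ⟨c, d, t⟩ h
  have h1 := fun u => DFunLike.congr_fun h (Sum.inl u)
  have h2 := fun u => DFunLike.congr_fun h (Sum.inr u)
  have h3 := h1 y
  cases s <;> cases t <;> simp [Wr.perm] at h1 h2 h3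
  · rw [Equiv.ext h1, Equiv.ext h2]
  · rw [Equiv.ext h1, Equiv.ext h2]

lemma Wr.exists_perm_eq [Finite Y] (g : Equiv.Perm (Y ⊕ Y)) (s : Bool)
    (h : ∀ z, (g z).isLeft = xor s z.isLeft) : ∃ a b, Wr.perm Y ⟨a, b, s⟩ = g := by
  have key : ∀ g : Equiv.Perm (Y ⊕ Y), (∀ z, (g z).isLeft = z.isLeft) →
      ∃ a b, Wr.perm Y ⟨a, b, false⟩ = g := by
    intro g hg
    have : g ∈ (Equiv.Perm.sumCongrHom Y Y).range := by
      refine Equiv.Perm.mem_sumCongrHom_range_of_perm_mapsTo_inl ?_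
      rintro _ ⟨u, rfl⟩
      have := hg (Sum.inl u)
      obtain ⟨v, hv⟩ := Sum.isLeft_iff.1 (by rw [this]; rfl)
      exact ⟨v, hv.symm⟩
    obtain ⟨⟨a, b⟩, hab⟩ := this
    exact ⟨a, b, by rw [Wr.perm_false, ← hab]; rfl⟩
  cases s
  · exact key g (by simpa using h)
  · obtain ⟨a, b, hab⟩ := key (g * Equiv.sumComm Y Y) (by
      rintro (z | z) <;> simp [h])
    refine ⟨a, b, ?_⟩
    ext z
    have := fun z => DFunLike.congr_fun hab (Equiv.sumComm Y Y z)
    rcases z with z | z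
    · simpa [Wr.perm] using this (Sum.inl z)
    · simpa [Wr.perm] using this (Sum.inr z)

/-- The wreath product of a subgroup, acting imprimitively. -/
def Wr.permOf (H : Subgroup (Equiv.Perm Y)) : Wr H →* Equiv.Perm (Y ⊕ Y) :=
  (Wr.perm Y).comp (Wr.map H.subtype)

lemma Wr.permOf_injective [Nonempty Y] (H : Subgroup (Equiv.Perm Y)) :
    Function.Injective (Wr.permOf H) :=
  Wr.perm_injective.comp (Wr.map_injective H.subtype_injective)

lemma Wr.perm_mem_range {H : Subgroup (Equiv.Perm Y)} {a b : Equiv.Perm Y} (s : Bool)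
    (ha : a ∈ H) (hb : b ∈ H) : Wr.perm Y ⟨a, b, s⟩ ∈ (Wr.permOf H).range :=
  ⟨⟨⟨a, ha⟩, ⟨b, hb⟩, s⟩, rfl⟩

lemma Wr.isPGroup_range {H : Subgroup (Equiv.Perm Y)} (hH : IsPGroup 2 H) :
    IsPGroup 2 (Wr.permOf H).range :=
  (Wr.isPGroup hH).of_surjective _ (Wr.permOf H).rangeRestrict_surjective

end WreathPerm

section Product
variable {G₁ G₂ G : Type} [Group G₁] [Group G₂] [Group G]

lemma IsPGroup.prod_subgroup {P : Subgroup G₁} {Q : Subgroup G₂} (hP : IsPGroup 2 P)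
    (hQ : IsPGroup 2 Q) : IsPGroup 2 (P.prod Q) := by
  rintro ⟨⟨a, b⟩, ha, hb⟩
  obtain ⟨m, hm⟩ := hP ⟨a, ha⟩
  obtain ⟨n, hn⟩ := hQ ⟨b, hb⟩
  have hm' : a ^ 2 ^ m = 1 := congrArg Subtype.val hm
  have hn' : b ^ 2 ^ n = 1 := congrArg Subtype.val hn
  refine ⟨m + n, Subtype.ext (Prod.ext ?_ ?_)⟩
  · change a ^ 2 ^ (m + n) = 1
    rw [pow_add, pow_mul, hm', one_pow]
  · change b ^ 2 ^ (m + n) = 1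
    rw [pow_add, mul_comm, pow_mul, hn', one_pow]

lemma NS.prod (f : G₁ × G₂ →* G) {x₁ a : G₁} {x₂ b : G₂} (h₁ : NS x₁ a) (h₂ : NS x₂ b) :
    NS (f (x₁, x₂)) (f (a, b)) := by
  obtain ⟨P, p1, p2, p3⟩ := h₁
  obtain ⟨Q, q1, q2, q3⟩ := h₂
  refine ⟨(P.prod Q).map f, (p1.prod_subgroup q1).map f, ⟨_, ⟨p2, q2⟩, rfl⟩, ?_⟩
  rintro _ ⟨⟨u, v⟩, ⟨hu, hv⟩, rfl⟩
  exact ⟨(a * u * a⁻¹, b * v * b⁻¹), ⟨p3 u hu, q3 v hv⟩, by simp [← map_mul, ← map_inv]⟩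

lemma NS.of_prod {f : G₁ × G₂ →* G} (hf : Function.Injective f) {x₁ a : G₁} {x₂ b : G₂}
    (h : NS (f (x₁, x₂)) (f (a, b))) : NS x₁ a ∧ NS x₂ b := by
  obtain ⟨Q, h1, h2, h3⟩ := h
  have hQ := h1.comap_of_injective f hf
  have h4 : ∀ u v, f (u, v) ∈ Q → f (a * u * a⁻¹, b * v * b⁻¹) ∈ Q := by
    intro u v huv
    have := h3 _ huv
    simpa [← map_mul, ← map_inv] using this
  refine ⟨⟨(Q.comap f).map (MonoidHom.fst G₁ G₂), hQ.map _, ⟨(x₁, x₂), h2, rfl⟩, ?_⟩,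
    ⟨(Q.comap f).map (MonoidHom.snd G₁ G₂), hQ.map _, ⟨(x₁, x₂), h2, rfl⟩, ?_⟩⟩
  · rintro _ ⟨⟨u, v⟩, huv, rfl⟩
    exact ⟨_, h4 u v huv, rfl⟩
  · rintro _ ⟨⟨u, v⟩, huv, rfl⟩
    exact ⟨_, h4 u v huv, rfl⟩

lemma NS.one {x : G} (hx : Two x) : NS x 1 :=
  ⟨_, hx, Subgroup.mem_zpowers x, by simp⟩

lemma mem_subnormalizer_prod [Finite G₁] [Finite G₂] [Finite G] (f : G₁ × G₂ →* G) {x₁ a : G₁}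
    {x₂ b : G₂} (h₁ : Two x₁) (h₂ : Two x₂) (ha : a ∈ subnormalizer x₁) (hb : b ∈ subnormalizer x₂) :
    f (a, b) ∈ subnormalizer (f (x₁, x₂)) := by
  have e1 : subnormalizer x₁ ≤ (subnormalizer (f (x₁, x₂))).comap (f.comp (MonoidHom.inl G₁ G₂)) :=
    subnormalizer_le h₁ fun g hg => (NS.prod f hg (NS.one h₂)).mem
  have e2 : subnormalizer x₂ ≤ (subnormalizer (f (x₁, x₂))).comap (f.comp (MonoidHom.inr G₁ G₂)) :=
    subnormalizer_le h₂ fun g hg => (NS.prod f (NS.one h₁) hg).mem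
  have e3 : f (a, 1) ∈ subnormalizer (f (x₁, x₂)) := e1 ha
  have e4 : f (1, b) ∈ subnormalizer (f (x₁, x₂)) := e2 hb
  have := mul_mem e3 e4
  rwa [← map_mul, Prod.mk_mul_mk, mul_one, one_mul] at this

end Product

section Blocks
variable {Ω : Type} [Finite Ω]

/-- A transitive `2`-group of permutations preserves a partition into two blocks. -/
lemma exists_block (Q : Subgroup (Equiv.Perm Ω)) (hQ : IsPGroup 2 Q)
    (ht : ∀ a b : Ω, ∃ q ∈ Q, q a = b) {v w : Ω} (hvw : v ≠ w) :
    ∃ f : Ω → Bool, (∀ q ∈ Q, ∃ s, ∀ ω, f (q ω) = xor s (f ω)) ∧ ∃ q ∈ Q, ∀ ω, f (q ω) = !f ω := by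
  classical
  let S : Subgroup Q := MulAction.stabilizer Q v
  obtain ⟨n, hn⟩ := IsPGroup.iff_card.1 hQ
  obtain ⟨m, hm⟩ := IsPGroup.iff_card.1 (hQ.to_subgroup S)
  have hS : S ≠ ⊤ := by
    intro h
    obtain ⟨q, hq, rfl⟩ := ht v w
    have : (⟨q, hq⟩ : Q) ∈ S := h ▸ Subgroup.mem_top _
    exact hvw (MulAction.mem_stabilizer_iff.1 this).symm
  have hmn : m < n := by
    by_contra hc
    refine hS (Subgroup.eq_top_of_le_card S ?_)
    rw [hn, hm]
    exact Nat.pow_le_pow_right (by norm_num) (not_lt.1 hc)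
  have h2 : Fact (Nat.Prime 2) := ⟨Nat.prime_two⟩
  obtain ⟨K, hK, hSK⟩ := Sylow.exists_subgroup_card_pow_prime_le (p := 2) (n := m) (m := n - 1)
    (G := Q) (by rw [hn]; exact pow_dvd_pow _ (by omega)) S hm (by omega)
  have hidx : K.index = 2 := by
    have := K.card_mul_index
    rw [hK, hn] at this
    have h3 : 2 ^ n = 2 ^ (n - 1) * 2 := by rw [← pow_succ]; congr 1; omega
    rw [h3] at this
    exact Nat.eq_of_mul_eq_mul_left (by positivity) this
  let f : Ω → Bool := fun ω => decide (∃ k ∈ K, (k : Equiv.Perm Ω) v = ω)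
  have hf : ∀ h : Q, f ((h : Equiv.Perm Ω) v) = decide (h ∈ K) := by
    intro h
    refine decide_eq_decide.2 ⟨?_, fun hh => ⟨h, hh, rfl⟩⟩
    rintro ⟨k, hk, hkh⟩
    have : k⁻¹ * h ∈ S := by
      rw [MulAction.mem_stabilizer_iff]
      change (k : Equiv.Perm Ω)⁻¹ ((h : Equiv.Perm Ω) v) = v
      rw [← hkh]; simp
    have := mul_mem hk (hSK this)
    rwa [mul_inv_cancel_left] at this
  have key : ∀ q : Q, ∀ ω, f ((q : Equiv.Perm Ω) ω) = xor (decide (q ∉ K)) (f ω) := by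
    intro q ω
    obtain ⟨h, hh, rfl⟩ := ht v ω
    have e1 := hf (q * ⟨h, hh⟩)
    have e2 := hf ⟨h, hh⟩
    rw [show ((q * ⟨h, hh⟩ : Q) : Equiv.Perm Ω) v = (q : Equiv.Perm Ω) (h v) from rfl] at e1
    rw [show ((⟨h, hh⟩ : Q) : Equiv.Perm Ω) v = h v from rfl] at e2
    rw [e1, e2]
    have e3 := Subgroup.mul_mem_iff_of_index_two hidx (a := q) (b := ⟨h, hh⟩)
    by_cases a1 : q ∈ K <;> by_cases a2 : (⟨h, hh⟩ : Q) ∈ K <;> simp [e3, a1, a2]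
  refine ⟨f, fun q hq => ⟨_, key ⟨q, hq⟩⟩, ?_⟩
  have hKt : K ≠ ⊤ := by
    rintro rfl
    simp at hidx
  obtain ⟨q, hq⟩ : ∃ q : Q, q ∉ K := by
    by_contra hc
    push Not at hc
    exact hKt (by ext q; simp [hc q])
  refine ⟨q, q.2, fun ω => ?_⟩
  rw [key]
  simp [hq]

/-- An element normalizing a transitive `2`-group preserves any partition into halves that is the
only one invariant under some element of the group. -/
lemma exists_perm_of_normalizes {Y : Type} [Finite Y] [Nonempty Y] {Q : Subgroup (Equiv.Perm (Y ⊕ Y))}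
    (hQ : IsPGroup 2 Q) (ht : ∀ a b, ∃ q ∈ Q, q a = b) {x : Equiv.Perm (Y ⊕ Y)} (hx : x ∈ Q)
    (hU : ∀ f : Y ⊕ Y → Bool, (∃ s, ∀ ω, f (x ω) = xor s (f ω)) →
      (∃ q : Equiv.Perm (Y ⊕ Y), ∀ ω, f (q ω) = !f ω) → ∃ t, ∀ ω, f ω = xor t ω.isLeft)
    {g : Equiv.Perm (Y ⊕ Y)} (hg : ∀ h ∈ Q, g * h * g⁻¹ ∈ Q) :
    ∃ a b s, Wr.perm Y ⟨a, b, s⟩ = g := by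
  obtain ⟨y⟩ := ‹Nonempty Y›
  obtain ⟨f, hf, q, hq, hfq⟩ := exists_block Q hQ ht (v := Sum.inl y) (w := Sum.inr y) (by simp)
  obtain ⟨t, ht⟩ := hU f (hf x hx) ⟨q, hfq⟩
  obtain ⟨t', ht'⟩ := hU (f ∘ g) (by
      obtain ⟨s, hs⟩ := hf _ (hg x hx)
      exact ⟨s, fun ω => by have := hs (g ω); simpa using this⟩)
    ⟨g⁻¹ * q * g, fun ω => by simp [hfq]⟩
  obtain ⟨a, b, h⟩ := Wr.exists_perm_eq g (xor t t') (fun z => by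
    have e1 := ht (g z)
    have e2 := ht' z
    simp only [Function.comp] at e2
    rw [e2] at e1
    revert e1
    cases t <;> cases t' <;> cases (g z).isLeft <;> cases z.isLeft <;> simp)
  exact ⟨a, b, _, h⟩

end Blocks

section Sylow

lemma exists_conj_le_sylow {G : Type} [Group G] [Finite G] {P : Subgroup G} (hP : IsPGroup 2 P)
    (S : Sylow 2 G) : ∃ g : G, ∀ p ∈ P, g * p * g⁻¹ ∈ S := by
  have h2 : Fact (Nat.Prime 2) := ⟨Nat.prime_two⟩
  obtain ⟨T, hT⟩ := hP.exists_le_sylow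
  obtain ⟨g, hg⟩ := MulAction.exists_smul_eq G T S
  refine ⟨g, fun p hp => ?_⟩
  rw [← hg]
  exact ⟨p, hT hp, rfl⟩

end Sylow

section FullCycles
variable {Y A B : Type}

lemma FullCycle.conj {c : Equiv.Perm Y} (h : FullCycle c) (g : Equiv.Perm Y) :
    FullCycle (g * c * g⁻¹) := fun _ _ => Equiv.Perm.sameCycle_conj.2 (h _ _)

lemma FullCycle.permCongr {c : Equiv.Perm A} (h : FullCycle c) (e : A ≃ B) :
    FullCycle (e.permCongr c) := by
  intro a b
  obtain ⟨i, hi⟩ := h (e.symm a) (e.symm b)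
  refine ⟨i, ?_⟩
  rw [show e.permCongr c ^ i = e.permCongr (c ^ i) from (map_zpow e.permCongrHom c i).symm]
  simp [Equiv.permCongr_apply, hi]

lemma Wr.perm_sq (c y : Equiv.Perm Y) :
    Wr.perm Y ⟨c, y, true⟩ * Wr.perm Y ⟨c, y, true⟩ = Equiv.Perm.sumCongr (c * y) (y * c) := by
  rw [← map_mul, ← Wr.perm_false]
  simp [Wr.mul_def]

lemma sumCongr_zpow_inl (a : Equiv.Perm A) (b : Equiv.Perm B) (i : ℤ) :
    (Equiv.Perm.sumCongr a b) ^ i = Equiv.Perm.sumCongr (a ^ i) (b ^ i) :=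
  (map_zpow (Equiv.Perm.sumCongrHom A B) (a, b) i).symm

lemma FullCycle.wreath {c : Equiv.Perm Y} (h : FullCycle c) :
    FullCycle (Wr.perm Y ⟨c, 1, true⟩) := by
  have h2 := Wr.perm_sq c 1
  have e1 : ∀ a b, (Wr.perm Y ⟨c, 1, true⟩).SameCycle (Sum.inl a) (Sum.inl b) := by
    intro a b
    obtain ⟨i, hi⟩ := h a b
    refine ⟨2 * i, ?_⟩
    rw [zpow_mul, zpow_ofNat, pow_two, h2, sumCongr_zpow_inl]
    simp [hi]
  have e2 : ∀ u, (Wr.perm Y ⟨c, 1, true⟩).SameCycle (Sum.inr u) (Sum.inl (c u)) := by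
    intro u
    rw [← Wr.perm_true_inr c 1 u]
    exact Equiv.Perm.sameCycle_apply_right.2 (Equiv.Perm.SameCycle.refl _ _)
  rintro (a | a) (b | b)
  · exact e1 a b
  · exact (e1 _ _).trans (e2 b).symm
  · exact (e2 a).trans (e1 _ _)
  · exact (e2 a).trans ((e1 _ _).trans (e2 b).symm)

lemma exists_fullCycle (k : ℕ) : ∃ (Y : Type) (_ : Fintype Y) (_ : DecidableEq Y)
    (c : Equiv.Perm Y), Fintype.card Y = 2 ^ k ∧ FullCycle c := by
  induction k with
  | zero => exact ⟨Unit, inferInstance, inferInstance, 1, rfl, fun a b => ⟨0, rfl⟩⟩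
  | succ k ih =>
    obtain ⟨Y, _, _, c, hY, hc⟩ := ih
    exact ⟨Y ⊕ Y, inferInstance, inferInstance, _, by rw [Fintype.card_sum, hY]; ring, hc.wreath⟩

lemma FullCycle.const {c : Equiv.Perm Y} (h : FullCycle c) {f : Y → Bool} (hf : ∀ y, f (c y) = f y)
    (a b : Y) : f a = f b := by
  obtain ⟨i, rfl⟩ := h a b
  have : ∀ i : ℕ, ∀ y, f ((c ^ i) y) = f y := by
    intro i
    induction i with
    | zero => simp
    | succ i ih => intro y; rw [pow_succ', Equiv.Perm.mul_apply, hf, ih]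
  obtain ⟨n, rfl | rfl⟩ := i.eq_nat_or_neg
  · rw [zpow_natCast, this]
  · rw [zpow_neg, zpow_natCast]
    have := this n ((c ^ n)⁻¹ a)
    rw [← Equiv.Perm.mul_apply, mul_inv_cancel] at this
    exact this

variable [Fintype Y] [DecidableEq Y]

lemma two_iff_cyc {x : Equiv.Perm Y} : Two x ↔ ∀ r ∈ cyc x, ∃ k, r = 2 ^ k := by
  constructor
  · intro h r hr
    rcases Multiset.mem_add.mp hr with hr | hr
    · have h2 : Fact (Nat.Prime 2) := ⟨Nat.prime_two⟩
      obtain ⟨n, hn⟩ := IsPGroup.iff_card.1 h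
      rw [Nat.card_zpowers] at hn
      have := Equiv.Perm.dvd_of_mem_cycleType hr
      rw [hn] at this
      obtain ⟨k, _, hk⟩ := (Nat.dvd_prime_pow Nat.prime_two).1 this
      exact ⟨k, hk⟩
    · exact ⟨0, Multiset.eq_of_mem_replicate hr⟩
  · intro h
    have : orderOf x ∣ 2 ^ (cyc x).sum := by
      rw [← Equiv.Perm.lcm_cycleType, Multiset.lcm_dvd]
      intro r hr
      have hr' : r ∈ cyc x := Multiset.mem_add.2 (Or.inl hr)
      obtain ⟨k, rfl⟩ := h r hr'
      exact pow_dvd_pow _ (Nat.lt_two_pow_self.le.trans (Multiset.le_sum_of_mem hr'))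
    obtain ⟨k, _, hk⟩ := (Nat.dvd_prime_pow Nat.prime_two).1 this
    exact two_of_orderOf ⟨k, hk⟩

lemma FullCycle.two [Nonempty Y] {c : Equiv.Perm Y} (h : FullCycle c) {k : ℕ}
    (hY : Fintype.card Y = 2 ^ k) : Two c := by
  rw [two_iff_cyc, h.cyc_eq]
  intro r hr
  exact ⟨k, by rw [Multiset.mem_singleton.1 hr, hY]⟩

lemma FullCycle.exists_equiv {A B : Type} [Fintype A] [Fintype B] [DecidableEq A] [DecidableEq B]
    [Nonempty A] {c : Equiv.Perm A} {d : Equiv.Perm B} (hc : FullCycle c) (hd : FullCycle d)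
    (h : Fintype.card A = Fintype.card B) : ∃ e : A ≃ B, e.permCongr c = d := by
  have : Nonempty B := (Fintype.equivOfCardEq h).nonempty_congr.1 ‹_›
  exact exists_equiv_of_cyc_eq (by rw [hc.cyc_eq, hd.cyc_eq, h])

lemma exists_fullCycle_perm {k : ℕ} (hY : Fintype.card Y = 2 ^ k) :
    ∃ c : Equiv.Perm Y, FullCycle c := by
  obtain ⟨Z, _, _, c, hZ, hc⟩ := exists_fullCycle k
  exact ⟨_, hc.permCongr (Fintype.equivOfCardEq (hZ.trans hY.symm))⟩

/-- A `2`-element on `2 ^ k` points lies in a `2`-group containing a full cycle. -/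
lemma exists_pgroup_fullCycle {k : ℕ} (hY : Fintype.card Y = 2 ^ k) {l : Equiv.Perm Y} (hl : Two l) :
    ∃ P : Subgroup (Equiv.Perm Y), IsPGroup 2 P ∧ l ∈ P ∧ ∃ c ∈ P, FullCycle c := by
  have hne : Nonempty Y := Fintype.card_pos_iff.1 (by rw [hY]; positivity)
  obtain ⟨c, hc⟩ := exists_fullCycle_perm hY
  obtain ⟨S, hS⟩ := IsPGroup.exists_le_sylow hl
  obtain ⟨g, hg⟩ := exists_conj_le_sylow (hc.two hY) S
  exact ⟨S, S.2, hS (Subgroup.mem_zpowers l), _, hg c (Subgroup.mem_zpowers c), hc.conj g⟩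

/-- The subnormalizer of a full cycle on `2 * 2 ^ k` points, from that of a full cycle on `2 ^ k`
points. -/
lemma subnormalizer_wreath_cycle [Nonempty Y] {c : Equiv.Perm Y} (hc : FullCycle c)
    (hP : IsPGroup 2 (subnormalizer c)) :
    subnormalizer (Wr.perm Y ⟨c, 1, true⟩) = (Wr.permOf (subnormalizer c)).range := by
  have hcm := mem_subnormalizer_self c
  have hr := Wr.isPGroup_range hP
  have hm : Wr.perm Y ⟨c, 1, true⟩ ∈ (Wr.permOf (subnormalizer c)).range :=
    Wr.perm_mem_range true hcm (one_mem _)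
  refine le_antisymm (subnormalizer_le (Two.of_mem hr hm) ?_) (le_subnormalizer hr hm)
  rintro g ⟨Q, h1, h2, h3⟩
  obtain ⟨a, b, s, rfl⟩ := exists_perm_of_normalizes h1 (fun a b => by
      obtain ⟨i, hi⟩ := hc.wreath a b
      exact ⟨_, zpow_mem h2 i, hi⟩) h2 (by
    rintro f ⟨s, hs⟩ ⟨q, hq⟩
    cases s
    · obtain ⟨y⟩ := ‹Nonempty Y›
      have := hq (Sum.inl y)
      rw [hc.wreath.const (f := f) (by simpa using hs) _ (Sum.inl y)] at this
      simp at this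
    · have e1 : ∀ u, f (Sum.inr u) = !f (Sum.inl u) := by
        intro u
        have := hs (Sum.inl u)
        rw [Wr.perm_true_inl] at this
        simpa using this
      have e2 : ∀ u, f (Sum.inl (c u)) = !f (Sum.inr u) := by
        intro u
        have := hs (Sum.inr u)
        rw [Wr.perm_true_inr] at this
        simpa using this
      obtain ⟨y⟩ := ‹Nonempty Y›
      have e3 : ∀ u, f (Sum.inl u) = f (Sum.inl y) := fun u =>
        hc.const (f := fun u => f (Sum.inl u)) (fun u => by rw [e2, e1, Bool.not_not]) u y
      refine ⟨!f (Sum.inl y), ?_⟩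
      rintro (u | u)
      · simp [e3]
      · simp [e1, e3]) h3
  have base : ∀ a b, (∀ h ∈ Q, Wr.perm Y ⟨a, b, false⟩ * h * (Wr.perm Y ⟨a, b, false⟩)⁻¹ ∈ Q) →
      a ∈ subnormalizer c ∧ b ∈ subnormalizer c := by
    intro a b h
    have h4 : NS (Equiv.Perm.sumCongrHom Y Y (c, c)) (Equiv.Perm.sumCongrHom Y Y (a, b)) := by
      refine ⟨Q, h1, ?_, ?_⟩
      · have := mul_mem h2 h2
        rw [Wr.perm_sq, mul_one, one_mul] at this
        exact this
      · rw [Wr.perm_false] at h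
        exact h
    obtain ⟨h5, h6⟩ := h4.of_prod Equiv.Perm.sumCongrHom_injective
    exact ⟨h5.mem, h6.mem⟩
  cases s
  · obtain ⟨ha, hb⟩ := base a b h3
    exact Wr.perm_mem_range _ ha hb
  · have e : Wr.perm Y ⟨a, b, true⟩ * Wr.perm Y ⟨c, 1, true⟩ = Wr.perm Y ⟨a, b * c, false⟩ := by
      rw [← map_mul]; simp [Wr.mul_def]
    obtain ⟨ha, hb⟩ := base a (b * c) (by
      rw [← e]
      intro h hh
      have := h3 _ (mul_mem (mul_mem h2 hh) (inv_mem h2))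
      simpa [mul_assoc] using this)
    refine Wr.perm_mem_range _ ha ?_
    simpa using mul_mem hb (inv_mem hcm)

/-- The subnormalizer of a full cycle on `2 ^ k` points is a `2`-group. -/
theorem FullCycle.isPGroup {k : ℕ} (hY : Fintype.card Y = 2 ^ k) {c : Equiv.Perm Y}
    (hc : FullCycle c) : IsPGroup 2 (subnormalizer c) := by
  induction k generalizing Y with
  | zero =>
    have : Subsingleton Y := Fintype.card_le_one_iff_subsingleton.1 (by simp [hY])
    intro g
    exact ⟨0, Subsingleton.elim _ _⟩
  | succ k ih =>
    obtain ⟨Z, _, _, d, hZ, hd⟩ := exists_fullCycle k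
    have hne : Nonempty Z := Fintype.card_pos_iff.1 (by rw [hZ]; positivity)
    have hY' : Fintype.card (Z ⊕ Z) = Fintype.card Y := by rw [Fintype.card_sum, hZ, hY]; ring
    obtain ⟨e, he⟩ := hd.wreath.exists_equiv hc hY'
    have h1 := subnormalizer_wreath_cycle hd (ih hZ hd)
    have h2 : IsPGroup 2 (subnormalizer (Wr.perm Z ⟨d, 1, true⟩)) := by
      rw [h1]; exact Wr.isPGroup_range (ih hZ hd)
    exact h2.of_equiv (subnormalizerCongr e.permCongrHom
      (hd.wreath.two (hY'.trans hY)) he)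

end FullCycles

section WreathLemma
variable {Y : Type} [Fintype Y] [DecidableEq Y]

lemma FullCycle.isPGroup_le {k : ℕ} (hY : Fintype.card Y = 2 ^ k) {c y : Equiv.Perm Y}
    (hc : FullCycle c) {P : Subgroup (Equiv.Perm Y)} (hP : IsPGroup 2 P) (hcP : c ∈ P) (hyP : y ∈ P) :
    P ≤ subnormalizer c ∧ subnormalizer c ≤ subnormalizer y :=
  ⟨le_subnormalizer hP hcP, le_subnormalizer (hc.isPGroup hY) (le_subnormalizer hP hcP hyP)⟩

/-- Subnormalizers of full cycles which both lie in a common subgroup `W` with one of the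
subnormalizers inside are fused in `W`. -/
lemma FullCycle.fusion {k : ℕ} (hY : Fintype.card Y = 2 ^ k) {c b : Equiv.Perm Y} (hc : FullCycle c)
    {W : Subgroup (Equiv.Perm Y)} (h1 : subnormalizer c ≤ W)
    (h2 : subnormalizer (b * c * b⁻¹) ≤ W) : b ∈ W := by
  have hne : Nonempty Y := Fintype.card_pos_iff.1 (by rw [hY]; positivity)
  have hp1 := hc.isPGroup hY
  have hp2 := (hc.conj b).isPGroup hY
  let S : Sylow 2 W := ⟨(subnormalizer (b * c * b⁻¹)).subgroupOf W,
    hp2.comap_of_injective _ W.subtype_injective, fun {T} hT hle => by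
      refine le_antisymm ?_ hle
      have h3 : IsPGroup 2 (T.map W.subtype) := hT.map _
      have h4 : b * c * b⁻¹ ∈ T.map W.subtype :=
        ⟨⟨_, h2 (mem_subnormalizer_self _)⟩, hle (mem_subnormalizer_self (b * c * b⁻¹)), rfl⟩
      intro t ht
      exact le_subnormalizer h3 h4 ⟨t, ht, rfl⟩⟩
  obtain ⟨w, hw⟩ := exists_conj_le_sylow (G := W) (P := (subnormalizer c).subgroupOf W)
    (hp1.comap_of_injective _ W.subtype_injective) S
  have h5 : ∀ p ∈ subnormalizer c, (w : Equiv.Perm Y) * p * (w : Equiv.Perm Y)⁻¹ ∈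
      subnormalizer (b * c * b⁻¹) := fun p hp => hw ⟨p, h1 hp⟩ hp
  have h6 : NS c (b⁻¹ * w) := by
    refine ⟨_, hp1, mem_subnormalizer_self c, fun h hh => ?_⟩
    have := h5 h hh
    rw [subnormalizer_conj (hc.two hY)] at this
    obtain ⟨v, hv, hv'⟩ := this
    have e : b * v * b⁻¹ = w * h * (w : Equiv.Perm Y)⁻¹ := hv'
    have : b⁻¹ * w * h * (b⁻¹ * w)⁻¹ = v := by
      rw [mul_inv_rev, inv_inv,
        show b⁻¹ * (w : Equiv.Perm Y) * h * ((w : Equiv.Perm Y)⁻¹ * b) =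
        b⁻¹ * ((w : Equiv.Perm Y) * h * (w : Equiv.Perm Y)⁻¹) * b by simp [mul_assoc], ← e]
      group
    rw [this]; exact hv
  have h7 := h1 h6.mem
  have := mul_mem w.2 (inv_mem h7)
  simpa using this

lemma orbit_dichotomy {k : ℕ} (hY : Fintype.card Y = 2 ^ k) {c y : Equiv.Perm Y} (hc : FullCycle c)
    {Q : Subgroup (Equiv.Perm (Y ⊕ Y))} (hQ : IsPGroup 2 Q) (hx : Equiv.Perm.sumCongr c y ∈ Q) :
    (∀ q ∈ Q, ∀ z, (q z).isLeft = z.isLeft) ∨ ∀ a b, ∃ q ∈ Q, q a = b := by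
  classical
  by_cases hpres : ∀ q ∈ Q, ∀ z, (q z).isLeft = z.isLeft
  · exact Or.inl hpres
  right
  have hne : Nonempty Y := Fintype.card_pos_iff.1 (by rw [hY]; positivity)
  obtain ⟨u₀⟩ := hne
  let O := MulAction.orbit Q (Sum.inl u₀ : Y ⊕ Y)
  have hmem : ∀ z, z ∈ O ↔ ∃ q ∈ Q, q (Sum.inl u₀) = z := fun z =>
    ⟨fun ⟨q, hq⟩ => ⟨q, q.2, hq⟩, fun ⟨q, h, hq⟩ => ⟨⟨q, h⟩, hq⟩⟩
  have hinl : ∀ u, (Sum.inl u : Y ⊕ Y) ∈ O := by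
    intro u
    obtain ⟨i, hi⟩ := hc u₀ u
    refine (hmem _).2 ⟨_, zpow_mem hx i, ?_⟩
    rw [sumCongr_zpow_inl]; simp [hi]
  have hO : ∀ q ∈ Q, ∀ z ∈ O, q z ∈ O := by
    intro q hq z hz
    obtain ⟨r, hr, rfl⟩ := (hmem z).1 hz
    exact (hmem _).2 ⟨_, mul_mem hq hr, rfl⟩
  -- the orbit contains a right point
  obtain ⟨v, hv⟩ : ∃ v, (Sum.inr v : Y ⊕ Y) ∈ O := by
    by_contra hcon
    push Not at hcon
    have hQinl : ∀ q ∈ Q, ∀ u, (q (Sum.inl u)).isLeft = true := by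
      intro q hq u
      rcases hz : q (Sum.inl u) with w | w
      · rfl
      · exact absurd (hz ▸ hO q hq _ (hinl u)) (hcon w)
    apply hpres
    intro q hq z
    rcases z with u | u
    · exact hQinl q hq u
    · rcases hz : q (Sum.inr u) with w | w
      · exfalso
        have := hQinl q⁻¹ (inv_mem hq) w
        rw [← hz] at this
        simp at this
      · rfl
  have hcard : ∃ n, Nat.card O = 2 ^ n := by
    have h2 : Fact (Nat.Prime 2) := ⟨Nat.prime_two⟩
    exact hQ.card_orbit _
  obtain ⟨n, hn⟩ := hcard
  have hOuniv : O = Set.univ := by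
    have e1 : Nat.card O = (O.toFinset).card := by simp
    have e2 : O.toFinset.card ≤ 2 ^ (k + 1) := by
      refine (Finset.card_le_univ _).trans ?_
      rw [Fintype.card_sum, hY, pow_succ]; omega
    have e3 : 2 ^ k < O.toFinset.card := by
      have : insert (Sum.inr v) (Finset.univ.map ⟨Sum.inl, Sum.inl_injective⟩) ⊆ O.toFinset := by
        intro z hz
        rw [Set.mem_toFinset]
        rcases Finset.mem_insert.1 hz with rfl | hz
        · exact hv
        · obtain ⟨u, _, rfl⟩ := Finset.mem_map.1 hz
          exact hinl u
      have := Finset.card_le_card this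
      rw [Finset.card_insert_of_notMem (by simp), Finset.card_map, Finset.card_univ, hY] at this
      omega
    rw [← e1, hn] at e2 e3
    have e4 := (Nat.pow_lt_pow_iff_right (by norm_num : 1 < 2)).1 e3
    have e5 := (Nat.pow_le_pow_iff_right (by norm_num : 1 < 2)).1 e2
    have e6 : n = k + 1 := by omega
    have : O.toFinset = Finset.univ := by
      rw [← Finset.card_eq_iff_eq_univ, ← e1, hn, e6, Fintype.card_sum, hY]; ring
    rwa [← Set.toFinset_univ, Set.toFinset_inj] at this
  intro a b
  obtain ⟨q, hq, rfl⟩ := (hmem a).1 (hOuniv ▸ Set.mem_univ a)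
  obtain ⟨r, hr, rfl⟩ := (hmem b).1 (hOuniv ▸ Set.mem_univ b)
  exact ⟨r * q⁻¹, mul_mem hr (inv_mem hq), by simp⟩

lemma exists_perm_of_NS {k : ℕ} (hY : Fintype.card Y = 2 ^ k) {c y : Equiv.Perm Y} (hc : FullCycle c)
    (hfix : ∃ v, y v = v) {Q : Subgroup (Equiv.Perm (Y ⊕ Y))} (hQ : IsPGroup 2 Q)
    (hx : Equiv.Perm.sumCongr c y ∈ Q) {g : Equiv.Perm (Y ⊕ Y)} (hg : ∀ h ∈ Q, g * h * g⁻¹ ∈ Q) :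
    ∃ a b s, Wr.perm Y ⟨a, b, s⟩ = g := by
  have hne : Nonempty Y := Fintype.card_pos_iff.1 (by rw [hY]; positivity)
  rcases orbit_dichotomy hY hc hQ hx with hp | ht
  · -- `g` maps the orbit `inl` to an orbit
    have hgc : ∀ u v, (g (Sum.inl u)).isLeft = (g (Sum.inl v)).isLeft := by
      have : ∀ u, (g (Sum.inl (c u))).isLeft = (g (Sum.inl u)).isLeft := by
        intro u
        have := hp _ (hg _ hx) (g (Sum.inl u))
        simpa using this
      exact hc.const (f := fun u => (g (Sum.inl u)).isLeft) this
    obtain ⟨u₀⟩ := hne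
    have hgr : ∀ v, (g (Sum.inr v)).isLeft = !(g (Sum.inl u₀)).isLeft := by
      intro v
      by_contra hcon
      have h1 : (g (Sum.inr v)).isLeft = (g (Sum.inl u₀)).isLeft := by
        revert hcon
        cases (g (Sum.inr v)).isLeft <;> cases (g (Sum.inl u₀)).isLeft <;> simp
      -- injection of `Option Y` in one half
      classical
      let F : Option Y → Y ⊕ Y := fun o => o.elim (g (Sum.inr v)) fun u => g (Sum.inl u)
      have hF : ∀ o, (F o).isLeft = (g (Sum.inl u₀)).isLeft := by
        rintro (_ | u)
        · exact h1
        · exact hgc u u₀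
      have hFi : Function.Injective F := by
        rintro (_ | u) (_ | w) h
        · rfl
        · exact absurd (g.injective h) (by simp)
        · exact absurd (g.injective h) (by simp)
        · have := g.injective h
          simp only [Sum.inl.injEq] at this
          rw [this]
      have hproj : Function.Injective fun o => (Sum.elim id id (F o) : Y) := by
        intro o o' h
        have h2 := (hF o).trans (hF o').symm
        apply hFi
        have h3 : Sum.elim id id (F o) = Sum.elim id id (F o') := h
        clear h
        revert h3 h2
        generalize F o = p
        generalize F o' = p'
        rcases p with a | a <;> rcases p' with b | b <;> simp
      have := Fintype.card_le_of_injective _ hproj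
      simp at this
    obtain ⟨a, b, h⟩ := Wr.exists_perm_eq g (!(g (Sum.inl u₀)).isLeft) (by
      rintro (u | u)
      · rw [hgc u u₀]; simp
      · rw [hgr]; simp)
    exact ⟨a, b, _, h⟩
  · refine exists_perm_of_normalizes hQ ht hx ?_ hg
    rintro f ⟨s, hs⟩ ⟨q, hq⟩
    obtain ⟨v, hv⟩ := hfix
    have hs0 : s = false := by
      have := hs (Sum.inr v)
      simp only [Equiv.Perm.sumCongr_apply, Sum.map_inr, hv] at this
      revert this
      cases s <;> simp
    subst hs0
    obtain ⟨u₀⟩ := hne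
    have hl : ∀ u, f (Sum.inl u) = f (Sum.inl u₀) := fun u =>
      hc.const (f := fun u => f (Sum.inl u)) (fun u => by simpa using hs (Sum.inl u)) u u₀
    -- the two fibres have equal size
    have hr : ∀ v, f (Sum.inr v) = !f (Sum.inl u₀) := by
      intro v
      by_contra hcon
      have h1 : f (Sum.inr v) = f (Sum.inl u₀) := by
        revert hcon
        cases f (Sum.inr v) <;> cases f (Sum.inl u₀) <;> simp
      let F : Option Y → Y ⊕ Y := fun o => o.elim (q (Sum.inr v)) fun u => q (Sum.inl u)
      have hF : ∀ o, f (F o) = !f (Sum.inl u₀) := by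
        rintro (_ | u)
        · exact (hq _).trans (by rw [h1])
        · exact (hq _).trans (by rw [hl])
      have hFi : Function.Injective F := by
        rintro (_ | u) (_ | w) h
        · rfl
        · exact absurd (q.injective h) (by simp)
        · exact absurd (q.injective h) (by simp)
        · have := q.injective h
          simp only [Sum.inl.injEq] at this
          rw [this]
      have hright : ∀ o, ∃ w, F o = Sum.inr w := by
        intro o
        rcases ho : F o with u | w
        · exfalso
          have := hF o
          rw [ho, hl] at this
          simp at this
        · exact ⟨w, rfl⟩
      choose w hw using hright
      have hwi : Function.Injective w := fun o o' h => hFi (by rw [hw, hw, h])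
      have := Fintype.card_le_of_injective _ hwi
      simp at this
    refine ⟨!f (Sum.inl u₀), ?_⟩
    rintro (u | u)
    · simp [hl]
    · simp [hr]

/-- The subnormalizer in the wreath case. -/
theorem subnormalizer_wreath {k : ℕ} (hY : Fintype.card Y = 2 ^ k) {c y : Equiv.Perm Y}
    (hc : FullCycle c) (hfix : ∃ v, y v = v) {P : Subgroup (Equiv.Perm Y)} (hP : IsPGroup 2 P)
    (hcP : c ∈ P) (hyP : y ∈ P) :
    subnormalizer (Equiv.Perm.sumCongr c y) = (Wr.permOf (subnormalizer y)).range := by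
  obtain ⟨hle1, hle2⟩ := hc.isPGroup_le hY hP hcP hyP
  have hr := Wr.isPGroup_range hP
  have hxr : Equiv.Perm.sumCongr c y ∈ (Wr.permOf P).range := by
    rw [← Wr.perm_false]; exact Wr.perm_mem_range false hcP hyP
  have hy : Two y := Two.of_mem hP hyP
  have hc2 : Two c := Two.of_mem hP hcP
  apply le_antisymm
  · refine subnormalizer_le (Two.of_mem hr hxr) ?_
    rintro g ⟨Q, h1, h2, h3⟩
    have base : ∀ a b, (∀ h ∈ Q, Wr.perm Y ⟨a, b, false⟩ * h * (Wr.perm Y ⟨a, b, false⟩)⁻¹ ∈ Q) →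
        a ∈ subnormalizer y ∧ b ∈ subnormalizer y := by
      intro a b h
      rw [Wr.perm_false] at h
      have h4 : NS (Equiv.Perm.sumCongrHom Y Y (c, y)) (Equiv.Perm.sumCongrHom Y Y (a, b)) :=
        ⟨Q, h1, h2, h⟩
      obtain ⟨h5, h6⟩ := h4.of_prod Equiv.Perm.sumCongrHom_injective
      exact ⟨hle2 h5.mem, h6.mem⟩
    obtain ⟨a, b, s, rfl⟩ := exists_perm_of_NS hY hc hfix h1 h2 h3
    cases s
    · obtain ⟨ha, hb⟩ := base a b h3
      exact Wr.perm_mem_range _ ha hb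
    · have hb : b ∈ subnormalizer y := by
        refine hc.fusion hY hle2 ?_
        have e : Wr.perm Y ⟨a, b, true⟩ * Equiv.Perm.sumCongr c y * (Wr.perm Y ⟨a, b, true⟩)⁻¹ =
            Equiv.Perm.sumCongrHom Y Y (a * y * a⁻¹, b * c * b⁻¹) := by
          change _ = Equiv.Perm.sumCongr (a * y * a⁻¹) (b * c * b⁻¹)
          rw [← Wr.perm_false, ← Wr.perm_false, ← map_inv, ← map_mul, ← map_mul]
          simp [Wr.mul_def, Wr.inv_def]
        have h4 := h3 _ h2
        rw [e] at h4
        let R := (Q.comap (Equiv.Perm.sumCongrHom Y Y)).map (MonoidHom.snd _ _)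
        have hR : IsPGroup 2 R :=
          (h1.comap_of_injective _ Equiv.Perm.sumCongrHom_injective).map _
        have hyR : y ∈ R := ⟨(c, y), h2, rfl⟩
        have hcR : b * c * b⁻¹ ∈ R := ⟨(_, _), h4, rfl⟩
        exact ((hc.conj b).isPGroup_le hY hR hcR hyR).2
      have e : Wr.perm Y ⟨a, b, true⟩ * Wr.perm Y ⟨a, b, true⟩ = Wr.perm Y ⟨a * b, b * a, false⟩ := by
        rw [← map_mul]; simp [Wr.mul_def]
      obtain ⟨hab, _⟩ := base (a * b) (b * a) (by
        rw [← e]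
        intro h hh
        have := h3 _ (h3 _ hh)
        simpa [mul_assoc] using this)
      refine Wr.perm_mem_range _ ?_ hb
      simpa using mul_mem hab (inv_mem hb)
  · have hσ : Wr.perm Y ⟨1, 1, true⟩ ∈ subnormalizer (Equiv.Perm.sumCongr c y) :=
      le_subnormalizer hr hxr (Wr.perm_mem_range true (one_mem _) (one_mem _))
    have hb : ∀ b ∈ subnormalizer y, Wr.perm Y ⟨1, b, false⟩ ∈
        subnormalizer (Equiv.Perm.sumCongr c y) := by
      intro b hb
      rw [Wr.perm_false]
      exact mem_subnormalizer_prod (Equiv.Perm.sumCongrHom Y Y) hc2 hy (one_mem _) hb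
    have hall : ∀ a ∈ subnormalizer y, ∀ b ∈ subnormalizer y, Wr.perm Y ⟨a, b, false⟩ ∈
        subnormalizer (Equiv.Perm.sumCongr c y) := by
      intro a ha b hb'
      have := mul_mem (mul_mem (mul_mem hσ (hb a ha)) hσ) (hb b hb')
      simpa [← map_mul, Wr.mul_def] using this
    rintro _ ⟨⟨a, b, s⟩, rfl⟩
    cases s
    · exact hall a a.2 b b.2
    · have := mul_mem (hall a a.2 b b.2) hσ
      rw [← map_mul] at this
      simp only [Wr.mul_def, Bool.false_eq_true, if_false, mul_one] at this
      exact this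

/-- The subnormalizer in the wreath case, as an abstract group. -/
def wreathEquiv {Y : Type} [Nonempty Y] {x : Equiv.Perm (Y ⊕ Y)} {H : Subgroup (Equiv.Perm Y)}
    (h : subnormalizer x = (Wr.permOf H).range) : Wr H ≃* subnormalizer x :=
  (MonoidHom.ofInjective (Wr.permOf_injective H)).trans (MulEquiv.subgroupCongr h.symm)

lemma wreathEquiv_coe {Y : Type} [Nonempty Y] {x : Equiv.Perm (Y ⊕ Y)} {H : Subgroup (Equiv.Perm Y)}
    (h : subnormalizer x = (Wr.permOf H).range) (w : Wr H) :
    (wreathEquiv h w : Equiv.Perm (Y ⊕ Y)) = Wr.perm Y ⟨w.a, w.b, w.s⟩ := rfl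

end WreathLemma

section SplitLemma
variable {A B Ω : Type} [Fintype A] [DecidableEq A] [Fintype B] [DecidableEq B] [Fintype Ω]
  [DecidableEq Ω]

lemma card_sameCycle_mem_cyc (g : Equiv.Perm Ω) (ω : Ω) :
    ∃ S : Finset Ω, (∀ u, u ∈ S ↔ g.SameCycle ω u) ∧ S.card ∈ cyc g := by
  classical
  obtain ⟨g₁, g₂, h1, -, -, h4⟩ := exists_cycle_split g ω
  have : Nonempty {u // g.SameCycle ω u} := ⟨⟨ω, Equiv.Perm.SameCycle.refl _ _⟩⟩
  refine ⟨Finset.univ.filter fun u => g.SameCycle ω u, by simp, ?_⟩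
  have h5 : cyc g = cyc g₁ + cyc g₂ := by
    rw [← cyc_sumCongr, ← cyc_permCongr (Equiv.sumCompl fun u => g.SameCycle ω u), h4]
  rw [h5, h1.cyc_eq, Fintype.card_subtype]
  simp

/-- Direct products of subgroups acting on a disjoint union. -/
def sumHom (H : Subgroup (Equiv.Perm A)) (K : Subgroup (Equiv.Perm B)) :
    H × K →* Equiv.Perm (A ⊕ B) :=
  (Equiv.Perm.sumCongrHom A B).comp (MonoidHom.prodMap H.subtype K.subtype)

lemma sumHom_injective (H : Subgroup (Equiv.Perm A)) (K : Subgroup (Equiv.Perm B)) :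
    Function.Injective (sumHom H K) := by
  intro p q h
  have := Equiv.Perm.sumCongrHom_injective h
  simp only [MonoidHom.coe_prodMap, Subgroup.coe_subtype, Prod.map, Prod.mk.injEq] at this
  exact Prod.ext (Subtype.ext this.1) (Subtype.ext this.2)

theorem subnormalizer_split {k : ℕ} {a : Equiv.Perm A} {b : Equiv.Perm B} (ha : Two a) (hb : Two b)
    (hA : Fintype.card A < 2 ^ k) (hB : ∀ r ∈ cyc b, 2 ^ k ∣ r) :
    subnormalizer (Equiv.Perm.sumCongr a b) = (sumHom (subnormalizer a) (subnormalizer b)).range := by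
  classical
  have hx : Two (Equiv.Perm.sumCongr a b) := by
    rw [two_iff_cyc, cyc_sumCongr]
    intro r hr
    rcases Multiset.mem_add.1 hr with h | h
    · exact two_iff_cyc.1 ha r h
    · exact two_iff_cyc.1 hb r h
  apply le_antisymm
  · refine subnormalizer_le hx ?_
    rintro g ⟨Q, h1, h2, h3⟩
    let O : A ⊕ B → Finset (A ⊕ B) := fun z => (MulAction.orbit Q z).toFinset
    have hO : ∀ z w, w ∈ O z ↔ ∃ q ∈ Q, q z = w := fun z w => by
      rw [Set.mem_toFinset]
      exact ⟨fun ⟨q, hq⟩ => ⟨q, q.2, hq⟩, fun ⟨q, h, hq⟩ => ⟨⟨q, h⟩, hq⟩⟩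
    have hOcard : ∀ z, ∃ n, (O z).card = 2 ^ n := by
      intro z
      have h2 : Fact (Nat.Prime 2) := ⟨Nat.prime_two⟩
      obtain ⟨n, hn⟩ := h1.card_orbit z
      exact ⟨n, by rw [← hn]; simp [O]⟩
    have hOeq : ∀ z w, w ∈ O z ↔ O w = O z := by
      intro z w
      simp only [O, Set.mem_toFinset, Set.toFinset_inj]
      exact MulAction.orbit_eq_iff.symm
    have hOr : ∀ v, 2 ^ k ∣ (O (Sum.inr v)).card := by
      intro v
      obtain ⟨S, hS, hSc⟩ := card_sameCycle_mem_cyc b v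
      have e1 : S.map ⟨Sum.inr, Sum.inr_injective⟩ ⊆ O (Sum.inr v) := by
        intro z hz
        obtain ⟨u, hu, rfl⟩ := Finset.mem_map.1 hz
        obtain ⟨i, hi⟩ := (hS u).1 hu
        refine (hO _ _).2 ⟨_, zpow_mem h2 i, ?_⟩
        rw [sumCongr_zpow_inl]; simp [hi]
      have e2 := Finset.card_le_card e1
      rw [Finset.card_map] at e2
      have e3 := (Nat.le_of_dvd (cyc_pos hSc) (hB _ hSc)).trans e2
      obtain ⟨n, hn⟩ := hOcard (Sum.inr v)
      rw [hn] at e3 ⊢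
      exact pow_dvd_pow _ ((Nat.pow_le_pow_iff_right (by norm_num : 1 < 2)).1 e3)
    let S : Finset (A ⊕ B) := Finset.univ.filter fun z => 2 ^ k ∣ (O z).card
    have hS : 2 ^ k ∣ S.card := by
      rw [Finset.card_eq_sum_card_image O S]
      refine Finset.dvd_sum fun T hT => ?_
      obtain ⟨z, hz, rfl⟩ := Finset.mem_image.1 hT
      have hz' := (Finset.mem_filter.1 hz).2
      suffices h : (S.filter fun w => O w = O z) = O z by rw [h]; exact hz'
      ext w
      rw [Finset.mem_filter, ← hOeq]
      refine ⟨fun h => h.2, fun h => ⟨?_, h⟩⟩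
      rw [Finset.mem_filter, (hOeq _ _).1 h]
      exact ⟨Finset.mem_univ _, hz'⟩
    have hSl : ∀ u, (Sum.inl u : A ⊕ B) ∉ S := by
      have e1 : S.card = (Finset.univ.filter fun u : A => (Sum.inl u : A ⊕ B) ∈ S).card +
          Fintype.card B := by
        have : S = (Finset.univ.filter fun u : A => (Sum.inl u : A ⊕ B) ∈ S).disjSum
            (Finset.univ : Finset B) := by
          ext z
          rcases z with u | v
          · simp
          · simp [S, hOr]
        conv_lhs => rw [this]
        rw [Finset.card_disjSum, Finset.card_univ]
      have e2 : 2 ^ k ∣ Fintype.card B := by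
        rw [← cyc_sum b]
        exact Multiset.dvd_sum hB
      have e3 := (Nat.dvd_add_left e2).1 (e1 ▸ hS)
      have e4 := (Finset.card_filter_le (Finset.univ : Finset A)
        (fun u : A => (Sum.inl u : A ⊕ B) ∈ S)).trans_lt hA
      have e5 := Nat.eq_zero_of_dvd_of_lt e3 e4
      intro u hu
      rw [Finset.card_eq_zero] at e5
      have : u ∈ (Finset.univ.filter fun u : A => (Sum.inl u : A ⊕ B) ∈ S) := by simpa using hu
      rw [e5] at this
      simp at this
    have hgO : ∀ z, (O (g z)).card = (O z).card := by
      intro z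
      have : O (g z) = (O z).map g.toEmbedding := by
        ext w
        rw [Finset.mem_map, hO]
        constructor
        · rintro ⟨q, hq, rfl⟩
          have hn := le_normalizer_of_conj_mem h3
          refine ⟨(g⁻¹ * q * g) z, (hO _ _).2 ⟨_, ?_, rfl⟩, by simp⟩
          exact (Subgroup.mem_normalizer_iff''.1 hn q).1 hq
        · rintro ⟨w, hw, rfl⟩
          obtain ⟨q, hq, rfl⟩ := (hO _ _).1 hw
          exact ⟨_, h3 q hq, by simp⟩
      rw [this, Finset.card_map]
    have : g ∈ (Equiv.Perm.sumCongrHom A B).range := by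
      refine Equiv.Perm.mem_sumCongrHom_range_of_perm_mapsTo_inl ?_
      rintro _ ⟨u, rfl⟩
      rcases hgu : g (Sum.inl u) with w | w
      · exact ⟨w, rfl⟩
      · exfalso
        apply hSl u
        rw [Finset.mem_filter, ← hgO, hgu]
        exact ⟨Finset.mem_univ _, hOr w⟩
    obtain ⟨⟨s, t⟩, rfl⟩ := this
    have hNS : NS (Equiv.Perm.sumCongrHom A B (a, b)) (Equiv.Perm.sumCongrHom A B (s, t)) :=
      ⟨Q, h1, h2, h3⟩
    obtain ⟨hs, ht⟩ := hNS.of_prod Equiv.Perm.sumCongrHom_injective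
    exact ⟨(⟨s, hs.mem⟩, ⟨t, ht.mem⟩), rfl⟩
  · rintro _ ⟨⟨s, t⟩, rfl⟩
    exact mem_subnormalizer_prod (Equiv.Perm.sumCongrHom A B) ha hb s.2 t.2

/-- The subnormalizer in the split case, as an abstract group. -/
def splitEquiv {x : Equiv.Perm (A ⊕ B)} {H : Subgroup (Equiv.Perm A)} {K : Subgroup (Equiv.Perm B)}
    (h : subnormalizer x = (sumHom H K).range) : H × K ≃* subnormalizer x :=
  (MonoidHom.ofInjective (sumHom_injective H K)).trans (MulEquiv.subgroupCongr h.symm)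

end SplitLemma

section Transpositions
variable {Ω : Type} [Fintype Ω] [DecidableEq Ω]

lemma subnormalizer_eq_top_of_swap {x : Equiv.Perm Ω}
    (h : ∀ u v, Equiv.swap u v ∈ subnormalizer x) : subnormalizer x = ⊤ := by
  rw [eq_top_iff, ← Equiv.Perm.closure_isSwap, Subgroup.closure_le]
  rintro _ ⟨u, v, _, rfl⟩
  exact h u v

lemma swap_trans {H : Subgroup (Equiv.Perm Ω)} {u v w : Ω} (h1 : Equiv.swap u v ∈ H)
    (h2 : Equiv.swap v w ∈ H) : Equiv.swap u w ∈ H := by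
  by_cases huw : u = w
  · subst huw; rw [Equiv.swap_self]; exact H.one_mem
  by_cases huv : u = v
  · subst huv; exact h2
  have := mul_mem (mul_mem h2 h1) h2
  rwa [Equiv.swap_mul_swap_mul_swap huv huw, Equiv.swap_comm] at this

lemma swap_conj_mem {H : Subgroup (Equiv.Perm Ω)} {u v : Ω} {g : Equiv.Perm Ω} (hg : g ∈ H)
    (h : Equiv.swap u v ∈ H) : Equiv.swap (g u) (g v) ∈ H := by
  rw [Equiv.swap_apply_apply]
  exact mul_mem (mul_mem hg h) (inv_mem hg)

/-- Transpositions commuting with an involution centralizing `x` lie in the subnormalizer. -/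
lemma swap_involution_mem {x j : Equiv.Perm Ω} (hx : Two x) (hj : j * j = 1) (hxj : x * j = j * x)
    (u : Ω) : Equiv.swap u (j u) ∈ subnormalizer x := by
  have hjj : ∀ w, j (j w) = w := fun w => by rw [← Equiv.Perm.mul_apply, hj, Equiv.Perm.one_apply]
  have hxw : ∀ w, x (j w) = j (x w) := fun w => DFunLike.congr_fun hxj w
  let E : Subgroup (Equiv.Perm Ω) :=
    { carrier := {σ | ∀ w, (σ w = w ∧ σ (j w) = j w) ∨ (σ w = j w ∧ σ (j w) = w)}
      one_mem' := fun w => by simp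
      mul_mem' := by
        intro σ τ hσ hτ w
        simp only [Equiv.Perm.mul_apply]
        rcases hσ w with ⟨a1, a2⟩ | ⟨a1, a2⟩ <;> rcases hτ w with ⟨b1, b2⟩ | ⟨b1, b2⟩ <;>
          simp [a1, a2, b1, b2]
      inv_mem' := by
        intro σ hσ w
        simp only [Equiv.Perm.inv_eq_iff_eq]
        rcases hσ w with ⟨a1, a2⟩ | ⟨a1, a2⟩
        · exact Or.inl ⟨a1.symm, a2.symm⟩
        · exact Or.inr ⟨a2.symm, a1.symm⟩ }
  have hE : IsPGroup 2 E := by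
    rintro ⟨σ, hσ⟩
    refine ⟨1, Subtype.ext (Equiv.ext fun w => ?_)⟩
    change (σ ^ 2 ^ 1) w = w
    rw [pow_one, pow_two, Equiv.Perm.mul_apply]
    rcases hσ w with ⟨a1, a2⟩ | ⟨a1, a2⟩ <;> simp [a1, a2]
  have hxE : x ∈ Subgroup.normalizer (E : Set (Equiv.Perm Ω)) := by
    refine le_normalizer_of_conj_mem fun σ hσ w => ?_
    have e : x⁻¹ (j w) = j (x⁻¹ w) := by
      apply x.injective
      rw [hxw]; simp
    rcases hσ (x⁻¹ w) with ⟨a1, a2⟩ | ⟨a1, a2⟩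
    · left
      simp only [Equiv.Perm.mul_apply, e, a1, a2, hxw]
      simp
    · right
      simp only [Equiv.Perm.mul_apply, e, a1, a2, hxw]
      simp
  have hP : IsPGroup 2 (Subgroup.zpowers x ⊔ E : Subgroup _) :=
    IsPGroup.to_sup_of_normal_right' hx hE (Subgroup.zpowers_le.2 hxE)
  refine le_subnormalizer hP (le_sup_left (b := E) (Subgroup.mem_zpowers x)) (le_sup_right (a := Subgroup.zpowers x) ?_)
  intro w
  by_cases h1 : w = u
  · subst h1; right; simp
  · by_cases h2 : w = j u
    · subst h2; right; simp [hjj]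
    · left
      have h3 : j w ≠ u := fun h => h2 (by rw [← h, hjj])
      have h4 : j w ≠ j u := fun h => h1 (j.injective h)
      exact ⟨Equiv.swap_apply_of_ne_of_ne h1 h2, Equiv.swap_apply_of_ne_of_ne h3 h4⟩

end Transpositions

section Multisets

lemma exists_le_sum_eq_two_pow (k : ℕ) (m : Multiset ℕ) (h2 : ∀ r ∈ m, ∃ j, r = 2 ^ j)
    (hle : ∀ r ∈ m, r ≤ 2 ^ k) (hs : 2 ^ k ≤ m.sum) : ∃ T ≤ m, T.sum = 2 ^ k := by
  induction k generalizing m with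
  | zero =>
    have : ∃ r, r ∈ m := by
      by_contra! h
      rw [Multiset.eq_zero_of_forall_notMem h] at hs
      simp at hs
    obtain ⟨r, hr⟩ := this
    obtain ⟨j, rfl⟩ := h2 r hr
    have h1 := hle _ hr
    have h3 : 0 < 2 ^ j := by positivity
    refine ⟨{2 ^ j}, Multiset.singleton_le.2 hr, ?_⟩
    rw [Multiset.sum_singleton]
    omega
  | succ k ih =>
    by_cases hk : 2 ^ (k + 1) ∈ m
    · exact ⟨{2 ^ (k + 1)}, Multiset.singleton_le.2 hk, by simp⟩
    have hle' : ∀ r ∈ m, r ≤ 2 ^ k := by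
      intro r hr
      have h1 := hle r hr
      obtain ⟨j, rfl⟩ := h2 r hr
      have h3 := (Nat.pow_le_pow_iff_right (by norm_num : 1 < 2)).1 h1
      refine Nat.pow_le_pow_right (by norm_num) ?_
      rcases Nat.lt_or_ge j (k + 1) with h | h
      · omega
      · have : j = k + 1 := by omega
        subst this
        exact absurd hr hk
    rw [pow_succ] at hs
    obtain ⟨T, hT, hTs⟩ := ih m h2 hle' (by omega)
    obtain ⟨R, rfl⟩ := Multiset.le_iff_exists_add.1 hT
    rw [Multiset.sum_add] at hs
    obtain ⟨S, hS, hSs⟩ := ih R (fun r hr => h2 r (Multiset.mem_add.2 (Or.inr hr)))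
      (fun r hr => hle' r (Multiset.mem_add.2 (Or.inr hr))) (by omega)
    exact ⟨T + S, by gcongr, by rw [Multiset.sum_add, hTs, hSs]; ring⟩

end Multisets

section Models
variable {Y Z Ω : Type} [Fintype Y] [DecidableEq Y] [Fintype Z] [DecidableEq Z]
  [Fintype Ω] [DecidableEq Ω]

lemma Wr.perm_sumSumSumComm (c y : Equiv.Perm Y) (c' y' : Equiv.Perm Z) :
    (Equiv.sumSumSumComm Y Y Z Z).permCongr
      (Equiv.Perm.sumCongr (Wr.perm Y ⟨c, y, true⟩) (Wr.perm Z ⟨c', y', true⟩)) =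
      Wr.perm (Y ⊕ Z) ⟨Equiv.Perm.sumCongr c c', Equiv.Perm.sumCongr y y', true⟩ := by
  ext z
  rcases z with (z | z) | (z | z) <;>
    simp [Equiv.permCongr_apply, Wr.perm_true_inl, Wr.perm_true_inr]

/-- A multiset of powers of two is the cycle type of a permutation, whose twisted double has
the doubled cycle type. -/
lemma exists_perm_cyc (m : Multiset ℕ) (h2 : ∀ r ∈ m, ∃ j, r = 2 ^ j) :
    ∃ (Y : Type) (_ : Fintype Y) (_ : DecidableEq Y) (y : Equiv.Perm Y), cyc y = m ∧
      cyc (Wr.perm Y ⟨y, 1, true⟩) = m.map (2 * ·) := by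
  induction m using Multiset.induction_on with
  | empty =>
    refine ⟨Empty, inferInstance, inferInstance, 1, ?_, ?_⟩
    · exact Multiset.eq_zero_of_forall_notMem fun r hr =>
        absurd (Multiset.le_sum_of_mem hr) (by rw [cyc_sum]; have := cyc_pos hr; simp; omega)
    · exact Multiset.eq_zero_of_forall_notMem fun r hr =>
        absurd (Multiset.le_sum_of_mem hr) (by rw [cyc_sum]; have := cyc_pos hr; simp; omega)
  | cons r m ih =>
    obtain ⟨Z, _, _, z, h1, h3⟩ := ih fun r hr => h2 r (Multiset.mem_cons_of_mem hr)
    obtain ⟨j, rfl⟩ := h2 r (Multiset.mem_cons_self _ _)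
    obtain ⟨Y, _, _, c, hY, hc⟩ := exists_fullCycle j
    have : Nonempty Y := Fintype.card_pos_iff.1 (by rw [hY]; positivity)
    refine ⟨Y ⊕ Z, inferInstance, inferInstance, Equiv.Perm.sumCongr c z, ?_, ?_⟩
    · rw [cyc_sumCongr, h1, hc.cyc_eq, hY, Multiset.singleton_add]
    · have := Wr.perm_sumSumSumComm c 1 z 1
      rw [Equiv.Perm.sumCongr_one] at this
      rw [← this, cyc_permCongr, cyc_sumCongr, h3, hc.wreath.cyc_eq, Fintype.card_sum, hY,
        Multiset.singleton_add, Multiset.map_cons, two_mul]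

lemma Two.of_cyc_eq {x : Equiv.Perm Y} {y : Equiv.Perm Z} (hx : Two x) (h : cyc x = cyc y) :
    Two y := by
  rw [two_iff_cyc] at hx ⊢
  rwa [← h]

lemma Two.sumCongr {x : Equiv.Perm Y} {y : Equiv.Perm Z} (hx : Two x) (hy : Two y) :
    Two (Equiv.Perm.sumCongr x y) := by
  rw [two_iff_cyc] at hx hy ⊢
  rw [cyc_sumCongr]
  intro r hr
  rcases Multiset.mem_add.1 hr with h | h
  · exact hx r h
  · exact hy r h

lemma mem_subnormalizer_permCongr {x : Equiv.Perm Y} (hx : Two x) (e : Y ≃ Z) {g : Equiv.Perm Y}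
    (hg : g ∈ subnormalizer x) : e.permCongr g ∈ subnormalizer (e.permCongr x) := by
  have := subnormalizer_map e.permCongrHom hx
  change _ = subnormalizer (e.permCongr x) at this
  rw [← this]
  exact ⟨g, hg, rfl⟩

/-- The group is transitive on points. -/
def PointTransitive (H : Subgroup (Equiv.Perm Ω)) : Prop := ∀ u v, ∃ g ∈ H, g u = v

lemma FullCycle.pointTransitive {c : Equiv.Perm Ω} (h : FullCycle c) {H : Subgroup (Equiv.Perm Ω)}
    (hc : c ∈ H) : PointTransitive H := fun u v => by
  obtain ⟨i, hi⟩ := h u v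
  exact ⟨_, zpow_mem hc i, hi⟩

lemma PointTransitive.of_cyc_eq {x : Equiv.Perm Y} {y : Equiv.Perm Z} (hx : Two x) (h : cyc x = cyc y)
    (ht : PointTransitive (subnormalizer x)) : PointTransitive (subnormalizer y) := by
  obtain ⟨e, rfl⟩ := exists_equiv_of_cyc_eq h
  intro u v
  obtain ⟨g, hg, he⟩ := ht (e.symm u) (e.symm v)
  exact ⟨_, mem_subnormalizer_permCongr hx e hg, by simp [Equiv.permCongr_apply, he]⟩

lemma subnormalizer_eq_top_of_cyc_eq {x : Equiv.Perm Y} {y : Equiv.Perm Z} (hx : Two x)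
    (h : cyc x = cyc y) (ht : subnormalizer x = ⊤) : subnormalizer y = ⊤ := by
  obtain ⟨e, rfl⟩ := exists_equiv_of_cyc_eq h
  rw [eq_top_iff]
  intro g _
  have := mem_subnormalizer_permCongr hx e (g := e.symm.permCongr g) (by rw [ht]; trivial)
  rwa [← Equiv.permCongr_symm, Equiv.apply_symm_apply] at this

/-- Two transitive parts linked by a transposition generate the symmetric group. -/
lemma subnormalizer_eq_top_of_link {a : Equiv.Perm Y} {b : Equiv.Perm Z} (ha : Two a) (hb : Two b)
    (hta : PointTransitive (subnormalizer a)) (htb : PointTransitive (subnormalizer b)) {u : Y} {v : Z}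
    (h : Equiv.swap (Sum.inl u) (Sum.inr v) ∈ subnormalizer (Equiv.Perm.sumCongr a b)) :
    subnormalizer (Equiv.Perm.sumCongr a b) = ⊤ := by
  have h1 : ∀ u' v', Equiv.swap (Sum.inl u') (Sum.inr v') ∈
      subnormalizer (Equiv.Perm.sumCongr a b) := by
    intro u' v'
    obtain ⟨g, hg, rfl⟩ := hta u u'
    obtain ⟨g', hg', rfl⟩ := htb v v'
    exact swap_conj_mem
      (mem_subnormalizer_prod (Equiv.Perm.sumCongrHom Y Z) ha hb hg hg') h
  have h2 : ∀ v' u', Equiv.swap (Sum.inr v') (Sum.inl u') ∈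
      subnormalizer (Equiv.Perm.sumCongr a b) := fun v' u' => by
    rw [Equiv.swap_comm]; exact h1 u' v'
  refine subnormalizer_eq_top_of_swap ?_
  rintro (p | p) (q | q)
  · exact swap_trans (h1 p v) (h2 v q)
  · exact h1 p q
  · exact h2 p q
  · exact swap_trans (h2 p u) (h1 u q)

lemma subnormalizer_eq_top_of_move {c : Equiv.Perm Y} {y : Equiv.Perm Z} {x : Equiv.Perm Ω}
    (hc : FullCycle c) (hc2 : Two c) (hy2 : Two y) (hy : subnormalizer y = ⊤) (e : Y ⊕ Z ≃ Ω)
    (he : e.permCongr (Equiv.Perm.sumCongr c y) = x) {g : Equiv.Perm Ω} (hg : g ∈ subnormalizer x)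
    {p q v : Z} {u : Y} (hp : g (e (Sum.inr p)) = e (Sum.inl u))
    (hq : g (e (Sum.inr q)) = e (Sum.inr v)) :
    subnormalizer (Equiv.Perm.sumCongr c y) = ⊤ := by
  have hx2 : Two x := Two.of_cyc_eq (hc2.sumCongr hy2) (by rw [← he, cyc_permCongr])
  have he' : Equiv.Perm.sumCongr c y = e.symm.permCongr x := by
    rw [← he, ← Equiv.permCongr_symm, Equiv.symm_apply_apply]
  have hg' := mem_subnormalizer_permCongr hx2 e.symm hg
  rw [← he'] at hg'
  have hs : Equiv.Perm.sumCongr (1 : Equiv.Perm Y) (Equiv.swap p q) ∈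
      subnormalizer (Equiv.Perm.sumCongr c y) :=
    mem_subnormalizer_prod (Equiv.Perm.sumCongrHom Y Z) hc2 hy2 (one_mem _) (by rw [hy]; trivial)
  rw [Equiv.Perm.sumCongr_one_swap] at hs
  have := swap_conj_mem hg' hs
  simp only [Equiv.permCongr_apply, Equiv.symm_symm, hp, hq, Equiv.symm_apply_apply] at this
  refine subnormalizer_eq_top_of_link hc2 hy2 (hc.pointTransitive (mem_subnormalizer_self c)) ?_ this
  intro a b
  exact ⟨Equiv.swap a b, by rw [hy]; trivial, Equiv.swap_apply_left _ _⟩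

end Models

section Classification
variable {Y Z Ω L : Type} [Fintype Y] [DecidableEq Y] [Fintype Z] [DecidableEq Z]
  [Fintype Ω] [DecidableEq Ω] [Fintype L] [DecidableEq L]

/-- The subnormalizer of `x` is obtained from a smaller one by the wreath construction. -/
def WreathType (x : Equiv.Perm Ω) : Prop :=
  ∃ (k : ℕ) (c : Equiv.Perm Ω) (hc : c ∈ subnormalizer x) (P : Subgroup (Equiv.Perm Ω)),
    Fintype.card Ω = 2 ^ k ∧ IsPGroup 2 P ∧ x ∈ P ∧ c ∈ P ∧ FullCycle c ∧ (∃ v, x v = v) ∧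
    (∃ r ∈ cyc x, 2 * r = 2 ^ k) ∧
    ∀ N, 2 * 2 ^ k ≤ N → LabReal N (2 ^ k) (⟨x, mem_subnormalizer_self x⟩ : subnormalizer x)
      ⟨c, hc⟩ (cl x) [2 ^ k]

lemma FullCycle.cl_perm [Nonempty Ω] {c : Equiv.Perm Ω} (h : FullCycle c) {n : ℕ}
    (hn : Fintype.card Ω = n) : (cl c).Perm [n] := by
  rw [← Multiset.coe_eq_coe, coe_cl, h.cyc_eq, hn]
  rfl

/-- The wreath construction. -/
lemma wreathType_sumCongr {k : ℕ} (hL : Fintype.card L = 2 ^ k) {c y : Equiv.Perm L}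
    {P : Subgroup (Equiv.Perm L)} (hP : IsPGroup 2 P) (hyP : y ∈ P) (hcP : c ∈ P) (hc : FullCycle c)
    (hfix : ∃ v, y v = v) (hlt : ∀ r ∈ cyc y, r < 2 ^ k) (hcs : c ∈ subnormalizer y)
    (hg : ∀ N, 2 * 2 ^ k ≤ N → LabReal N (2 ^ k) (⟨y, mem_subnormalizer_self y⟩ : subnormalizer y)
      ⟨c, hcs⟩ (cl y) [2 ^ k]) : WreathType (Equiv.Perm.sumCongr c y) := by
  classical
  have : Nonempty L := Fintype.card_pos_iff.1 (by rw [hL]; positivity)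
  have hsub := subnormalizer_wreath hL hc hfix hP hcP hyP
  have hfin : Fintype (subnormalizer y) := Fintype.ofFinite _
  have hfin' : Fintype (subnormalizer (Equiv.Perm.sumCongr c y)) := Fintype.ofFinite _
  refine ⟨k + 1, Wr.perm L ⟨c, 1, true⟩, ?_, (Wr.permOf P).range, ?_, Wr.isPGroup_range hP, ?_, ?_,
    hc.wreath, ?_, ?_, ?_⟩
  · rw [hsub]
    exact Wr.perm_mem_range true hcs (one_mem _)
  · rw [Fintype.card_sum, hL]; ring
  · rw [← Wr.perm_false]
    exact Wr.perm_mem_range false hcP hyP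
  · exact Wr.perm_mem_range true hcP (one_mem _)
  · obtain ⟨v, hv⟩ := hfix
    exact ⟨Sum.inr v, by simp [hv]⟩
  · exact ⟨2 ^ k, by rw [cyc_sumCongr, hc.cyc_eq, hL]; simp, by ring⟩
  · intro N hN
    rw [pow_succ'] at hN ⊢
    have h1 := LabReal.wreath (by omega) (by rw [cl_sum, hL]) (cl_pos y)
      (fun h => (hlt _ (by rw [← coe_cl]; exact h)).ne rfl) (hg N (by omega))
    have h2 := Realizes.congr h1 (wreathEquiv hsub)
    have e1 : wreathEquiv hsub ⟨⟨c, hcs⟩, ⟨y, mem_subnormalizer_self y⟩, false⟩ =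
        ⟨Equiv.Perm.sumCongr c y, mem_subnormalizer_self _⟩ := by
      apply Subtype.ext
      rw [wreathEquiv_coe]
      exact Wr.perm_false c y
    rw [e1] at h2
    refine LabReal.perm_left h2 ?_ (List.Perm.refl _)
    rw [← Multiset.coe_eq_coe, coe_cl, cyc_sumCongr, hc.cyc_eq, hL, ← coe_cl y]
    rfl

lemma labReal_top {x y c : Equiv.Perm Ω} (hx : subnormalizer x = ⊤) {N n : ℕ}
    (hn : Fintype.card Ω = n) (hN : 2 * n ≤ N) (hy : y ∈ subnormalizer x)
    (hc : c ∈ subnormalizer x) :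
    LabReal N n (⟨y, hy⟩ : subnormalizer x) ⟨c, hc⟩ (cl y) (cl c) := by
  classical
  have hfin' : Fintype (subnormalizer x) := Fintype.ofFinite _
  exact Realizes.congr (labReal_perm hn hN y c)
    (Subgroup.topEquiv.symm.trans (MulEquiv.subgroupCongr hx.symm))

/-- The possible subnormalizers of a permutation that does not split. -/
def Tame (x : Equiv.Perm Ω) : Prop := subnormalizer x = ⊤ ∨ FullCycle x ∨ WreathType x

lemma Tame.pointTransitive {x : Equiv.Perm Ω} (h : Tame x) : PointTransitive (subnormalizer x) := by
  rcases h with h | h | ⟨k, c, hc, P, -, -, -, -, hf, -⟩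
  · exact fun u v => ⟨Equiv.swap u v, by rw [h]; trivial, Equiv.swap_apply_left _ _⟩
  · exact h.pointTransitive (mem_subnormalizer_self x)
  · exact hf.pointTransitive hc

/-- Two equal longest cycles. -/
lemma subnormalizer_eq_top_of_repeat [Nonempty L] {c : Equiv.Perm L} {z : Equiv.Perm Z}
    (hc : FullCycle c) (hc2 : Two c) (hz : Two z)
    (ht : PointTransitive (subnormalizer (Equiv.Perm.sumCongr c z))) :
    subnormalizer (Equiv.Perm.sumCongr c (Equiv.Perm.sumCongr c z)) = ⊤ := by
  have u : L := Classical.arbitrary L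
  let j : Equiv.Perm (L ⊕ (L ⊕ Z)) :=
    (Equiv.sumAssoc L L Z).permCongr (Equiv.Perm.sumCongr (Equiv.sumComm L L) 1)
  have hj : j * j = 1 := by
    ext w
    rcases w with w | w | w <;> simp [j, Equiv.permCongr_apply]
  have hxj : Equiv.Perm.sumCongr c (Equiv.Perm.sumCongr c z) * j =
      j * Equiv.Perm.sumCongr c (Equiv.Perm.sumCongr c z) := by
    ext w
    rcases w with w | w | w <;> simp [j, Equiv.permCongr_apply]
  have h := swap_involution_mem (hc2.sumCongr (hc2.sumCongr hz)) hj hxj (Sum.inl u)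
  have hju : j (Sum.inl u) = Sum.inr (Sum.inl u) := by simp [j, Equiv.permCongr_apply]
  rw [hju] at h
  exact subnormalizer_eq_top_of_link hc2 (hc2.sumCongr hz)
    (hc.pointTransitive (mem_subnormalizer_self c)) ht h

/-- A proper part of the smaller cycles fills up the longest one. -/
lemma subnormalizer_eq_top_of_fill [Nonempty L] [Nonempty Z] {c l : Equiv.Perm L} {z : Equiv.Perm Z}
    (hc : FullCycle c) (hz : Two z) {P : Subgroup (Equiv.Perm L)} (hP : IsPGroup 2 P) (hcP : c ∈ P)
    (hlP : l ∈ P) (ht : subnormalizer (Equiv.Perm.sumCongr l z) = ⊤) :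
    subnormalizer (Equiv.Perm.sumCongr c (Equiv.Perm.sumCongr l z)) = ⊤ := by
  have u : L := Classical.arbitrary L
  have w : Z := Classical.arbitrary Z
  have hc2 := Two.of_mem hP hcP
  have hl2 := Two.of_mem hP hlP
  have hg : Wr.perm L ⟨1, 1, true⟩ ∈ subnormalizer (Equiv.Perm.sumCongr c l) := by
    refine le_subnormalizer (Wr.isPGroup_range hP) ?_ (Wr.perm_mem_range true (one_mem P) (one_mem P))
    rw [← Wr.perm_false]
    exact Wr.perm_mem_range false hcP hlP
  refine subnormalizer_eq_top_of_move (p := Sum.inl u) (q := Sum.inr w) (u := u) (v := Sum.inr w)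
    hc hc2 (hl2.sumCongr hz) ht (Equiv.sumAssoc L L Z).symm ?_
    (mem_subnormalizer_prod (Equiv.Perm.sumCongrHom (L ⊕ L) Z) (hc2.sumCongr hl2) hz hg (one_mem _))
    ?_ ?_
  · ext v
    rcases v with (v | v) | v <;> simp [Equiv.permCongr_apply]
  · simp [Wr.perm_true_inr]
  · simp

/-- All cycles have even length. -/
lemma subnormalizer_eq_top_of_even [Nonempty L] {c y : Equiv.Perm L} (hc : FullCycle c)
    {P : Subgroup (Equiv.Perm L)} (hP : IsPGroup 2 P) (hcP : c ∈ P) (hyP : y ∈ P)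
    (ht : subnormalizer (Wr.perm L ⟨y, 1, true⟩) = ⊤) :
    subnormalizer (Equiv.Perm.sumCongr (Wr.perm L ⟨c, 1, true⟩) (Wr.perm L ⟨y, 1, true⟩)) = ⊤ := by
  have u : L := Classical.arbitrary L
  have hR := Wr.isPGroup_range hP
  have hg : Wr.perm (L ⊕ L) ⟨Wr.perm L ⟨1, 1, true⟩, 1, false⟩ ∈
      subnormalizer (Wr.perm (L ⊕ L) ⟨Equiv.Perm.sumCongr c y, 1, true⟩) := by
    refine le_subnormalizer (Wr.isPGroup_range hR) ?_
      (Wr.perm_mem_range false (Wr.perm_mem_range true (one_mem P) (one_mem P)) (one_mem _))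
    refine Wr.perm_mem_range true ?_ (one_mem _)
    rw [← Wr.perm_false]
    exact Wr.perm_mem_range false hcP hyP
  refine subnormalizer_eq_top_of_move (p := Sum.inl u) (q := Sum.inr u) (u := Sum.inl u)
    (v := Sum.inr u) hc.wreath (Two.of_mem hR (Wr.perm_mem_range true hcP (one_mem P)))
    (Two.of_mem hR (Wr.perm_mem_range true hyP (one_mem P))) ht (Equiv.sumSumSumComm L L L L) ?_
    hg ?_ ?_
  · rw [Wr.perm_sumSumSumComm, Equiv.Perm.sumCongr_one]
  · simp [Wr.perm_false, Wr.perm_true_inr]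
  · simp [Wr.perm_false]

end Classification

/-- No power of two separates the small parts from the large ones. -/
def Unsplit (m : Multiset ℕ) : Prop :=
  ∀ k : ℕ, (m.filter (· < 2 ^ k)) = 0 ∨ 2 ^ k ≤ (m.filter (· < 2 ^ k)).sum ∨
    m.filter (· < 2 ^ k) = m

lemma exists_fixed_of_one_mem_cyc {Y : Type} [Fintype Y] [DecidableEq Y] {y : Equiv.Perm Y}
    (h : 1 ∈ cyc y) : ∃ v, y v = v := by
  rcases Multiset.mem_add.1 h with h | h
  · have := Equiv.Perm.two_le_of_mem_cycleType h
    omega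
  · rw [Multiset.mem_replicate] at h
    by_contra! hv
    have : y.support = Finset.univ := by
      ext v
      simp [hv v]
    rw [this, Finset.card_univ] at h
    omega

lemma Tame.exists_model {Y : Type} [Fintype Y] [DecidableEq Y] {y : Equiv.Perm Y} (h : Tame y)
    {m : Multiset ℕ} (hy : cyc y = m) :
    ∃ (Y : Type) (_ : Fintype Y) (_ : DecidableEq Y) (y : Equiv.Perm Y), cyc y = m ∧ Tame y :=
  ⟨Y, _, _, y, hy, h⟩

theorem exists_tame (m : Multiset ℕ) (h2 : ∀ r ∈ m, ∃ j, r = 2 ^ j) (hm : Unsplit m) :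
    ∃ (Y : Type) (_ : Fintype Y) (_ : DecidableEq Y) (y : Equiv.Perm Y), cyc y = m ∧ Tame y := by
  induction hn : Multiset.card m generalizing m with
  | zero =>
    obtain ⟨Y, _, _, y, hy, -⟩ := exists_perm_cyc m h2
    refine ⟨Y, _, _, y, hy, Or.inl ?_⟩
    have : Fintype.card Y = 0 := by
      rw [← cyc_sum y, hy, Multiset.card_eq_zero.1 hn, Multiset.sum_zero]
    have := Fintype.card_eq_zero_iff.1 this
    exact Subsingleton.elim _ _
  | succ n ih =>
    have hne : m ≠ 0 := by
      rintro rfl; simp at hn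
    obtain ⟨Q, hQm, hQ⟩ : ∃ Q ∈ m, ∀ r ∈ m, r ≤ Q := by
      obtain ⟨r, hr⟩ := Multiset.exists_mem_of_ne_zero hne
      obtain ⟨Q, hQ, hmax⟩ := m.toFinset.exists_max_image id ⟨r, by simpa using hr⟩
      exact ⟨Q, by simpa using hQ, fun s hs => hmax s (by simpa using hs)⟩
    obtain ⟨k, rfl⟩ := h2 Q hQm
    obtain ⟨m', rfl⟩ := Multiset.exists_cons_of_mem hQm
    have h2' : ∀ r ∈ m', ∃ j, r = 2 ^ j := fun r hr => h2 r (Multiset.mem_cons_of_mem hr)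
    have hle : ∀ r ∈ m', r ≤ 2 ^ k := fun r hr => hQ r (Multiset.mem_cons_of_mem hr)
    have hf : ∀ j, 2 ^ j ≤ 2 ^ k →
        (2 ^ k ::ₘ m').filter (· < 2 ^ j) = m'.filter (· < 2 ^ j) := fun j h =>
      Multiset.filter_cons_of_neg (p := (· < 2 ^ j)) _ (not_lt.2 h)
    have hm' : Unsplit m' := by
      intro j
      rcases lt_or_ge (2 ^ k) (2 ^ j) with h | h
      · exact Or.inr (Or.inr (Multiset.filter_eq_self.2 fun r hr => (hle r hr).trans_lt h))
      · rcases hm j with h' | h' | h'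
        · rw [hf j h] at h'
          exact Or.inl h'
        · rw [hf j h] at h'
          exact Or.inr (Or.inl h')
        · exact absurd (Multiset.filter_eq_self.1 h' _ (Multiset.mem_cons_self _ _)) (not_lt.2 h)
    have hlt : 2 ^ k ∉ m' → ∀ r ∈ m', r < 2 ^ k := fun h r hr =>
      lt_of_le_of_ne (hle r hr) fun e => h (e ▸ hr)
    have hsum : 2 ^ k ∉ m' → m' = 0 ∨ 2 ^ k ≤ m'.sum := by
      intro h
      have := hm k
      rw [hf k le_rfl, Multiset.filter_eq_self.2 (hlt h)] at this
      rcases this with h' | h' | h'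
      · exact Or.inl h'
      · exact Or.inr h'
      · exact absurd (congrArg Multiset.card h') (by simp)
    obtain ⟨Y, _, _, y, hy, ht⟩ := ih m' h2' hm' (by simpa using hn)
    have hy2 : Two y := two_iff_cyc.2 (by rwa [hy])
    by_cases hmem : 2 ^ k ∈ m'
    · obtain ⟨z', rfl⟩ := Multiset.exists_cons_of_mem hmem
      obtain ⟨Z, _, _, z, hz, -⟩ := exists_perm_cyc z' fun r hr => h2' r (Multiset.mem_cons_of_mem hr)
      have hz2 : Two z := two_iff_cyc.2 (by rw [hz]; exact fun r hr => h2' r (Multiset.mem_cons_of_mem hr))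
      obtain ⟨L, _, _, c, hL, hc⟩ := exists_fullCycle k
      have : Nonempty L := Fintype.card_pos_iff.1 (by rw [hL]; positivity)
      have hcz : cyc (Equiv.Perm.sumCongr c z) = 2 ^ k ::ₘ z' := by
        rw [cyc_sumCongr, hz, hc.cyc_eq, hL, Multiset.singleton_add]
      refine Tame.exists_model (Or.inl (subnormalizer_eq_top_of_repeat hc (hc.two hL) hz2
        (ht.pointTransitive.of_cyc_eq hy2 (hy.trans hcz.symm)))) ?_
      rw [cyc_sumCongr, hcz, hc.cyc_eq, hL, Multiset.singleton_add]
    have hlt := hlt hmem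
    rcases hsum hmem with rfl | hsum
    · obtain ⟨L, _, _, c, hL, hc⟩ := exists_fullCycle k
      have : Nonempty L := Fintype.card_pos_iff.1 (by rw [hL]; positivity)
      exact ⟨L, _, _, c, by rw [hc.cyc_eq, hL]; rfl, Or.inr (Or.inl hc)⟩
    have hYs : Fintype.card Y = m'.sum := by rw [← cyc_sum y, hy]
    have hYne : Nonempty Y := Fintype.card_pos_iff.1 (by rw [hYs]; exact lt_of_lt_of_le (by positivity) hsum)
    rcases ht with ht | ht | ht
    · obtain ⟨T, hT, hTs⟩ := exists_le_sum_eq_two_pow k m' h2' hle hsum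
      obtain ⟨R, rfl⟩ := Multiset.le_iff_exists_add.1 hT
      have hT2 : ∀ r ∈ T, ∃ j, r = 2 ^ j := fun r hr => h2' r (Multiset.mem_add.2 (Or.inl hr))
      have hR2 : ∀ r ∈ R, ∃ j, r = 2 ^ j := fun r hr => h2' r (Multiset.mem_add.2 (Or.inr hr))
      obtain ⟨L, _, _, l, hl, -⟩ := exists_perm_cyc T hT2
      have hL : Fintype.card L = 2 ^ k := by rw [← cyc_sum l, hl, hTs]
      have : Nonempty L := Fintype.card_pos_iff.1 (by rw [hL]; positivity)
      obtain ⟨P, hP, hlP, c, hcP, hc⟩ := exists_pgroup_fullCycle hL (two_iff_cyc.2 (by rwa [hl]))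
      by_cases hR : R = 0
      · subst hR
        rw [add_zero] at *
        have htl : subnormalizer l = ⊤ := subnormalizer_eq_top_of_cyc_eq hy2 (hy.trans hl.symm) ht
        by_cases h1 : 1 ∈ T
        · refine Tame.exists_model (y := Equiv.Perm.sumCongr c l) (Or.inr (Or.inr (wreathType_sumCongr hL hP
            hlP hcP hc ?_ (by rwa [hl]) (by rw [htl]; trivial) fun N hN => ?_))) ?_
          · rw [← hl] at h1
            exact exists_fixed_of_one_mem_cyc h1
          · exact LabReal.perm_left (labReal_top htl hL hN _ _) (List.Perm.refl _) (hc.cl_perm hL)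
          · rw [cyc_sumCongr, hl, hc.cyc_eq, hL, Multiset.singleton_add]
        · have hT0 : (T.map (· / 2)).map (2 * ·) = T := by
            rw [Multiset.map_map]
            refine (Multiset.map_congr rfl fun r hr => ?_).trans (Multiset.map_id _)
            obtain ⟨j, rfl⟩ := hT2 r hr
            cases j with
            | zero => exact absurd hr h1
            | succ j => simp [pow_succ']
          obtain ⟨L', _, _, y', hy', hy''⟩ := exists_perm_cyc (T.map (· / 2)) (by
            intro r hr
            obtain ⟨s, hs, rfl⟩ := Multiset.mem_map.1 hr
            obtain ⟨j, rfl⟩ := hT2 s hs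
            cases j with
            | zero => exact absurd hs h1
            | succ j => exact ⟨j, by simp [pow_succ']⟩)
          rw [hT0] at hy''
          have hL' : 2 * Fintype.card L' = 2 ^ k := by
            rw [← hTs, ← hy'', cyc_sum, Fintype.card_sum, two_mul]
          cases k with
          | zero => omega
          | succ k =>
            rw [pow_succ'] at hL'
            have hL' : Fintype.card L' = 2 ^ k := by omega
            have : Nonempty L' := Fintype.card_pos_iff.1 (by rw [hL']; positivity)
            obtain ⟨P, hP, hyP, c, hcP, hc⟩ := exists_pgroup_fullCycle hL' (two_iff_cyc.2 (by
              rw [hy']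
              intro r hr
              obtain ⟨s, hs, rfl⟩ := Multiset.mem_map.1 hr
              obtain ⟨j, rfl⟩ := hT2 s hs
              cases j with
              | zero => exact absurd hs h1
              | succ j => exact ⟨j, by simp [pow_succ']⟩))
            refine Tame.exists_model (Or.inl (subnormalizer_eq_top_of_even hc hP hcP hyP
              (subnormalizer_eq_top_of_cyc_eq hy2 (hy.trans hy''.symm) ht))) ?_
            rw [cyc_sumCongr, hy'', hc.wreath.cyc_eq, Fintype.card_sum, hL', Multiset.singleton_add,
              pow_succ', two_mul]
      · obtain ⟨Z, _, _, z, hz, -⟩ := exists_perm_cyc R hR2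
        have hZ : Nonempty Z := by
          by_contra h
          rw [not_nonempty_iff] at h
          obtain ⟨r, hr⟩ := Multiset.exists_mem_of_ne_zero hR
          rw [← hz] at hr
          have h1 := Multiset.le_sum_of_mem hr
          have h3 := cyc_pos hr
          rw [cyc_sum, Fintype.card_eq_zero] at h1
          omega
        have hlz : cyc (Equiv.Perm.sumCongr l z) = T + R := by rw [cyc_sumCongr, hl, hz]
        refine Tame.exists_model (Or.inl (subnormalizer_eq_top_of_fill hc (two_iff_cyc.2 (by rwa [hz]))
          hP hcP hlP (subnormalizer_eq_top_of_cyc_eq hy2 (hy.trans hlz.symm) ht))) ?_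
        rw [cyc_sumCongr, hlz, hc.cyc_eq, hL, Multiset.singleton_add]
    · exfalso
      have := ht.cyc_eq
      rw [hy] at this
      have h3 : Fintype.card Y ∈ m' := by rw [this]; simp
      have := hlt _ h3
      omega
    · obtain ⟨k', c, hcs, P, hk', hP, hyP, hcP, hc, hfix, hr, hg⟩ := ht
      have : k' = k := by
        obtain ⟨r, hr, hrk⟩ := hr
        rw [hy] at hr
        have h1 := hlt r hr
        obtain ⟨j, rfl⟩ := h2' r hr
        have h3 := (Nat.pow_lt_pow_iff_right (by norm_num : 1 < 2)).1 h1
        rw [← pow_succ'] at hrk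
        have h4 := Nat.pow_right_injective le_rfl hrk
        rw [← hYs, hk'] at hsum
        have h5 := (Nat.pow_le_pow_iff_right (by norm_num : 1 < 2)).1 hsum
        omega
      subst this
      refine Tame.exists_model (y := Equiv.Perm.sumCongr c y) (Or.inr (Or.inr (wreathType_sumCongr hk' hP
            hyP hcP hc hfix (by rwa [hy]) hcs hg))) ?_
      rw [cyc_sumCongr, hy, hc.cyc_eq, hk', Multiset.singleton_add]

section Single
variable {G : Type} [Group G]

/-- Labels with a nonzero value at a cycle type. -/
abbrev LabOne (N n : ℕ) (l : List ℕ) : Type := {B : Lab N n // chi N B.1 l ≠ 0}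

/-- The values of the characters of `G` not vanishing at `y` are those of a symmetric group. -/
def LabRealOne (N n : ℕ) (y : G) (l : List ℕ) : Prop :=
  Realizes y y (fun B : LabOne N n l => chi N B.1.1 l) (fun B => chi N B.1.1 l)
    (fun B => chiVal N n B.1.1)

lemma LabReal.fst {N n : ℕ} {y c : G} {l l' : List ℕ} (h : LabReal N n y c l l') :
    LabRealOne N n y l := by
  have h1 := Realizes.restrict (Realizes.fst h) (fun B => chi N B.1.1 l ≠ 0)
    (fun B hB => by push Not at hB; exact ⟨hB, hB⟩)
  refine Realizes.reindex h1
    ⟨fun B => ⟨⟨B.1, Or.inl B.2⟩, B.2⟩, fun B => ⟨B.1.1, B.2⟩, fun B => rfl, fun B => rfl⟩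
    (fun B => ⟨1, Or.inl rfl, by simp, by simp⟩) (fun B => rfl)

lemma LabReal.snd {N n : ℕ} {y c : G} {l l' : List ℕ} (h : LabReal N n y c l l') :
    LabRealOne N n c l' := by
  have h1 := Realizes.restrict (Realizes.snd h) (fun B => chi N B.1.1 l' ≠ 0)
    (fun B hB => by push Not at hB; exact ⟨hB, hB⟩)
  refine Realizes.reindex h1
    ⟨fun B => ⟨⟨B.1, Or.inr B.2⟩, B.2⟩, fun B => ⟨B.1.1, B.2⟩, fun B => rfl, fun B => rfl⟩
    (fun B => ⟨1, Or.inl rfl, by simp, by simp⟩) (fun B => rfl)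

lemma LabRealOne.perm {N n : ℕ} {y : G} {l m : List ℕ} (h : LabRealOne N n y l) (hl : l.Perm m) :
    LabRealOne N n y m := by
  refine Realizes.reindex h (Equiv.subtypeEquivRight fun B => ?_) (fun B => ⟨1, Or.inl rfl, ?_, ?_⟩)
    (fun B => rfl)
  · rw [chi_perm hl]
  · simp [chi_perm hl]
  · simp [chi_perm hl]

end Single

section Match
variable {Ω Z : Type} [Fintype Ω] [DecidableEq Ω] [Fintype Z] [DecidableEq Z]

/-- The characters of the subnormalizer not vanishing at `x` match those of the symmetric group. -/
def Matches (x : Equiv.Perm Ω) : Prop :=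
  ∀ N, 2 * Fintype.card Ω ≤ N →
    LabRealOne N (Fintype.card Ω) (⟨x, mem_subnormalizer_self x⟩ : subnormalizer x) (cl x)

lemma Matches.of_cyc_eq {x : Equiv.Perm Ω} {y : Equiv.Perm Z} (hx : Two x) (h : cyc x = cyc y)
    (hm : Matches x) : Matches y := by
  classical
  intro N hN
  have hfin : Fintype (subnormalizer x) := Fintype.ofFinite _
  have hfin' : Fintype (subnormalizer y) := Fintype.ofFinite _
  have hcard : Fintype.card Ω = Fintype.card Z := by rw [← cyc_sum x, h, cyc_sum]
  rw [← hcard] at hN ⊢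
  obtain ⟨e, he⟩ := exists_equiv_of_cyc_eq h
  have h1 : LabRealOne _ _ _ _ :=
    Realizes.congr (hm N hN) (subnormalizerCongr e.permCongrHom hx he)
  have h2 : subnormalizerCongr e.permCongrHom hx he ⟨x, mem_subnormalizer_self x⟩ =
      ⟨y, mem_subnormalizer_self y⟩ := Subtype.ext he
  rw [h2] at h1
  exact h1.perm (cl_perm_iff.2 h)

lemma exists_labReal_fullCycle (k : ℕ) : ∃ (Y : Type) (_ : Fintype Y) (_ : DecidableEq Y)
    (c y : Equiv.Perm Y) (hy : y ∈ subnormalizer c) (l : List ℕ), Fintype.card Y = 2 ^ (k + 1) ∧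
      FullCycle c ∧ l.sum = 2 ^ (k + 1) ∧ (∀ s ∈ l, 0 < s) ∧ 2 ^ (k + 1) ∉ l ∧
      ∀ N, 2 * 2 ^ (k + 1) ≤ N → LabReal N (2 ^ (k + 1)) (⟨y, hy⟩ : subnormalizer c)
        ⟨c, mem_subnormalizer_self c⟩ l [2 ^ (k + 1)] := by
  induction k with
  | zero =>
    let c : Equiv.Perm (Unit ⊕ Unit) := Wr.perm Unit ⟨1, 1, true⟩
    have hc : FullCycle c := FullCycle.wreath fun a b => ⟨0, rfl⟩
    have ht : subnormalizer c = ⊤ := by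
      refine eq_top_iff.2 (le_subnormalizer (P := ⊤) (IsPGroup.of_card (n := 1) ?_) trivial)
      rw [Subgroup.card_top, Nat.card_eq_fintype_card, Fintype.card_perm]
      rfl
    have h1 : (1 : Equiv.Perm (Unit ⊕ Unit)) ∈ subnormalizer c := one_mem _
    refine ⟨Unit ⊕ Unit, inferInstance, inferInstance, c, 1, h1, cl (1 : Equiv.Perm (Unit ⊕ Unit)),
      rfl, hc, by rw [cl_sum]; rfl, cl_pos _, ?_, fun N hN => ?_⟩
    · rw [cl_one]
      intro h
      have := List.eq_of_mem_replicate h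
      omega
    · exact LabReal.perm_left (labReal_top ht rfl hN h1 _) (List.Perm.refl _) (hc.cl_perm rfl)
  | succ k ih =>
    obtain ⟨Y, _, _, c, y, hy, l, hY, hc, hl, hl0, hq, h⟩ := ih
    have : Nonempty Y := Fintype.card_pos_iff.1 (by rw [hY]; positivity)
    have hsub := subnormalizer_wreath_cycle hc (hc.isPGroup hY)
    have hfin : Fintype (subnormalizer c) := Fintype.ofFinite _
    have hfin' : Fintype (subnormalizer (Wr.perm Y ⟨c, 1, true⟩)) := Fintype.ofFinite _
    refine ⟨Y ⊕ Y, inferInstance, inferInstance, Wr.perm Y ⟨c, 1, true⟩,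
      Equiv.Perm.sumCongr c y, ?_, 2 ^ (k + 1) :: l, ?_, hc.wreath, ?_, ?_, ?_, ?_⟩
    · rw [hsub, ← Wr.perm_false]
      exact Wr.perm_mem_range false (mem_subnormalizer_self c) hy
    · rw [Fintype.card_sum, hY]; ring
    · rw [List.sum_cons, hl]; ring
    · intro s hs
      rcases List.mem_cons.1 hs with rfl | hs
      · positivity
      · exact hl0 s hs
    · intro hs
      have h0 : 0 < 2 ^ (k + 1) := by positivity
      rw [pow_succ _ (k + 1)] at hs
      rcases List.mem_cons.1 hs with hs | hs
      · omega
      · have := List.le_sum_of_mem hs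
        omega
    · intro N hN
      have e0 : 2 ^ (k + 1 + 1) = 2 * 2 ^ (k + 1) := pow_succ' _ _
      rw [e0] at hN ⊢
      have h1 := LabReal.wreath (by omega) hl hl0 hq (h N (by omega))
      exact Realizes.congr h1 (wreathEquiv hsub)

lemma FullCycle.matches [Nonempty Ω] {c : Equiv.Perm Ω} (hc : FullCycle c) (h2 : Two c) :
    Matches c := by
  obtain ⟨k, hk⟩ := two_iff_cyc.1 h2 (Fintype.card Ω) (by rw [hc.cyc_eq]; simp)
  cases k with
  | zero =>
    intro N hN
    have : Subsingleton Ω := Fintype.card_le_one_iff_subsingleton.1 (by rw [hk]; rfl)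
    exact (labReal_top (Subsingleton.elim _ _) rfl hN (mem_subnormalizer_self c)
      (mem_subnormalizer_self c)).fst
  | succ k =>
    obtain ⟨Y, _, _, d, y, hy, l, hY, hd, -, -, -, h⟩ := exists_labReal_fullCycle k
    have : Nonempty Y := Fintype.card_pos_iff.1 (by rw [hY]; positivity)
    refine Matches.of_cyc_eq (x := d) (hd.two hY) (by rw [hd.cyc_eq, hc.cyc_eq, hY, hk]) ?_
    intro N hN
    rw [hY] at hN ⊢
    exact (LabReal.snd (h N hN)).perm (hd.cl_perm hY).symm

lemma Tame.matches {x : Equiv.Perm Ω} (hx : Two x) (h : Tame x) : Matches x := by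
  rcases h with h | h | ⟨k, c, hc, P, hk, -, -, -, -, -, -, h⟩
  · exact fun N hN => (labReal_top h rfl hN (mem_subnormalizer_self x)
      (mem_subnormalizer_self x)).fst
  · rcases isEmpty_or_nonempty Ω with hΩ | hΩ
    · exact fun N hN => (labReal_top (Subsingleton.elim _ _) rfl hN (mem_subnormalizer_self x)
        (mem_subnormalizer_self x)).fst
    · exact h.matches hx
  · intro N hN
    rw [hk] at hN ⊢
    exact LabReal.fst (h N hN)

lemma Matches.split {k : ℕ} {a : Equiv.Perm Ω} {b : Equiv.Perm Z} (ha : Two a) (hb : Two b)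
    (hA : Fintype.card Ω < 2 ^ k) (hB : ∀ r ∈ cyc b, 2 ^ k ∣ r) (hma : Matches a)
    (hmb : Matches b) : Matches (Equiv.Perm.sumCongr a b) := by
  classical
  intro N hN
  rw [Fintype.card_sum] at hN ⊢
  have hsub := subnormalizer_split ha hb hA hB
  have hfin : Fintype (subnormalizer a) := Fintype.ofFinite _
  have hfin' : Fintype (subnormalizer b) := Fintype.ofFinite _
  have hfin'' : Fintype (subnormalizer (Equiv.Perm.sumCongr a b)) := Fintype.ofFinite _
  obtain ⟨N', hN', Φ, hΦ⟩ := split_lab hA (cl_sum a) (cl_sum b) (cl_pos a)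
    (fun s hs => ⟨cl_pos b s hs, hB s (by rw [← coe_cl]; exact hs)⟩) hN
  have h1 := Realizes.congr (Realizes.prod (hma N (by omega)) (hmb N' hN')) (splitEquiv hsub)
  have h2 : LabRealOne N (Fintype.card Ω + Fintype.card Z)
      (⟨Equiv.Perm.sumCongr a b, mem_subnormalizer_self _⟩ :
        subnormalizer (Equiv.Perm.sumCongr a b)) (cl b ++ cl a) := by
    refine Realizes.reindex h1 Φ (fun B => ?_) fun B => (hΦ B).2.symm
    obtain ⟨s, hs, h⟩ := (hΦ B).1
    refine ⟨s, hs, ?_, ?_⟩ <;>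
    · rw [h, ← mul_assoc]
      rcases hs with rfl | rfl <;> simp
  refine h2.perm ?_
  rw [← Multiset.coe_eq_coe, coe_cl, cyc_sumCongr, ← Multiset.coe_add, coe_cl, coe_cl, add_comm]

theorem Two.matches {x : Equiv.Perm Ω} (hx : Two x) : Matches x := by
  induction hn : Fintype.card Ω using Nat.strong_induction_on generalizing Ω with
  | _ n ih =>
    have h2 := two_iff_cyc.1 hx
    by_cases hu : Unsplit (cyc x)
    · obtain ⟨Y, _, _, y, hy, ht⟩ := exists_tame (cyc x) h2 hu
      have hy2 := hx.of_cyc_eq hy.symm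
      exact (ht.matches hy2).of_cyc_eq hy2 hy
    · simp only [Unsplit, not_forall, not_or, not_le] at hu
      obtain ⟨k, h0, hlt, hne⟩ := hu
      have hadd := Multiset.filter_add_not (· < 2 ^ k) (cyc x)
      obtain ⟨A, _, _, a, ha, -⟩ := exists_perm_cyc ((cyc x).filter (· < 2 ^ k))
        fun r hr => h2 r (Multiset.mem_of_mem_filter hr)
      obtain ⟨B, _, _, b, hb, -⟩ := exists_perm_cyc ((cyc x).filter (¬ · < 2 ^ k))
        fun r hr => h2 r (Multiset.mem_of_mem_filter hr)
      have ha2 : Two a := two_iff_cyc.2 (by rw [ha]; exact fun r hr => h2 r (Multiset.mem_of_mem_filter hr))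
      have hb2 : Two b := two_iff_cyc.2 (by rw [hb]; exact fun r hr => h2 r (Multiset.mem_of_mem_filter hr))
      have hab : cyc (Equiv.Perm.sumCongr a b) = cyc x := by rw [cyc_sumCongr, ha, hb, hadd]
      have hcard : Fintype.card A + Fintype.card B = n := by
        rw [← hn, ← cyc_sum x, ← hab, cyc_sum, Fintype.card_sum]
      have hApos : 0 < Fintype.card A := by
        obtain ⟨r, hr⟩ := Multiset.exists_mem_of_ne_zero h0
        rw [← ha] at hr
        rw [← cyc_sum a]
        exact (cyc_pos hr).trans_le (Multiset.le_sum_of_mem hr)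
      have hBpos : 0 < Fintype.card B := by
        have : (cyc x).filter (¬ · < 2 ^ k) ≠ 0 := by
          intro h
          rw [h, add_zero] at hadd
          exact hne hadd
        obtain ⟨r, hr⟩ := Multiset.exists_mem_of_ne_zero this
        rw [← hb] at hr
        rw [← cyc_sum b]
        exact (cyc_pos hr).trans_le (Multiset.le_sum_of_mem hr)
      refine Matches.of_cyc_eq (ha2.sumCongr hb2) hab (Matches.split (k := k) ha2 hb2 ?_ ?_
        (ih _ (by omega) ha2 rfl) (ih _ (by omega) hb2 rfl))
      · rw [← cyc_sum a, ha]; exact hlt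
      · rw [hb]
        intro r hr
        obtain ⟨h3, h4⟩ := Multiset.mem_filter.1 hr
        obtain ⟨j, rfl⟩ := h2 r h3
        exact pow_dvd_pow _ ((Nat.pow_le_pow_iff_right (by norm_num : 1 < 2)).1 (not_lt.1 h4))

end Match

section Bijection
variable {G H : Type} [Group G] [Group H]

lemma Realizes.exists_equiv_irrX {y : G} {ι : Type} {v : ι → ℤ} {d : ι → ℕ}
    (h : Realizes y y v v d) (hv : ∀ i, v i ≠ 0) :
    ∃ e : ι ≃ IrrX G y, ∀ i, ((e i).1 y = v i ∨ (e i).1 y = -v i) ∧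
      pPart 2 (charDeg (e i).1) = 2 ^ d i := by
  obtain ⟨e, hinj, hirr, hval, hdeg, hsurj⟩ := h
  have hne : ∀ i, e i y ≠ 0 := fun i => by
    obtain ⟨s, hs, h, -⟩ := hval i
    rw [h]
    rcases hs with rfl | rfl <;> simpa using hv i
  refine ⟨Equiv.ofBijective (fun i => ⟨e i, hirr i, hne i⟩) ⟨fun i j hij => hinj (congrArg Subtype.val hij),
    fun χ => ?_⟩, fun i => ⟨?_, ?_⟩⟩
  · by_contra hχ
    exact χ.2.2 (hsurj χ.1 χ.2.1 fun ⟨i, hi⟩ => hχ ⟨i, Subtype.ext hi⟩).1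
  · obtain ⟨s, hs, h, -⟩ := hval i
    rcases hs with rfl | rfl
    · exact Or.inl (h.trans (by simp))
    · exact Or.inr (h.trans (by simp))
  · obtain ⟨m, hm, h⟩ := hdeg i
    have : charDeg (e i) = m := by simp [charDeg, hm]
    change pPart 2 (charDeg (e i)) = _
    rw [this, pPart, ← h, Nat.factorization_def _ Nat.prime_two]

lemma Realizes.exists_irrX_equiv {y : G} {z : H} {ι : Type} {v : ι → ℤ}
    {d : ι → ℕ} (h : Realizes y y v v d) (h' : Realizes z z v v d) (hv : ∀ i, v i ≠ 0) :
    ∃ Γ : IrrX G y ≃ IrrX H z,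
      (∀ χ, pPart 2 (charDeg (Γ χ).1) = pPart 2 (charDeg χ.1)) ∧
      (∀ χ, (Γ χ).1 z = χ.1 y ∨ (Γ χ).1 z = - χ.1 y) := by
  obtain ⟨e, he⟩ := h.exists_equiv_irrX hv
  obtain ⟨f, hf⟩ := h'.exists_equiv_irrX hv
  refine ⟨e.symm.trans f, fun χ => ?_, fun χ => ?_⟩ <;> obtain ⟨i, rfl⟩ := e.surjective χ <;>
    simp only [Equiv.trans_apply, Equiv.symm_apply_apply]
  · rw [(he i).2, (hf i).2]
  · rcases (he i).1 with h1 | h1 <;> rcases (hf i).1 with h2 | h2 <;> simp [h1, h2]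

end Bijection

/-- Theorem B: the Subnormalizer Conjecture for symmetric groups at `p = 2`, in strong
form: for every `2`-element `x` of `S_n` there is a bijection
`Γ : Irr^x(S_n) → Irr^x(Sub_{S_n}(x))` preserving `2`-parts of degrees and values at
`x` up to sign. -/
theorem thmB (n : ℕ) (hn : 1 ≤ n) (x : Equiv.Perm (Fin n))
    (hx : ∃ k, orderOf x = 2 ^ k) :
    ∃ Γ : ↥(IrrX (Equiv.Perm (Fin n)) x) ≃
          ↥(IrrX ↥(subnormalizer x) ⟨x, mem_subnormalizer_self x⟩),
      (∀ χ, pPart 2 (charDeg (Γ χ).1) = pPart 2 (charDeg χ.1)) ∧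
      (∀ χ, (Γ χ).1 ⟨x, mem_subnormalizer_self x⟩ = χ.1 x ∨
            (Γ χ).1 ⟨x, mem_subnormalizer_self x⟩ = - χ.1 x) :=
  Realizes.exists_irrX_equiv (labReal_perm rfl le_rfl x x).fst
    ((two_of_orderOf hx).matches _ le_rfl) fun B => B.2

end
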